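/- Let n ≥ 0 and ℓ ≥ 1 be integers, let e be an integer with 2 ≤ e < ∞, let κ = (κ_1,…,κ_ℓ) ∈ Z^ℓ be a multicharge with κ_l − κ_{l+1} ≥ n for 1 ≤ l < ℓ, and let (O,t) be an e-idempotent subring of a field K. Then the integral cyclotomic Hecke algebra H_n(O,t,κ) is isomorphic as a unital O-algebra to the deformed cyclotomic quiver Hecke algebra R_n(O); equivalently, H_n(O,t,κ) is generated by elements f_i (i ∈ I^n), ψ_1,…,ψ_{n−1}, y_1,…,y_n subject only to the deformed KLR relations. -/

import Mathlib

open scoped BigOperators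
open scoped Classical

namespace Paper

/-! ## Quantum integers -/

/-- The quantum integer `[d]_x` in a field, for `d ∈ ℤ`. -/
noncomputable def qint {K : Type*} [Field K] (x : K) (d : ℤ) : K :=
  if 0 ≤ d then ∑ k ∈ Finset.range d.toNat, x ^ k
  else -∑ k ∈ Finset.range (-d).toNat, x ^ (-((k : ℤ) + 1))

/-- The quantum integer `[d]_t` in a commutative ring, for an invertible `t` and `d ∈ ℤ`. -/
def qintU {O : Type*} [CommRing O] (t : Oˣ) (d : ℤ) : O :=
  if 0 ≤ d then ∑ k ∈ Finset.range d.toNat, (t : O) ^ k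
  else -∑ k ∈ Finset.range (-d).toNat, ((t ^ (-((k : ℤ) + 1)) : Oˣ) : O)

/-! ## Nodes, multipartitions and standard tableaux -/

/-- A node `(l, r, c)`: component `l`, row `r`, column `c` (all `0`-based). -/
abbrev Node : Type := ℕ × ℕ × ℕ

/-- `nodeBelow A B` holds when `B` is strictly below `A`, i.e. `A < B` lexicographically. -/
def nodeBelow (A B : Node) : Prop :=
  A.1 < B.1 ∨ (A.1 = B.1 ∧ (A.2.1 < B.2.1 ∨ (A.2.1 = B.2.1 ∧ A.2.2 < B.2.2)))

/-- An `ℓ`-multipartition of `n`. -/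
structure Multipartition (ℓ n : ℕ) : Type where
  part : ℕ → ℕ → ℕ
  comp_bound : ∀ l, ℓ ≤ l → ∀ r, part l r = 0
  antitone : ∀ l, Antitone (part l)
  row_bound : ∀ l r, n ≤ r → part l r = 0
  size : (∑ l ∈ Finset.range ℓ, ∑ r ∈ Finset.range n, part l r) = n

/-- The diagram of a multipartition. -/
def Multipartition.diagram {ℓ n : ℕ} (μ : Multipartition ℓ n) : Set Node :=
  {A | A.2.2 < μ.part A.1 A.2.1}

/-- A standard tableau: a bijection from the diagram of its shape onto `{1, …, n}`
that increases along rows and down columns of each component (it takes the value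
`0` off the diagram, so that it is determined by its entries). -/
structure StdTableau (ℓ n : ℕ) : Type where
  shape : Multipartition ℓ n
  entry : Node → ℕ
  entry_zero : ∀ A, A ∉ shape.diagram → entry A = 0
  bijOn : Set.BijOn entry shape.diagram (Set.Icc 1 n)
  row_inc : ∀ l r c, (l, r, c + 1) ∈ shape.diagram → entry (l, r, c) < entry (l, r, c + 1)
  col_inc : ∀ l r c, (l, r + 1, c) ∈ shape.diagram → entry (l, r, c) < entry (l, r + 1, c)

/-- The node of a standard tableau containing the entry `k`. -/
noncomputable def StdTableau.node {ℓ n : ℕ} (T : StdTableau ℓ n) (k : ℕ) : Node :=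
  Function.invFunOn T.entry T.shape.diagram k

/-- The content `c_k(T) = κ_l + c - r` of the entry `k` in the tableau `T`
(`1 ≤ k ≤ n`). -/
noncomputable def content {ℓ n : ℕ} (κ : ℕ → ℤ) (T : StdTableau ℓ n) (k : ℕ) : ℤ :=
  κ (T.node k).1 + ((T.node k).2.2 : ℤ) - ((T.node k).2.1 : ℤ)

/-- The residue sequence of a standard tableau, in `I^n` with `I = ℤ/eℤ`. -/
noncomputable def resSeq {ℓ n : ℕ} (e : ℕ) (κ : ℕ → ℤ) (T : StdTableau ℓ n) :
    Fin n → ZMod e :=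
  fun k => ((content κ T (k.1 + 1) : ℤ) : ZMod e)

/-- The residue of a node. -/
def resNode (e : ℕ) (κ : ℕ → ℤ) (A : Node) : ZMod e :=
  ((κ A.1 + (A.2.2 : ℤ) - (A.2.1 : ℤ) : ℤ) : ZMod e)

/-- A set of nodes is the diagram of a multipartition (with at most `ℓ` components)
iff it is finite and downward closed in rows and columns. -/
def IsDiagramSet (ℓ : ℕ) (S : Set Node) : Prop :=
  S.Finite ∧ (∀ A ∈ S, A.1 < ℓ) ∧
    (∀ l r c, (l, r, c + 1) ∈ S → (l, r, c) ∈ S) ∧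
    (∀ l r c, (l, r + 1, c) ∈ S → (l, r, c) ∈ S)

/-- `A` is an addable node of the diagram `S`. -/
def Addable (ℓ : ℕ) (S : Set Node) (A : Node) : Prop :=
  A ∉ S ∧ IsDiagramSet ℓ (S ∪ {A})

/-- `A` is a removable node of the diagram `S`. -/
def Removable (ℓ : ℕ) (S : Set Node) (A : Node) : Prop :=
  A ∈ S ∧ IsDiagramSet ℓ (S \ {A})

/-- `d_A(S)`: the number of addable nodes of `S` of the same residue as `A` strictly
below `A`, minus the number of removable ones. -/
noncomputable def dNode (ℓ e : ℕ) (κ : ℕ → ℤ) (S : Set Node) (A : Node) : ℤ :=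
  (Set.ncard {B | Addable ℓ S B ∧ resNode e κ B = resNode e κ A ∧ nodeBelow A B} : ℤ) -
    (Set.ncard {B | Removable ℓ S B ∧ resNode e κ B = resNode e κ A ∧ nodeBelow A B} : ℤ)

/-- The Brundan–Kleshchev–Wang degree `deg_e(T)` of a standard tableau, written as the
telescoping sum of the recursion `deg_e(T) = deg_e(T↓(n-1)) + d_A(Shape(T))`. -/
noncomputable def degE {ℓ n : ℕ} (e : ℕ) (κ : ℕ → ℤ) (T : StdTableau ℓ n) : ℤ :=
  ∑ m ∈ Finset.Icc 1 n,
    dNode ℓ e κ {A | A ∈ T.shape.diagram ∧ T.entry A ≤ m} (T.node m)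

/-- The restriction of the diagram of `T` to entries `≤ m` (the diagram of `Shape(T↓m)`). -/
def restDiag {ℓ n : ℕ} (T : StdTableau ℓ n) (m : ℕ) : Set Node :=
  {A | A ∈ T.shape.diagram ∧ T.entry A ≤ m}

/-- Dominance order on standard tableaux: `domTab S T` iff `S ⊵ T`. -/
def domTab {ℓ n : ℕ} (S T : StdTableau ℓ n) : Prop :=
  ∀ m l i : ℕ,
    Set.ncard {A | A ∈ restDiag T m ∧ (A.1 < l ∨ (A.1 = l ∧ A.2.1 ≤ i))} ≤
      Set.ncard {A | A ∈ restDiag S m ∧ (A.1 < l ∨ (A.1 = l ∧ A.2.1 ≤ i))}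

/-- Interchange the entries `r` and `r + 1` in an entry function. -/
def swapEntry (f : Node → ℕ) (r : ℕ) : Node → ℕ :=
  fun A => if f A = r then r + 1 else if f A = r + 1 then r else f A

/-- `ρ_r(T) = c_r(T) - c_{r+1}(T)`, the axial distance. -/
noncomputable def rhoTab {ℓ n : ℕ} (κ : ℕ → ℤ) (T : StdTableau ℓ n) (r : ℕ) : ℤ :=
  content κ T r - content κ T (r + 1)

/-- The entry function of the row-reading initial tableau `t^λ`. -/
noncomputable def tlamEntry {ℓ n : ℕ} (μ : Multipartition ℓ n) (A : Node) : ℕ :=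
  if A ∈ μ.diagram then
    (∑ l ∈ Finset.range A.1, ∑ r ∈ Finset.range n, μ.part l r) +
      (∑ r ∈ Finset.range A.2.1, μ.part A.1 r) + A.2.2 + 1
  else 0

/-- The finite set of possible contents of standard tableaux of size `n`. -/
noncomputable def contFinset (ℓ n : ℕ) (κ : ℕ → ℤ) : Finset ℤ :=
  ((Finset.range ℓ ×ˢ Finset.range n ×ˢ Finset.range n).image
      (fun x => κ x.1 + (x.2.2 : ℤ) - (x.2.1 : ℤ))).filter
    (fun c => ∃ T : StdTableau ℓ n, ∃ k, 1 ≤ k ∧ k ≤ n ∧ content κ T k = c)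

/-- The standard tableau (if any) obtained from `T` by interchanging the entries
`r` and `r + 1`; i.e. `T·s_r` if it is standard, and `none` otherwise. -/
noncomputable def oSwapO {ℓ n : ℕ} (T : StdTableau ℓ n) (r : ℕ) :
    Option (StdTableau ℓ n) :=
  if h : ∃ V : StdTableau ℓ n, V.entry = swapEntry T.entry r then some (Classical.choose h)
  else none

/-- `oSwap` extended to `Option`. -/
noncomputable def oSwap {ℓ n : ℕ} (X : Option (StdTableau ℓ n)) (r : ℕ) :
    Option (StdTableau ℓ n) :=
  X.bind fun T => oSwapO T r

/-- Evaluate a seminormal coefficient system on an optional tableau (by `0` if none). -/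
noncomputable def aE {ℓ n : ℕ} {K : Type*} [Field K] (α : ℕ → StdTableau ℓ n → K) (r : ℕ)
    (X : Option (StdTableau ℓ n)) : K :=
  X.elim 0 (α r)

/-! ## Separation and idempotent subrings -/

/-- `(K, t)` separates `Std(P_n)` (field version):
`[n]!_t ∏_{1 ≤ l < m ≤ ℓ} ∏_{-n < d < n} [κ_l - κ_m + d]_t ≠ 0`. -/
def SeparatesF {K : Type*} [Field K] (t : Kˣ) (n ℓ : ℕ) (κ : ℕ → ℤ) : Prop :=
  ((∏ d ∈ Finset.Icc 1 n, qint (t : K) (d : ℤ)) *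
      ∏ l ∈ Finset.range ℓ, ∏ m ∈ Finset.Ioo l ℓ,
        ∏ d ∈ Finset.Ioo (-(n : ℤ)) (n : ℤ), qint (t : K) (κ l - κ m + d)) ≠ 0

/-- `(O, t)` separates `Std(P_n)` (subring version): the separation element is a unit. -/
def SeparatesU {O : Type*} [CommRing O] (t : Oˣ) (n ℓ : ℕ) (κ : ℕ → ℤ) : Prop :=
  IsUnit ((∏ d ∈ Finset.Icc 1 n, qintU t (d : ℤ)) *
      ∏ l ∈ Finset.range ℓ, ∏ m ∈ Finset.Ioo l ℓ,
        ∏ d ∈ Finset.Ioo (-(n : ℤ)) (n : ℤ), qintU t (κ l - κ m + d))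

/-- `(O, t)` is an `e`-idempotent subring of the field `K`. -/
def IsIdempotentSubring {K : Type*} [Field K] (O : Subring K) (t : Oˣ) (e n ℓ : ℕ)
    (κ : ℕ → ℤ) : Prop :=
  SeparatesU t n ℓ κ ∧
    (∀ k : ℤ, ¬(e : ℤ) ∣ k → IsUnit (qintU t k)) ∧
    (∀ k : ℤ, (e : ℤ) ∣ k → qintU t k ∈ Ideal.jacobson (⊥ : Ideal O))

/-! ## The cyclotomic Hecke algebra, by generators and relations -/

/-- Generators `L_1, …, L_n`, `T_1, …, T_{n-1}` (here `0`-based). -/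
inductive HeckeGen (n : ℕ) : Type
  | L : Fin n → HeckeGen n
  | T : Fin (n - 1) → HeckeGen n

/-- The position `r` of the pair `(r, r+1)` interchanged by the `r`-th transposition. -/
def pL {n : ℕ} (r : Fin (n - 1)) : Fin n := ⟨r.1, by have := r.2; omega⟩

/-- The position `r + 1` of the pair interchanged by the `r`-th transposition. -/
def pR {n : ℕ} (r : Fin (n - 1)) : Fin n := ⟨r.1 + 1, by have := r.2; omega⟩

/-- The position `r + 2`, used in braid relations. -/
def pM {n : ℕ} (r : Fin (n - 1)) (hr : r.1 + 1 < n - 1) : Fin n := ⟨r.1 + 2, by omega⟩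

/-- The free algebra generator `L_k`. -/
def hL (R : Type*) [CommRing R] {n : ℕ} (k : Fin n) : FreeAlgebra R (HeckeGen n) :=
  FreeAlgebra.ι R (HeckeGen.L k)

/-- The free algebra generator `T_r`. -/
def hT (R : Type*) [CommRing R] {n : ℕ} (r : Fin (n - 1)) : FreeAlgebra R (HeckeGen n) :=
  FreeAlgebra.ι R (HeckeGen.T r)

/-- The defining relations of the integral cyclotomic Hecke algebra `H_n(R, t, κ)`. -/
inductive HeckeRel (R : Type*) [CommRing R] (t : Rˣ) (n ℓ : ℕ) (κ : ℕ → ℤ) :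
    FreeAlgebra R (HeckeGen n) → FreeAlgebra R (HeckeGen n) → Prop
  | cyc (h : 0 < n) :
      HeckeRel R t n ℓ κ
        (((List.range ℓ).map fun l =>
          hL R (⟨0, h⟩ : Fin n) - algebraMap R _ (qintU t (κ l))).prod) 0
  | quad (r : Fin (n - 1)) :
      HeckeRel R t n ℓ κ ((hT R r + 1) * (hT R r - algebraMap R _ (t : R))) 0
  | LL (k m : Fin n) : HeckeRel R t n ℓ κ (hL R k * hL R m) (hL R m * hL R k)
  | TTfar (r s : Fin (n - 1)) (h : r.1 + 1 < s.1 ∨ s.1 + 1 < r.1) :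
      HeckeRel R t n ℓ κ (hT R r * hT R s) (hT R s * hT R r)
  | braid (r s : Fin (n - 1)) (h : s.1 = r.1 + 1) :
      HeckeRel R t n ℓ κ (hT R r * hT R s * hT R r) (hT R s * hT R r * hT R s)
  | TL (r : Fin (n - 1)) (k : Fin n) (h : k.1 ≠ r.1 ∧ k.1 ≠ r.1 + 1) :
      HeckeRel R t n ℓ κ (hT R r * hL R k) (hL R k * hT R r)
  | LT (r : Fin (n - 1)) :
      HeckeRel R t n ℓ κ (hL R (pR r) * (hT R r - algebraMap R _ (t : R) + 1))
        (hT R r * hL R (pL r) + 1)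

/-- The integral cyclotomic Hecke algebra of type `A`, `H_n(R, t, κ)`. -/
noncomputable abbrev CycHecke (R : Type*) [CommRing R] (t : Rˣ) (n ℓ : ℕ) (κ : ℕ → ℤ) :
    Type _ :=
  RingQuot (HeckeRel R t n ℓ κ)

/-- The generator `L_k` of the cyclotomic Hecke algebra. -/
noncomputable def Lgen (R : Type*) [CommRing R] (t : Rˣ) (n ℓ : ℕ) (κ : ℕ → ℤ)
    (k : Fin n) : CycHecke R t n ℓ κ :=
  RingQuot.mkAlgHom R (HeckeRel R t n ℓ κ) (hL R k)

/-- The generator `T_r` of the cyclotomic Hecke algebra. -/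
noncomputable def Tgen (R : Type*) [CommRing R] (t : Rˣ) (n ℓ : ℕ) (κ : ℕ → ℤ)
    (r : Fin (n - 1)) : CycHecke R t n ℓ κ :=
  RingQuot.mkAlgHom R (HeckeRel R t n ℓ κ) (hT R r)

end Paper
/-! ## Quiver Hecke (KLR) algebras, by generators and relations -/

namespace Paper

/-- Generators `e(i)` (`i ∈ I^n`), `ψ_1, …, ψ_{n-1}`, `y_1, …, y_n` (here `0`-based). -/
inductive KLRGen (n e : ℕ) : Type
  | idem : (Fin n → ZMod e) → KLRGen n e
  | psi : Fin (n - 1) → KLRGen n e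
  | y : Fin n → KLRGen n e

/-- The free algebra generator `e(i)`. -/
def kE (R : Type*) [CommRing R] {n e : ℕ} (i : Fin n → ZMod e) :
    FreeAlgebra R (KLRGen n e) :=
  FreeAlgebra.ι R (KLRGen.idem i)

/-- The free algebra generator `ψ_r`. -/
def kPsi (R : Type*) [CommRing R] {n e : ℕ} (r : Fin (n - 1)) :
    FreeAlgebra R (KLRGen n e) :=
  FreeAlgebra.ι R (KLRGen.psi r)

/-- The free algebra generator `y_k`. -/
def kY (R : Type*) [CommRing R] {n e : ℕ} (k : Fin n) : FreeAlgebra R (KLRGen n e) :=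
  FreeAlgebra.ι R (KLRGen.y k)

/-- `s_r · i`: interchange the entries of `i` at positions `r` and `r + 1`. -/
def swapSeq {n e : ℕ} (i : Fin n → ZMod e) (r : Fin (n - 1)) : Fin n → ZMod e :=
  fun k => if k = pL r then i (pR r) else if k = pR r then i (pL r) else i k

/-- The defining relations of the cyclotomic quiver Hecke algebra `R_n^Λ(R)` where
`Λ = Σ_l Λ_{κ_l mod e}`. -/
inductive KLRRel (R : Type*) [CommRing R] (n e ℓ : ℕ) [NeZero e] (κ : ℕ → ℤ) :
    FreeAlgebra R (KLRGen n e) → FreeAlgebra R (KLRGen n e) → Prop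
  | cyc (h : 0 < n) (i : Fin n → ZMod e) :
      KLRRel R n e ℓ κ
        ((kY R (⟨0, h⟩ : Fin n)) ^
            (((Finset.range ℓ).filter fun l => ((κ l : ZMod e) = i ⟨0, h⟩)).card) *
          kE R i) 0
  | orth (i j : Fin n → ZMod e) (h : i ≠ j) : KLRRel R n e ℓ κ (kE R i * kE R j) 0
  | idem (i : Fin n → ZMod e) : KLRRel R n e ℓ κ (kE R i * kE R i) (kE R i)
  | complete : KLRRel R n e ℓ κ (∑ i : Fin n → ZMod e, kE R i) 1
  | yE (k : Fin n) (i : Fin n → ZMod e) :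
      KLRRel R n e ℓ κ (kY R k * kE R i) (kE R i * kY R k)
  | psiE (r : Fin (n - 1)) (i : Fin n → ZMod e) :
      KLRRel R n e ℓ κ (kPsi R r * kE R i) (kE R (swapSeq i r) * kPsi R r)
  | yy (k m : Fin n) : KLRRel R n e ℓ κ (kY R k * kY R m) (kY R m * kY R k)
  | psiyEq (r : Fin (n - 1)) (i : Fin n → ZMod e) (h : i (pL r) = i (pR r)) :
      KLRRel R n e ℓ κ (kPsi R r * kY R (pR r) * kE R i)
        ((kY R (pL r) * kPsi R r + 1) * kE R i)
  | psiyNe (r : Fin (n - 1)) (i : Fin n → ZMod e) (h : i (pL r) ≠ i (pR r)) :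
      KLRRel R n e ℓ κ (kPsi R r * kY R (pR r) * kE R i)
        (kY R (pL r) * kPsi R r * kE R i)
  | ypsiEq (r : Fin (n - 1)) (i : Fin n → ZMod e) (h : i (pL r) = i (pR r)) :
      KLRRel R n e ℓ κ (kY R (pR r) * kPsi R r * kE R i)
        ((kPsi R r * kY R (pL r) + 1) * kE R i)
  | ypsiNe (r : Fin (n - 1)) (i : Fin n → ZMod e) (h : i (pL r) ≠ i (pR r)) :
      KLRRel R n e ℓ κ (kY R (pR r) * kPsi R r * kE R i)
        (kPsi R r * kY R (pL r) * kE R i)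
  | psiyFar (r : Fin (n - 1)) (k : Fin n) (h : k.1 ≠ r.1 ∧ k.1 ≠ r.1 + 1) :
      KLRRel R n e ℓ κ (kPsi R r * kY R k) (kY R k * kPsi R r)
  | psipsiFar (r s : Fin (n - 1)) (h : r.1 + 1 < s.1 ∨ s.1 + 1 < r.1) :
      KLRRel R n e ℓ κ (kPsi R r * kPsi R s) (kPsi R s * kPsi R r)
  | quadEq (r : Fin (n - 1)) (i : Fin n → ZMod e) (h : i (pL r) = i (pR r)) :
      KLRRel R n e ℓ κ (kPsi R r ^ 2 * kE R i) 0
  | quadR (r : Fin (n - 1)) (i : Fin n → ZMod e)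
      (h1 : i (pR r) = i (pL r) + 1) (h2 : i (pL r) ≠ i (pR r) + 1) :
      KLRRel R n e ℓ κ (kPsi R r ^ 2 * kE R i) ((kY R (pL r) - kY R (pR r)) * kE R i)
  | quadL (r : Fin (n - 1)) (i : Fin n → ZMod e)
      (h1 : i (pL r) = i (pR r) + 1) (h2 : i (pR r) ≠ i (pL r) + 1) :
      KLRRel R n e ℓ κ (kPsi R r ^ 2 * kE R i) ((kY R (pR r) - kY R (pL r)) * kE R i)
  | quadBoth (r : Fin (n - 1)) (i : Fin n → ZMod e)
      (h1 : i (pR r) = i (pL r) + 1) (h2 : i (pL r) = i (pR r) + 1) :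
      KLRRel R n e ℓ κ (kPsi R r ^ 2 * kE R i)
        ((kY R (pR r) - kY R (pL r)) * (kY R (pL r) - kY R (pR r)) * kE R i)
  | quadNone (r : Fin (n - 1)) (i : Fin n → ZMod e) (h1 : i (pL r) ≠ i (pR r))
      (h2 : i (pR r) ≠ i (pL r) + 1) (h3 : i (pL r) ≠ i (pR r) + 1) :
      KLRRel R n e ℓ κ (kPsi R r ^ 2 * kE R i) (kE R i)
  | braidR (r : Fin (n - 1)) (hr : r.1 + 1 < n - 1) (i : Fin n → ZMod e)
      (h0 : i (pM r hr) = i (pL r)) (h1 : i (pR r) = i (pL r) + 1)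
      (h2 : i (pL r) ≠ i (pR r) + 1) :
      KLRRel R n e ℓ κ (kPsi R r * kPsi R ⟨r.1 + 1, hr⟩ * kPsi R r * kE R i)
        ((kPsi R ⟨r.1 + 1, hr⟩ * kPsi R r * kPsi R ⟨r.1 + 1, hr⟩ - 1) * kE R i)
  | braidL (r : Fin (n - 1)) (hr : r.1 + 1 < n - 1) (i : Fin n → ZMod e)
      (h0 : i (pM r hr) = i (pL r)) (h1 : i (pL r) = i (pR r) + 1)
      (h2 : i (pR r) ≠ i (pL r) + 1) :
      KLRRel R n e ℓ κ (kPsi R r * kPsi R ⟨r.1 + 1, hr⟩ * kPsi R r * kE R i)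
        ((kPsi R ⟨r.1 + 1, hr⟩ * kPsi R r * kPsi R ⟨r.1 + 1, hr⟩ + 1) * kE R i)
  | braidBoth (r : Fin (n - 1)) (hr : r.1 + 1 < n - 1) (i : Fin n → ZMod e)
      (h0 : i (pM r hr) = i (pL r)) (h1 : i (pR r) = i (pL r) + 1)
      (h2 : i (pL r) = i (pR r) + 1) :
      KLRRel R n e ℓ κ (kPsi R r * kPsi R ⟨r.1 + 1, hr⟩ * kPsi R r * kE R i)
        ((kPsi R ⟨r.1 + 1, hr⟩ * kPsi R r * kPsi R ⟨r.1 + 1, hr⟩ +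
            kY R (pL r) - 2 * kY R (pR r) + kY R (pM r hr)) * kE R i)
  | braidNone (r : Fin (n - 1)) (hr : r.1 + 1 < n - 1) (i : Fin n → ZMod e)
      (h : ¬(i (pM r hr) = i (pL r) ∧
        (i (pR r) = i (pL r) + 1 ∨ i (pL r) = i (pR r) + 1))) :
      KLRRel R n e ℓ κ (kPsi R r * kPsi R ⟨r.1 + 1, hr⟩ * kPsi R r * kE R i)
        (kPsi R ⟨r.1 + 1, hr⟩ * kPsi R r * kPsi R ⟨r.1 + 1, hr⟩ * kE R i)

/-- The cyclotomic quiver Hecke algebra `R_n^Λ(R)`, `Λ = Σ_l Λ_{κ_l mod e}`. -/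
noncomputable abbrev KLR (R : Type*) [CommRing R] (n e ℓ : ℕ) [NeZero e] (κ : ℕ → ℤ) :
    Type _ :=
  RingQuot (KLRRel R n e ℓ κ)

/-- The generator `e(i)` of the cyclotomic quiver Hecke algebra. -/
noncomputable def KeGen (R : Type*) [CommRing R] (n e ℓ : ℕ) [NeZero e] (κ : ℕ → ℤ)
    (i : Fin n → ZMod e) : KLR R n e ℓ κ :=
  RingQuot.mkAlgHom R (KLRRel R n e ℓ κ) (kE R i)

/-- The generator `ψ_r` of the cyclotomic quiver Hecke algebra. -/
noncomputable def KpsiGen (R : Type*) [CommRing R] (n e ℓ : ℕ) [NeZero e] (κ : ℕ → ℤ)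
    (r : Fin (n - 1)) : KLR R n e ℓ κ :=
  RingQuot.mkAlgHom R (KLRRel R n e ℓ κ) (kPsi R r)

/-- The generator `y_k` of the cyclotomic quiver Hecke algebra. -/
noncomputable def KyGen (R : Type*) [CommRing R] (n e ℓ : ℕ) [NeZero e] (κ : ℕ → ℤ)
    (k : Fin n) : KLR R n e ℓ κ :=
  RingQuot.mkAlgHom R (KLRRel R n e ℓ κ) (kY R k)

end Paper
/-! ## The deformed cyclotomic quiver Hecke algebra -/

namespace Paper

/-- `y_k^⟨d⟩ = t^d y_k + [d]_t` in the free algebra. -/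
def ydot (R : Type*) [CommRing R] (t : Rˣ) {n e : ℕ} (d : ℤ) (k : Fin n) :
    FreeAlgebra R (KLRGen n e) :=
  algebraMap R _ ((t ^ d : Rˣ) : R) * kY R k + algebraMap R _ (qintU t d)

/-- `ρ_r(i) = î_r - î_{r+1}` for `i ∈ I^n`. -/
def rhoI {n e : ℕ} (i : Fin n → ZMod e) (r : Fin (n - 1)) : ℤ :=
  ((i (pL r)).val : ℤ) - ((i (pR r)).val : ℤ)

/-- The defining relations of the deformed cyclotomic quiver Hecke algebra `R_n(O)`. -/
inductive DefKLRRel (R : Type*) [CommRing R] (t : Rˣ) (n e ℓ : ℕ) [NeZero e] (κ : ℕ → ℤ) :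
    FreeAlgebra R (KLRGen n e) → FreeAlgebra R (KLRGen n e) → Prop
  | cyc (h : 0 < n) (i : Fin n → ZMod e) :
      DefKLRRel R t n e ℓ κ
        ((((List.range ℓ).map fun l =>
            if ((κ l : ZMod e) = i ⟨0, h⟩) then
              kY R (⟨0, h⟩ : Fin n) -
                algebraMap R _ (qintU t (κ l - ((i ⟨0, h⟩).val : ℤ)))
            else 1).prod) * kE R i) 0
  | orth (i j : Fin n → ZMod e) (h : i ≠ j) : DefKLRRel R t n e ℓ κ (kE R i * kE R j) 0
  | idem (i : Fin n → ZMod e) : DefKLRRel R t n e ℓ κ (kE R i * kE R i) (kE R i)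
  | complete : DefKLRRel R t n e ℓ κ (∑ i : Fin n → ZMod e, kE R i) 1
  | yE (k : Fin n) (i : Fin n → ZMod e) :
      DefKLRRel R t n e ℓ κ (kY R k * kE R i) (kE R i * kY R k)
  | psiE (r : Fin (n - 1)) (i : Fin n → ZMod e) :
      DefKLRRel R t n e ℓ κ (kPsi R r * kE R i) (kE R (swapSeq i r) * kPsi R r)
  | yy (k m : Fin n) : DefKLRRel R t n e ℓ κ (kY R k * kY R m) (kY R m * kY R k)
  | psiyEq (r : Fin (n - 1)) (i : Fin n → ZMod e) (h : i (pL r) = i (pR r)) :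
      DefKLRRel R t n e ℓ κ (kPsi R r * kY R (pR r) * kE R i)
        ((kY R (pL r) * kPsi R r + 1) * kE R i)
  | psiyNe (r : Fin (n - 1)) (i : Fin n → ZMod e) (h : i (pL r) ≠ i (pR r)) :
      DefKLRRel R t n e ℓ κ (kPsi R r * kY R (pR r) * kE R i)
        (kY R (pL r) * kPsi R r * kE R i)
  | ypsiEq (r : Fin (n - 1)) (i : Fin n → ZMod e) (h : i (pL r) = i (pR r)) :
      DefKLRRel R t n e ℓ κ (kY R (pR r) * kPsi R r * kE R i)
        ((kPsi R r * kY R (pL r) + 1) * kE R i)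
  | ypsiNe (r : Fin (n - 1)) (i : Fin n → ZMod e) (h : i (pL r) ≠ i (pR r)) :
      DefKLRRel R t n e ℓ κ (kY R (pR r) * kPsi R r * kE R i)
        (kPsi R r * kY R (pL r) * kE R i)
  | psiyFar (r : Fin (n - 1)) (k : Fin n) (h : k.1 ≠ r.1 ∧ k.1 ≠ r.1 + 1) :
      DefKLRRel R t n e ℓ κ (kPsi R r * kY R k) (kY R k * kPsi R r)
  | psipsiFar (r s : Fin (n - 1)) (h : r.1 + 1 < s.1 ∨ s.1 + 1 < r.1) :
      DefKLRRel R t n e ℓ κ (kPsi R r * kPsi R s) (kPsi R s * kPsi R r)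
  | quadEq (r : Fin (n - 1)) (i : Fin n → ZMod e) (h : i (pL r) = i (pR r)) :
      DefKLRRel R t n e ℓ κ (kPsi R r ^ 2 * kE R i) 0
  | quadR (r : Fin (n - 1)) (i : Fin n → ZMod e)
      (h1 : i (pR r) = i (pL r) + 1) (h2 : i (pL r) ≠ i (pR r) + 1) :
      DefKLRRel R t n e ℓ κ (kPsi R r ^ 2 * kE R i)
        ((ydot R t (1 + rhoI i r) (pL r) - kY R (pR r)) * kE R i)
  | quadL (r : Fin (n - 1)) (i : Fin n → ZMod e)
      (h1 : i (pL r) = i (pR r) + 1) (h2 : i (pR r) ≠ i (pL r) + 1) :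
      DefKLRRel R t n e ℓ κ (kPsi R r ^ 2 * kE R i)
        ((ydot R t (1 - rhoI i r) (pR r) - kY R (pL r)) * kE R i)
  | quadBoth (r : Fin (n - 1)) (i : Fin n → ZMod e)
      (h1 : i (pR r) = i (pL r) + 1) (h2 : i (pL r) = i (pR r) + 1) :
      DefKLRRel R t n e ℓ κ (kPsi R r ^ 2 * kE R i)
        ((ydot R t (1 + rhoI i r) (pL r) - kY R (pR r)) *
          (ydot R t (1 - rhoI i r) (pR r) - kY R (pL r)) * kE R i)
  | quadNone (r : Fin (n - 1)) (i : Fin n → ZMod e) (h1 : i (pL r) ≠ i (pR r))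
      (h2 : i (pR r) ≠ i (pL r) + 1) (h3 : i (pL r) ≠ i (pR r) + 1) :
      DefKLRRel R t n e ℓ κ (kPsi R r ^ 2 * kE R i) (kE R i)
  | braidBoth (r : Fin (n - 1)) (hr : r.1 + 1 < n - 1) (i : Fin n → ZMod e)
      (h0 : i (pM r hr) = i (pL r)) (h1 : i (pR r) = i (pL r) + 1)
      (h2 : i (pL r) = i (pR r) + 1) :
      DefKLRRel R t n e ℓ κ
        ((kPsi R r * kPsi R ⟨r.1 + 1, hr⟩ * kPsi R r -
            kPsi R ⟨r.1 + 1, hr⟩ * kPsi R r * kPsi R ⟨r.1 + 1, hr⟩) * kE R i)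
        ((ydot R t (1 + rhoI i r) (pL r) + ydot R t (1 + rhoI i r) (pM r hr) -
            ydot R t (1 + rhoI i r) (pR r) - ydot R t (1 - rhoI i r) (pR r)) * kE R i)
  | braidR (r : Fin (n - 1)) (hr : r.1 + 1 < n - 1) (i : Fin n → ZMod e)
      (h0 : i (pM r hr) = i (pL r)) (h1 : i (pR r) = i (pL r) + 1)
      (h2 : i (pL r) ≠ i (pR r) + 1) :
      DefKLRRel R t n e ℓ κ
        ((kPsi R r * kPsi R ⟨r.1 + 1, hr⟩ * kPsi R r -
            kPsi R ⟨r.1 + 1, hr⟩ * kPsi R r * kPsi R ⟨r.1 + 1, hr⟩) * kE R i)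
        (algebraMap R _ (-(((t ^ (1 + rhoI i r) : Rˣ) : R))) * kE R i)
  | braidL (r : Fin (n - 1)) (hr : r.1 + 1 < n - 1) (i : Fin n → ZMod e)
      (h0 : i (pM r hr) = i (pL r)) (h1 : i (pL r) = i (pR r) + 1)
      (h2 : i (pR r) ≠ i (pL r) + 1) :
      DefKLRRel R t n e ℓ κ
        ((kPsi R r * kPsi R ⟨r.1 + 1, hr⟩ * kPsi R r -
            kPsi R ⟨r.1 + 1, hr⟩ * kPsi R r * kPsi R ⟨r.1 + 1, hr⟩) * kE R i)
        (kE R i)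
  | braidNone (r : Fin (n - 1)) (hr : r.1 + 1 < n - 1) (i : Fin n → ZMod e)
      (h : ¬(i (pM r hr) = i (pL r) ∧
        (i (pR r) = i (pL r) + 1 ∨ i (pL r) = i (pR r) + 1))) :
      DefKLRRel R t n e ℓ κ
        ((kPsi R r * kPsi R ⟨r.1 + 1, hr⟩ * kPsi R r -
            kPsi R ⟨r.1 + 1, hr⟩ * kPsi R r * kPsi R ⟨r.1 + 1, hr⟩) * kE R i) 0

/-- The deformed cyclotomic quiver Hecke algebra `R_n(R)`. -/
noncomputable abbrev DefKLR (R : Type*) [CommRing R] (t : Rˣ) (n e ℓ : ℕ) [NeZero e]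
    (κ : ℕ → ℤ) : Type _ :=
  RingQuot (DefKLRRel R t n e ℓ κ)

/-- The generator `f_i` of the deformed cyclotomic quiver Hecke algebra. -/
noncomputable def DfGen (R : Type*) [CommRing R] (t : Rˣ) (n e ℓ : ℕ) [NeZero e]
    (κ : ℕ → ℤ) (i : Fin n → ZMod e) : DefKLR R t n e ℓ κ :=
  RingQuot.mkAlgHom R (DefKLRRel R t n e ℓ κ) (kE R i)

/-- The generator `ψ_r` of the deformed cyclotomic quiver Hecke algebra. -/
noncomputable def DpsiGen (R : Type*) [CommRing R] (t : Rˣ) (n e ℓ : ℕ) [NeZero e]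
    (κ : ℕ → ℤ) (r : Fin (n - 1)) : DefKLR R t n e ℓ κ :=
  RingQuot.mkAlgHom R (DefKLRRel R t n e ℓ κ) (kPsi R r)

/-- The generator `y_k` of the deformed cyclotomic quiver Hecke algebra. -/
noncomputable def DyGen (R : Type*) [CommRing R] (t : Rˣ) (n e ℓ : ℕ) [NeZero e]
    (κ : ℕ → ℤ) (k : Fin n) : DefKLR R t n e ℓ κ :=
  RingQuot.mkAlgHom R (DefKLRRel R t n e ℓ κ) (kY R k)

/-! ## Seminormal idempotents -/

/-- The seminormal idempotent `F_T` of the semisimple cyclotomic Hecke algebra: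
`F_T = ∏_{k=1}^n ∏_{c ∈ Cont(n), [c_k(T)] ≠ [c]} (L_k - [c]) / ([c_k(T)] - [c])`. -/
noncomputable def Fidem (K : Type*) [Field K] (tK : Kˣ) (n ℓ : ℕ) (κ : ℕ → ℤ)
    (T : StdTableau ℓ n) : CycHecke K tK n ℓ κ :=
  ((List.finRange n).map (fun k =>
    (((contFinset ℓ n κ).sort (· ≤ ·)).map (fun c =>
      if qint (tK : K) (content κ T (k.1 + 1)) ≠ qint (tK : K) c then
        (Lgen K tK n ℓ κ k - algebraMap K _ (qint (tK : K) c)) *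
          algebraMap K _ ((qint (tK : K) (content κ T (k.1 + 1)) - qint (tK : K) c)⁻¹)
      else 1)).prod)).prod

/-- The residue idempotent `f_i = Σ_{T ∈ Std(i)} F_T`. -/
noncomputable def fres (K : Type*) [Field K] (tK : Kˣ) (n ℓ e : ℕ) (κ : ℕ → ℤ)
    (i : Fin n → ZMod e) : CycHecke K tK n ℓ κ :=
  ∑ᶠ T : {T : StdTableau ℓ n // resSeq e κ T = i}, Fidem K tK n ℓ κ T.1

/-- The simultaneous two-sided eigenspace `H_{S,T}` of the Jucys–Murphy elements. -/
noncomputable def eigSub (K : Type*) [Field K] (tK : Kˣ) (n ℓ : ℕ) (κ : ℕ → ℤ)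
    (S T : StdTableau ℓ n) : Submodule K (CycHecke K tK n ℓ κ) where
  carrier := {h | ∀ k : Fin n,
      Lgen K tK n ℓ κ k * h = qint (tK : K) (content κ S (k.1 + 1)) • h ∧
      h * Lgen K tK n ℓ κ k = qint (tK : K) (content κ T (k.1 + 1)) • h}
  add_mem' := by
    intro a b ha hb
    intro k
    obtain ⟨h1, h2⟩ := ha k
    obtain ⟨h3, h4⟩ := hb k
    exact ⟨by rw [mul_add, h1, h3, smul_add], by rw [add_mul, h2, h4, smul_add]⟩
  zero_mem' := by intro k; simp
  smul_mem' := by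
    intro c a ha
    intro k
    obtain ⟨h1, h2⟩ := ha k
    constructor
    · rw [mul_smul_comm, h1, smul_comm]
    · rw [smul_mul_assoc, h2, smul_comm]

end Paper

open scoped BigOperators
open scoped Classical
namespace Paper

section Numerics
variable {O : Type*} [CommRing O] (t : Oˣ)

theorem qintU_zero : qintU t 0 = 0 := by simp [qintU]

theorem qintU_add_one (d : ℤ) : qintU t (d + 1) = qintU t d + ((t ^ d : Oˣ) : O) := by
  unfold qintU
  rcases lt_or_ge d 0 with h | h
  · obtain ⟨k, rfl⟩ : ∃ k : ℕ, d = -((k : ℤ) + 1) := ⟨(-d - 1).toNat, by omega⟩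
    rw [if_neg (by omega : ¬ (0 ≤ -((k : ℤ) + 1)))]
    have e1 : (-(-((k : ℤ) + 1))).toNat = k + 1 := by omega
    rw [e1, Finset.sum_range_succ]
    rcases Nat.eq_zero_or_pos k with h0 | h0
    · subst h0
      simp
    · rw [if_neg (by omega)]
      have e2 : (-(-((k : ℤ) + 1) + 1)).toNat = k := by omega
      rw [e2]
      ring
  · obtain ⟨k, rfl⟩ := Int.eq_ofNat_of_zero_le h
    rw [if_pos (by omega), if_pos (by omega)]
    have e1 : ((k : ℤ) + 1).toNat = k + 1 := by omega
    rw [e1, Finset.sum_range_succ]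
    simp

theorem qintU_add (b k : ℤ) :
    qintU t (b + k) = qintU t b + ((t ^ b : Oˣ) : O) * qintU t k := by
  induction k using Int.induction_on with
  | zero => simp [qintU_zero]
  | succ i ih =>
    rw [← add_assoc, qintU_add_one, ih, qintU_add_one, zpow_add, Units.val_mul]
    ring
  | pred i ih =>
    have h1 := qintU_add_one t (b + (-(i : ℤ) - 1))
    have h2 := qintU_add_one t (-(i : ℤ) - 1)
    rw [show b + (-(i : ℤ) - 1) + 1 = b + -(i : ℤ) by ring, ih, zpow_add, Units.val_mul] at h1
    rw [show (-(i : ℤ) - 1) + 1 = -(i : ℤ) by ring] at h2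
    rw [h2] at h1
    linear_combination -h1

theorem qintU_one : qintU t 1 = 1 := by simp [qintU]

theorem qintU_succ (d : ℤ) : qintU t (d + 1) = (t : O) * qintU t d + 1 := by
  rw [add_comm, qintU_add, qintU_one]
  simp [add_comm]

theorem qintU_pow (d : ℤ) : ((t ^ d : Oˣ) : O) = 1 + ((t : O) - 1) * qintU t d := by
  have h1 := qintU_succ t d
  rw [qintU_add_one] at h1
  linear_combination h1

theorem qintU_sub (a b : ℤ) :
    qintU t a - qintU t b = ((t ^ b : Oˣ) : O) * qintU t (a - b) := by
  have := qintU_add t b (a - b)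
  rw [show b + (a - b) = a by ring] at this
  linear_combination this

variable (e : ℕ)

theorem isUnit_qsub (hU : ∀ k : ℤ, ¬(e : ℤ) ∣ k → IsUnit (qintU t k)) (a b : ℤ)
    (h : (a : ZMod e) ≠ (b : ZMod e)) : IsUnit (qintU t a - qintU t b) := by
  rw [qintU_sub]
  refine (Units.isUnit _).mul (hU _ ?_)
  intro h1
  apply h
  rw [← sub_eq_zero, ← Int.cast_sub]
  exact (ZMod.intCast_zmod_eq_zero_iff_dvd _ _).2 h1

end Numerics

section Combinatorics
variable {e : ℕ}

/-- the pairing of the weight of a word with a simple coroot (words are read from the right) -/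
def hh (kap : ZMod e → ℤ) (x : ZMod e) : List (ZMod e) → ℤ
  | [] => kap x
  | z :: u => hh kap x u + (if z = x then -2 else if z = x + 1 ∨ z = x - 1 then 1 else 0)

/-- valid words: residue sequences of standard tableaux -/
def val (kap : ZMod e → ℤ) : List (ZMod e) → Prop
  | [] => True
  | x :: u => hh kap x u = 1 ∧ val kap u

theorem val_ge (kap : ZMod e → ℤ) (hk : ∀ x, 0 ≤ kap x) (u : List (ZMod e))
    (hv : val kap u) (x : ZMod e) : -1 ≤ hh kap x u := by
  induction u with
  | nil => have := hk x; simp only [hh]; omega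
  | cons z u ih =>
    have h1 := ih hv.2
    have h2 := hv.1
    simp only [hh]
    split_ifs with h3
    · subst h3; omega
    · omega
    · omega

theorem val_inv (n : ℕ) (hne : n < e) (kap : ZMod e → ℤ) (hk : ∀ x, kap x ≤ 1)
    (hkG : ∀ (x : ZMod e) (k : ℕ), 1 ≤ k → k < n → kap x = 1 → kap (x + k) = 1 → False)
    (u : List (ZMod e)) (hv : val kap u) (hl : u.length + 1 ≤ n) :
    (∀ x, hh kap x u ≤ 1) ∧
      ∀ (x : ZMod e) (k : ℕ), 1 ≤ k → hh kap x u = 1 → hh kap (x + k) u = 1 →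
        (∀ j : ℕ, 0 < j → j < k → hh kap (x + j) u = 0) → n ≤ k + u.length := by
  induction u with
  | nil =>
    refine ⟨hk, fun x k hk1 h1 h2 _ => ?_⟩
    by_contra hc
    exact hkG x k hk1 (by simpa using hc) h1 h2
  | cons z u ih =>
    simp only [List.length_cons] at hl ⊢
    obtain ⟨ihA, ihG⟩ := ih hv.2 (by omega)
    have hz := hv.1
    have he : Fact (1 < e) := ⟨by omega⟩
    have h10 : (1 : ZMod e) ≠ 0 := one_ne_zero
    have hzz : hh kap z (z :: u) = -1 := by simp [hh, hz]
    have hoff : ∀ x, x ≠ z → x ≠ z + 1 → x ≠ z - 1 → hh kap x (z :: u) = hh kap x u := by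
      intro x h1 h2 h3
      simp only [hh]
      rw [if_neg (Ne.symm h1), if_neg]
      · simp
      · rintro (h | h)
        · exact h3 (by rw [h]; ring)
        · exact h2 (by rw [h]; ring)
    have hR : hh kap (z + 1) (z :: u) = hh kap (z + 1) u + 1 := by
      simp only [hh]
      rw [if_neg (by simp), if_pos (by right; ring)]
    have hL : hh kap (z - 1) (z :: u) = hh kap (z - 1) u + 1 := by
      simp only [hh]
      rw [if_neg (by intro h; apply h10; linear_combination h), if_pos (by left; ring)]
    have hB1 : hh kap (z + 1) u ≤ 0 := by
      by_contra hc
      have h1 : hh kap (z + 1) u = 1 := by have := ihA (z + 1); omega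
      have := ihG z 1 le_rfl hz (by simpa using h1) (by intro j _ _; omega)
      omega
    have hB2 : hh kap (z - 1) u ≤ 0 := by
      by_contra hc
      have h1 : hh kap (z - 1) u = 1 := by have := ihA (z - 1); omega
      have := ihG (z - 1) 1 le_rfl h1 (by simpa using hz) (by intro j _ _; omega)
      omega
    constructor
    · intro x
      by_cases h1 : x = z
      · subst h1; omega
      by_cases h2 : x = z + 1
      · subst h2; omega
      by_cases h3 : x = z - 1
      · subst h3; omega
      rw [hoff x h1 h2 h3]; exact ihA x
    · intro x k hk1 hx hxk hntr
      by_contra hc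
      have hrun : ∀ j : ℕ, j ≤ k → x + j ≠ z := by
        intro j hj h
        rcases Nat.eq_zero_or_pos j with h0 | h0
        · subst h0
          simp at h; subst h; omega
        rcases Nat.lt_or_ge j k with h3 | h3
        · have := hntr j h0 h3
          rw [h] at this; omega
        · have : j = k := by omega
          subst this
          rw [h] at hxk; omega
      have hntr' : ∀ j : ℕ, 0 < j → j < k → hh kap (x + j) u = 0 := by
        intro j h0 h1
        rw [← hoff, hntr j h0 h1]
        · exact hrun j h1.le
        · intro h
          apply hrun (j - 1) (by omega)
          rw [Nat.cast_sub h0]; push_cast; linear_combination h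
        · intro h
          apply hrun (j + 1) (by omega)
          push_cast; linear_combination h
      have hxz : x ≠ z := by simpa using hrun 0 (by omega)
      have hxz1 : x ≠ z - 1 := by
        intro h; apply hrun 1 hk1; push_cast; linear_combination h
      have hyz : x + k ≠ z := hrun k le_rfl
      have hyz1 : x + k ≠ z + 1 := by
        intro h; apply hrun (k - 1) (by omega)
        rw [Nat.cast_sub hk1]; push_cast; linear_combination h
      by_cases hc1 : x = z + 1
      · subst hc1
        have h0 : hh kap (z + 1) u = 0 := by omega
        by_cases hc2 : z + 1 + k = z - 1
        · have h3 : ((k + 2 : ℕ) : ZMod e) = 0 := by push_cast; linear_combination hc2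
          rw [ZMod.natCast_eq_zero_iff] at h3
          have := Nat.le_of_dvd (by omega) h3
          omega
        · have h4 := hoff _ hyz hyz1 hc2
          have := ihG z (k + 1) (by omega) hz
            (by push_cast; rw [show z + ((k : ZMod e) + 1) = z + 1 + k by ring]; omega) (by
              intro j h5 h6
              rcases Nat.lt_or_ge 1 j with h7 | h7
              · have := hntr' (j - 1) (by omega) (by omega)
                rw [Nat.cast_sub h5] at this
                rw [← this]; congr 1; push_cast; ring
              · have : j = 1 := by omega
                subst this; simpa using h0)
          omega
      · have h3 := hoff _ hxz hc1 hxz1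
        by_cases hc2 : x + k = z - 1
        · have h0 : hh kap (x + k) u = 0 := by
            rw [hc2] at hxk ⊢; omega
          have := ihG x (k + 1) (by omega) (by omega)
            (by push_cast; rw [← add_assoc, hc2, show z - 1 + 1 = z by ring]; exact hz) (by
              intro j h5 h6
              rcases Nat.lt_or_ge j k with h7 | h7
              · exact hntr' j h5 h7
              · have : j = k := by omega
                subst this; exact h0)
          omega
        · have h4 := hoff _ hyz hyz1 hc2
          have := ihG x k hk1 (by omega) (by omega) hntr'
          omega

theorem val_adj (n : ℕ) (hne : n < e) (kap : ZMod e → ℤ) (hk : ∀ x, kap x ≤ 1)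
    (hkG : ∀ (x : ZMod e) (k : ℕ), 1 ≤ k → k < n → kap x = 1 → kap (x + k) = 1 → False)
    (u : List (ZMod e)) (hv : val kap u) (hl : u.length + 2 ≤ n) (x y : ZMod e)
    (hxy : x = y + 1 ∨ x = y - 1) (hy : hh kap y u = 1) : hh kap x u ≤ 0 := by
  obtain ⟨hA, hG⟩ := val_inv n hne kap hk hkG u hv (by omega)
  by_contra hc
  have h1 : hh kap x u = 1 := by have := hA x; omega
  rcases hxy with h | h
  · subst h
    have := hG y 1 le_rfl hy (by simpa using h1) (by intro j _ _; omega)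
    omega
  · subst h
    have := hG (y - 1) 1 le_rfl h1 (by simpa using hy) (by intro j _ _; omega)
    omega

theorem val_neg (kap : ZMod e → ℤ) (hk : ∀ x, 0 ≤ kap x) (u : List (ZMod e))
    (hv : val kap u) (x : ZMod e) (hx : hh kap x u < 0) :
    ∃ u2 u1, u = u2 ++ x :: u1 ∧ ∀ z ∈ u2, z ≠ x ∧ z ≠ x + 1 ∧ z ≠ x - 1 := by
  induction u with
  | nil => have := hk x; simp only [hh] at hx; omega
  | cons z u ih =>
    by_cases h1 : z = x
    · subst h1; exact ⟨[], u, rfl, by simp⟩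
    have h2 := val_ge kap hk u hv.2 x
    simp only [hh] at hx
    rw [if_neg h1] at hx
    split_ifs at hx with h3
    · omega
    · push Not at h3
      obtain ⟨u2, u1, h4, h5⟩ := ih hv.2 (by omega)
      refine ⟨z :: u2, u1, by simp [h4], ?_⟩
      intro w hw
      rcases List.mem_cons.1 hw with h6 | h6
      · subst h6; exact ⟨h1, h3.1, h3.2⟩
      · exact h5 w h6

theorem nz_move (nz : List (ZMod e) → Prop) (m : ℕ) (x : ZMod e)
    (P3 : ∀ v x y u, (v ++ x :: y :: u).length = m → x ≠ y → x ≠ y + 1 → x ≠ y - 1 →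
      nz (v ++ x :: y :: u) → nz (v ++ y :: x :: u))
    (u2 : List (ZMod e)) : ∀ (v u1 : List (ZMod e)), (v ++ u2 ++ x :: u1).length = m →
    (∀ z ∈ u2, z ≠ x ∧ z ≠ x + 1 ∧ z ≠ x - 1) → nz (v ++ u2 ++ x :: u1) →
    nz (v ++ x :: (u2 ++ u1)) := by
  induction u2 with
  | nil => intro v u1 _ _ h; simpa using h
  | cons z u2 ih =>
    intro v u1 hl hz h
    have h1 := ih (v ++ [z]) u1 (by simpa using hl)
      (fun w hw => hz w (List.mem_cons_of_mem _ hw)) (by simpa using h)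
    have h2 := hz z List.mem_cons_self
    have := P3 v z x (u2 ++ u1) (by simp at hl ⊢; omega) h2.1 h2.2.1 h2.2.2 (by simpa using h1)
    simpa using this

theorem val_step (n : ℕ) (hne : n < e) (kap : ZMod e → ℤ) (hk0 : ∀ x, 0 ≤ kap x)
    (hk : ∀ x, kap x ≤ 1)
    (hkG : ∀ (x : ZMod e) (k : ℕ), 1 ≤ k → k < n → kap x = 1 → kap (x + k) = 1 → False)
    (nz : List (ZMod e) → Prop) (m : ℕ) (hm1 : 1 ≤ m) (hm : m + 1 ≤ n)
    (P0 : ∀ x u, nz (x :: u) → nz u)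
    (IH : ∀ u, u.length = m → nz u → val kap u)
    (P2 : ∀ x u, (x :: x :: u).length = m + 1 → ¬ nz (x :: x :: u))
    (P3 : ∀ v x y u, (v ++ x :: y :: u).length = m + 1 → x ≠ y → x ≠ y + 1 → x ≠ y - 1 →
      nz (v ++ x :: y :: u) → nz (v ++ y :: x :: u))
    (P4 : ∀ x y u, (x :: y :: x :: u).length = m + 1 → (x = y + 1 ∨ x = y - 1) →
      ¬ nz (x :: y :: x :: u))
    (w : List (ZMod e)) (hw : w.length = m + 1) (hnz : nz w) : val kap w := by
  have he : Fact (1 < e) := ⟨by omega⟩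
  obtain ⟨x, y, u, rfl⟩ : ∃ x y u, w = x :: y :: u := by
    match w, hw with
    | [], h => simp at h
    | [x], h => simp at h; omega
    | x :: y :: u, _ => exact ⟨x, y, u, rfl⟩
  have hlu : u.length + 1 = m := by simpa using hw
  have hvy := IH (y :: u) (by simpa using hw) (P0 _ _ hnz)
  refine ⟨?_, hvy⟩
  by_cases hxy : x = y
  · subst hxy; exact absurd hnz (P2 x u hw)
  simp only [hh]
  rw [if_neg (Ne.symm hxy)]
  by_cases hadj : x = y + 1 ∨ x = y - 1
  · rw [if_pos (by
      rcases hadj with h | h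
      · right; rw [h]; ring
      · left; rw [h]; ring)]
    have h1 := val_adj n hne kap hk hkG u hvy.2 (by omega) x y hadj hvy.1
    have h2 : ¬ hh kap x u < 0 := by
      intro h3
      obtain ⟨u2, u1, rfl, h5⟩ := val_neg kap hk0 u hvy.2 x h3
      have := nz_move nz (m + 1) x P3 u2 [x, y] u1 (by simpa using hw) h5 (by simpa using hnz)
      exact P4 x y (u2 ++ u1) (by simp at hw ⊢; omega) hadj (by simpa using this)
    omega
  · rw [if_neg (by
      rintro (h | h)
      · apply hadj; right; rw [h]; ring
      · apply hadj; left; rw [h]; ring)]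
    push Not at hadj
    have h1 := P3 [] x y u (by simpa using hw) hxy hadj.1 hadj.2 (by simpa using hnz)
    have h2 := IH (x :: u) (by simpa using hw) (P0 _ _ h1)
    have := h2.1
    omega

/-- the content attached to a letter added to a word -/
def cont (base : ZMod e → ℤ) (x : ZMod e) : List (ZMod e) → ℤ
  | [] => base x
  | y :: u => if x = y + 1 then cont base y u + 1
      else if x = y - 1 then cont base y u - 1 else cont base x u

theorem cont_cast (base : ZMod e → ℤ) (hb : ∀ x, (base x : ZMod e) = x) (u : List (ZMod e)) :
    ∀ x, ((cont base x u : ℤ) : ZMod e) = x := by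
  induction u with
  | nil => intro x; exact hb x
  | cons y u ih =>
    intro x
    simp only [cont]
    split_ifs with h1 h2
    · push_cast; rw [ih y, h1]
    · push_cast; rw [ih y, h2]
    · exact ih x

end Combinatorics
end Paper

open scoped BigOperators
open scoped Classical
namespace Paper

section Rank2
variable {O : Type*} [CommRing O] {A : Type*} [Ring A] [Algebra O A] (t : Oˣ)

theorem rank2_TY (T X Y : A) (hq : T * T = ((t : O) - 1) • T + (t : O) • (1 : A))
    (hYT : Y * T = T * X + 1 + ((t : O) - 1) • Y) :
    T * Y = X * T + 1 + ((t : O) - 1) • Y := by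
  have h1 : (t : O) • Y = T * X * T + T := by
    have h2 : Y * T * T = (T * X + 1 + ((t : O) - 1) • Y) * T := by rw [hYT]
    rw [mul_assoc, hq] at h2
    simp only [mul_add, add_mul, smul_mul_assoc, mul_smul_comm, mul_one, one_mul] at h2
    linear_combination (norm := module) h2
  have h3 : (t : O) • (T * Y) = (t : O) • (X * T + 1 + ((t : O) - 1) • Y) := by
    have h4 : (t : O) • (T * Y) = T * T * X * T + T * T := by
      rw [← mul_smul_comm, h1]; simp only [mul_add, mul_assoc]
    rw [h4, hq]
    simp only [add_mul, smul_mul_assoc, one_mul]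
    have h5 : ((t : O) - 1) • ((t : O) • Y) = ((t : O) - 1) • (T * X * T + T) := by rw [h1]
    linear_combination (norm := module) - h5
  have h6 := congrArg (fun z => ((t⁻¹ : Oˣ) : O) • z) h3
  simpa [smul_smul] using h6

/-- the intertwiner -/
def phi (T X Y : A) : A := T * (X - Y) + 1 + ((t : O) - 1) • Y

theorem phi_X (T X Y : A) (hXY : X * Y = Y * X)
    (hYT : Y * T = T * X + 1 + ((t : O) - 1) • Y) :
    phi t T X Y * X = Y * phi t T X Y := by
  have h1 : Y * (T * X) = (T * X + 1 + ((t : O) - 1) • Y) * X := by rw [← hYT, mul_assoc]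
  have h2 : Y * (T * Y) = (T * X + 1 + ((t : O) - 1) • Y) * Y := by rw [← hYT, mul_assoc]
  unfold phi
  simp only [mul_add, add_mul, mul_sub, sub_mul, smul_mul_assoc, mul_smul_comm, mul_one, one_mul,
    h1, h2, mul_assoc, hXY]
  module

theorem phi_Y (T X Y : A) (hXY : X * Y = Y * X)
    (hTY : T * Y = X * T + 1 + ((t : O) - 1) • Y) :
    phi t T X Y * Y = X * phi t T X Y := by
  have hXT : X * T = T * Y - 1 - ((t : O) - 1) • Y := by rw [hTY]; abel
  have h1 : X * (T * X) = (T * Y - 1 - ((t : O) - 1) • Y) * X := by rw [← hXT, mul_assoc]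
  have h2 : X * (T * Y) = (T * Y - 1 - ((t : O) - 1) • Y) * Y := by rw [← hXT, mul_assoc]
  unfold phi
  simp only [mul_add, add_mul, mul_sub, sub_mul, smul_mul_assoc, mul_smul_comm, mul_one, one_mul,
    h1, h2, mul_assoc, hXY]
  module

theorem phi_sq (T X Y : A) (hXY : X * Y = Y * X)
    (hq : T * T = ((t : O) - 1) • T + (t : O) • (1 : A))
    (hYT : Y * T = T * X + 1 + ((t : O) - 1) • Y) :
    phi t T X Y * phi t T X Y =
      ((t : O) • X + 1 - Y) * ((t : O) • Y + 1 - X) := by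
  have hTY := rank2_TY t T X Y hq hYT
  have hX := phi_X t T X Y hXY hYT
  have hY := phi_Y t T X Y hXY hTY
  have h1 : phi t T X Y * phi t T X Y = T * phi t T X Y * (Y - X) + phi t T X Y *
      (1 + ((t : O) - 1) • X) := by
    conv_lhs => enter [1]; unfold phi
    simp only [mul_add, add_mul, mul_sub, sub_mul, smul_mul_assoc, mul_smul_comm, mul_one, one_mul,
      mul_assoc, ← hX, ← hY]
    module
  rw [h1]
  have h2 : T * phi t T X Y = T * (((t : O) - 1) • X + 1) + (t : O) • (X - Y) := by
    unfold phi
    have h3 : T * (T * (X - Y)) = (((t : O) - 1) • T + (t : O) • (1 : A)) * (X - Y) := by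
      rw [← hq, mul_assoc]
    rw [mul_add, mul_add, h3]
    simp only [mul_add, add_mul, mul_sub, sub_mul, smul_mul_assoc, mul_smul_comm, mul_one, one_mul]
    module
  rw [h2]
  unfold phi
  simp only [mul_add, add_mul, mul_sub, sub_mul, smul_mul_assoc, mul_smul_comm, mul_one, one_mul,
    mul_assoc, hXY]
  module

open Polynomial in
theorem rank2_poly {ι : Type*} [Fintype ι] (T X Y : A) (hXY : X * Y = Y * X)
    (hq : T * T = ((t : O) - 1) • T + (t : O) • (1 : A))
    (hYT : Y * T = T * X + 1 + ((t : O) - 1) • Y)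
    (F : ι → A) (b : ι → O) (hFT : (∑ z, F z) * T = T * (∑ z, F z))
    (hX : ∀ z, X * F z = b z • F z) (hX' : ∀ z, F z * X = b z • F z)
    (hYF : ∀ z, Y * F z = F z * Y) (horth : ∀ z z', z ≠ z' → F z * F z' = 0)
    (hidem : ∀ z, F z * F z = F z) (y : ι) (S : Finset ι)
    (hS : ∀ z, z ≠ y → z ∉ S → F z = 0) (hyS : y ∉ S) :
    aeval Y ((∏ z ∈ S, (Polynomial.X - C (b z))) *
      ((C (t : O) * Polynomial.X + 1 - C (b y)) *
        (1 + C ((t : O) * b y) - Polynomial.X))) * F y = 0 := by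
  have hTY := rank2_TY t T X Y hq hYT
  set R : A := aeval Y (∏ z ∈ S, (Polynomial.X - C (b z))) with hR
  have hRY : R * Y = Y * R := by
    have h : R * aeval Y (Polynomial.X : O[X]) = aeval Y (Polynomial.X : O[X]) * R := by
      rw [hR, ← map_mul, ← map_mul, mul_comm]
    simpa using h
  have hsumF : (∑ z, F z) * F y = F y := by
    rw [Finset.sum_mul, Finset.sum_eq_single y, hidem]
    · intro z _ hz; exact horth z y hz
    · simp
  have hYTF : ∀ z, z ≠ y → (Y - algebraMap O A (b z)) * (F y * T * F z) = 0 := by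
    intro z hz
    have h1 : Y * (F y * T * F z) = F y * (Y * T) * F z := by
      rw [← mul_assoc, ← mul_assoc, hYF]; simp only [mul_assoc]
    rw [sub_mul, h1, hYT]
    have h2 : F y * (T * X + 1 + ((t : O) - 1) • Y) * F z = F y * T * (X * F z) + F y * F z
        + ((t : O) - 1) • (F y * (Y * F z)) := by
      simp only [mul_add, add_mul, smul_mul_assoc, mul_smul_comm, mul_one, mul_assoc]
    rw [h2, hX, hYF, horth y z (Ne.symm hz), ← mul_assoc (F y) (F z), horth y z (Ne.symm hz),
      ← Algebra.smul_def]
    simp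
  have hRz : ∀ z, z ≠ y → R * (F y * T * F z) = 0 := by
    intro z hz
    by_cases hzS : z ∈ S
    · rw [hR, ← Finset.prod_erase_mul _ _ hzS, map_mul, mul_assoc]
      have : aeval Y (Polynomial.X - C (b z)) = Y - algebraMap O A (b z) := by simp
      rw [this, hYTF z hz, mul_zero]
    · rw [hS z hz hzS]; simp
  set Z : A := F y * T * F y with hZ
  have hFZ : F y * Z = Z := by rw [hZ, ← mul_assoc, ← mul_assoc, hidem]
  have hYZ : Y * Z = b y • Z + F y + ((t : O) - 1) • (Y * F y) := by
    have h1 : Y * (F y * T * F y) = F y * (Y * T) * F y := by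
      rw [← mul_assoc, ← mul_assoc, hYF]; simp only [mul_assoc]
    rw [hZ, h1, hYT]
    have h2 : F y * (T * X + 1 + ((t : O) - 1) • Y) * F y = F y * T * (X * F y) + F y * F y
        + ((t : O) - 1) • (F y * Y * F y) := by
      simp only [mul_add, add_mul, smul_mul_assoc, mul_smul_comm, mul_one, mul_assoc]
    rw [h2, hX, hidem, ← hYF, mul_assoc Y, hidem]
    simp only [mul_smul_comm]
  have hZZ : R * (F y * T * T * F y) = R * (Z * Z) := by
    have h1 : F y * T * T * F y = ∑ z, F y * T * F z * (T * F y) := by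
      have hTF : T * F y = (∑ z, F z) * (T * F y) := by
        rw [← mul_assoc, hFT, mul_assoc, hsumF]
      rw [mul_assoc (F y * T), hTF, ← mul_assoc (F y * T), Finset.mul_sum, Finset.sum_mul, ← hTF]
    rw [h1, Finset.mul_sum, Finset.sum_eq_single y]
    · congr 1
      rw [hZ, mul_assoc, mul_assoc, mul_assoc, mul_assoc, mul_assoc, ← mul_assoc (F y) (F y), hidem]
    · intro z _ hz
      rw [← mul_assoc, hRz z hz, zero_mul]
    · simp
  have h4 : R * (Z * Z - ((t : O) - 1) • Z - (t : O) • F y) = 0 := by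
    rw [mul_sub, mul_sub, ← hZZ]
    have : F y * T * T * F y = ((t : O) - 1) • Z + (t : O) • F y := by
      rw [mul_assoc (F y) T T, hq, hZ]
      simp only [mul_add, add_mul, smul_mul_assoc, mul_smul_comm, mul_one, hidem]
    rw [this, mul_add]
    abel
  set V : A := Y - algebraMap O A (b y) with hV
  set W : A := 1 + ((t : O) - 1) • Y with hW
  have hVZ : V * Z = W * F y := by
    rw [hV, sub_mul, hYZ, ← Algebra.smul_def, hW, add_mul, smul_mul_assoc, one_mul]
    abel
  have hVW : V * W = W * V := by
    rw [hV, hW]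
    simp only [mul_add, add_mul, mul_sub, sub_mul, smul_mul_assoc, mul_smul_comm, mul_one, one_mul,
      Algebra.commutes (b y) Y, smul_sub]
    abel
  have hVR : V * R = R * V := by
    rw [hV, sub_mul, mul_sub, hRY, Algebra.commutes]
  have hVF : V * F y = F y * V := by
    rw [hV, sub_mul, mul_sub, hYF, Algebra.commutes]
  have hkey : aeval Y ((C (t : O) * Polynomial.X + 1 - C (b y)) *
        (1 + C ((t : O) * b y) - Polynomial.X)) * F y
      = V * V * (Z * Z - ((t : O) - 1) • Z - (t : O) • F y) := by
    have h5 : V * V * (Z * Z) = W * W * F y := by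
      have : V * V * (Z * Z) = V * (V * Z) * Z := by simp only [mul_assoc]
      rw [this, hVZ, ← mul_assoc V W, hVW, mul_assoc W V, hVF, ← mul_assoc W, mul_assoc (W * F y), hVZ,
        mul_assoc W, ← mul_assoc (F y) W]
      have : F y * W = W * F y := by
        rw [hW]; simp only [mul_add, add_mul, mul_smul_comm, smul_mul_assoc, hYF, mul_one, one_mul]
      rw [this, mul_assoc W (F y), hidem, mul_assoc]
    have h6 : V * V * Z = V * W * F y := by rw [mul_assoc, hVZ, mul_assoc]
    have h7 : V * V * (Z * Z - ((t : O) - 1) • Z - (t : O) • F y) =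
        (W * W - ((t : O) - 1) • (V * W) - (t : O) • (V * V)) * F y := by
      rw [mul_sub (V * V), mul_sub (V * V), h5, mul_smul_comm, h6, mul_smul_comm,
        sub_mul _ _ (F y), sub_mul _ _ (F y), smul_mul_assoc, smul_mul_assoc]
    rw [h7]
    congr 1
    have : W * W - ((t : O) - 1) • (V * W) - (t : O) • (V * V) =
       aeval Y ((1 + C ((t : O) - 1) * Polynomial.X) * (1 + C ((t : O) - 1) * Polynomial.X)
        - C ((t : O) - 1) * ((Polynomial.X - C (b y)) * (1 + C ((t : O) - 1) * Polynomial.X))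
        - C (t : O) * ((Polynomial.X - C (b y)) * (Polynomial.X - C (b y)))) := by
      simp only [map_sub, map_mul, map_add, map_one, aeval_X, aeval_C, hV, hW, Algebra.smul_def]
    rw [this]
    congr 1
    simp only [C_mul, C_sub, C_1]
    ring
  rw [map_mul, mul_assoc, hkey, ← hR, ← mul_assoc, ← mul_assoc, ← hVR, mul_assoc V R V, ← hVR,
    mul_assoc, mul_assoc, h4]
  simp

end Rank2

section Lagr
open Polynomial
variable {O : Type*} [CommRing O] {ι : Type*} [Fintype ι]

/-- Lagrange basis polynomials -/
noncomputable def Lg (b : ι → O) (x : ι) : O[X] :=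
  ∏ z ∈ Finset.univ.erase x, (C (Ring.inverse (b x - b z)) * (X - C (b z)))

theorem Lg_sum [IsDomain O] [Nonempty ι] (b : ι → O)
    (hb : ∀ x z, x ≠ z → IsUnit (b x - b z)) : ∑ x, Lg b x = 1 := by
  have hinj : Function.Injective (algebraMap O (FractionRing O)) :=
    IsFractionRing.injective O (FractionRing O)
  apply Polynomial.map_injective (algebraMap O (FractionRing O)) hinj
  rw [Polynomial.map_sum, Polynomial.map_one]
  have hv : Set.InjOn (fun x => algebraMap O (FractionRing O) (b x))
      ((Finset.univ : Finset ι) : Set ι) := by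
    intro x _ z _ h
    by_contra hc
    have := hb x z hc
    rw [hinj h, sub_self] at this
    exact not_isUnit_zero this
  rw [← Lagrange.sum_basis hv Finset.univ_nonempty]
  refine Finset.sum_congr rfl fun x _ => ?_
  unfold Lg Lagrange.basis
  rw [Polynomial.map_prod]
  refine Finset.prod_congr rfl fun z hz => ?_
  unfold Lagrange.basisDivisor
  have hu := hb x z (Ne.symm (Finset.ne_of_mem_erase hz))
  simp only [Polynomial.map_mul, Polynomial.map_sub, Polynomial.map_C, Polynomial.map_X]
  congr 2
  rw [← map_sub]
  apply eq_inv_of_mul_eq_one_left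
  rw [← map_mul, Ring.inverse_mul_cancel _ hu, map_one]

theorem Lg_eq (b : ι → O) (x : ι) : ∃ u : O, Lg b x = C u * ∏ z ∈ Finset.univ.erase x, (X - C (b z)) := by
  refine ⟨∏ z ∈ Finset.univ.erase x, Ring.inverse (b x - b z), ?_⟩
  unfold Lg
  rw [Finset.prod_mul_distrib, map_prod]

theorem Lg_eq' (b : ι → O) (x : ι) (S : Finset ι) (hS : ∀ z, z ∈ S ↔ z ≠ x) :
    ∃ u : O, Lg b x = C u * ∏ z ∈ S, (X - C (b z)) := by
  obtain ⟨u, h⟩ := Lg_eq b x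
  refine ⟨u, h.trans ?_⟩
  congr 1
  refine Finset.prod_congr ?_ fun _ _ => rfl
  ext z
  simp [hS]

theorem Lg_mul (b : ι → O) (x : ι) :
    ∃ u : O, (X - C (b x)) * Lg b x = C u * ∏ z, (X - C (b z)) := by
  obtain ⟨u, h⟩ := Lg_eq b x
  refine ⟨u, ?_⟩
  rw [h, mul_left_comm, Finset.mul_prod_erase Finset.univ
      (fun z => X - C (b z)) (Finset.mem_univ x)]

end Lagr
end Paper

open scoped BigOperators
open scoped Classical
namespace Paper

/-- the numerical consequences of the separation hypotheses -/
structure Setup {O : Type*} [CommRing O] (t : Oˣ) (e n : ℕ) (kap base : ZMod e → ℤ) : Prop where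
  he : 2 ≤ e
  hne : n < e
  hk0 : ∀ x, 0 ≤ kap x
  hk : ∀ x, kap x ≤ 1
  hkG : ∀ (x : ZMod e) (k : ℕ), 1 ≤ k → k < n → kap x = 1 → kap (x + k) = 1 → False
  hb : ∀ x, (base x : ZMod e) = x
  hU : ∀ k : ℤ, ¬(e : ℤ) ∣ k → IsUnit (qintU t k)

/-- the (non cyclotomic) Hecke relations, with generators indexed by natural numbers -/
structure HeckeN {O : Type*} [CommRing O] {A : Type*} [Ring A] [Algebra O A] (t : Oˣ) (n : ℕ)
    (L T : ℕ → A) : Prop where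
  LL : ∀ j k, L j * L k = L k * L j
  quad : ∀ r, r + 1 < n → T r * T r = ((t : O) - 1) • T r + (t : O) • (1 : A)
  braid : ∀ r, r + 2 < n → T r * T (r + 1) * T r = T (r + 1) * T r * T (r + 1)
  TL : ∀ r k, r + 1 < n → k ≠ r → k ≠ r + 1 → T r * L k = L k * T r
  LT : ∀ r, r + 1 < n → L (r + 1) * T r = T r * L r + 1 + ((t : O) - 1) • L (r + 1)

section HSide
open Polynomial
variable {O : Type*} [CommRing O] {A : Type*} [Ring A] [Algebra O A] (t : Oˣ)
variable {e : ℕ} [NeZero e]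

theorem aeval_comm (X g : A) (h : X * g = g * X) (p : O[X]) : aeval X p * g = g * aeval X p := by
  induction p using Polynomial.induction_on' with
  | add p q hp hq => rw [map_add, add_mul, mul_add, hp, hq]
  | monomial k a =>
    rw [aeval_monomial]
    have h1 : X ^ k * g = g * X ^ k := (Commute.pow_left (show Commute X g from h) k)
    rw [mul_assoc, h1, ← mul_assoc, Algebra.commutes, mul_assoc]

theorem aeval_eig (X g : A) (a : O) (h : X * g = a • g) (p : O[X]) :
    aeval X p * g = (p.eval a) • g := by
  induction p using Polynomial.induction_on' with
  | add p q hp hq => rw [map_add, add_mul, hp, hq, eval_add, add_smul]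
  | monomial k b =>
    rw [aeval_monomial, eval_monomial]
    have h1 : X ^ k * g = a ^ k • g := by
      induction k with
      | zero => simp
      | succ k ih => rw [pow_succ, mul_assoc, h, mul_smul_comm, ih, smul_smul, pow_succ']
    rw [mul_assoc, h1, ← Algebra.smul_def, smul_smul]

theorem Lg_eval_self {ι : Type*} [Fintype ι] (b : ι → O)
    (hb : ∀ x z, x ≠ z → IsUnit (b x - b z)) (x : ι) : (Lg b x).eval (b x) = 1 := by
  unfold Lg
  rw [eval_prod]
  apply Finset.prod_eq_one
  intro z hz
  simp only [eval_mul, eval_C, eval_sub, eval_X]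
  exact Ring.inverse_mul_cancel _ (hb x z (Ne.symm (Finset.ne_of_mem_erase hz)))

theorem Lg_eval_ne {ι : Type*} [Fintype ι] (b : ι → O) (x y : ι) (h : x ≠ y) :
    (Lg b x).eval (b y) = 0 := by
  unfold Lg
  rw [eval_prod]
  apply Finset.prod_eq_zero (Finset.mem_erase.2 ⟨Ne.symm h, Finset.mem_univ y⟩)
  simp

/-- the idempotent attached to a word -/
noncomputable def FW (base : ZMod e → ℤ) (L : ℕ → A) : List (ZMod e) → A
  | [] => 1
  | x :: w => FW base L w * aeval (L w.length) (Lg (fun z => qintU t (cont base z w)) x)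

/-- being an eigenvector of residues given by a word -/
def EV (L : ℕ → A) (g : A) : List (ZMod e) → Prop
  | [] => True
  | x :: u => (∃ c : ℤ, (c : ZMod e) = x ∧ L u.length * g = qintU t c • g) ∧ EV L g u

variable {n : ℕ} {kap base : ZMod e → ℤ} (S : Setup t e n kap base)
variable (L T : ℕ → A)

theorem EV_append (g : A) (v u : List (ZMod e)) (h : EV t L g (v ++ u)) : EV t L g u := by
  induction v with
  | nil => exact h
  | cons x v ih => exact ih h.2

theorem EV_mul (g a : A) (u : List (ZMod e)) (h : EV t L g u) : EV t L (g * a) u := by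
  induction u with
  | nil => trivial
  | cons x u ih =>
    obtain ⟨⟨c, h1, h2⟩, h3⟩ := h
    exact ⟨⟨c, h1, by rw [← mul_assoc, h2, smul_mul_assoc]⟩, ih h3⟩

theorem EV_lmul (g a : A) (u : List (ZMod e)) (h : EV t L g u)
    (ha : ∀ k, k < u.length → L k * a = a * L k) : EV t L (a * g) u := by
  induction u with
  | nil => trivial
  | cons x u ih =>
    obtain ⟨⟨c, h1, h2⟩, h3⟩ := h
    refine ⟨⟨c, h1, ?_⟩, ih h3 (fun k hk => ha k (by simp; omega))⟩
    rw [← mul_assoc, ha _ (by simp), mul_assoc, h2, mul_smul_comm]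

theorem FW_comm (g : A) (w : List (ZMod e)) (h : ∀ k, k < w.length → L k * g = g * L k) :
    FW t base L w * g = g * FW t base L w := by
  induction w with
  | nil => simp [FW]
  | cons x w ih =>
    simp only [FW]
    rw [mul_assoc, aeval_comm _ _ (h _ (by simp)), ← mul_assoc,
      ih (fun k hk => h k (by simp; omega)), mul_assoc]

theorem FW_append (v u : List (ZMod e)) : ∃ a, FW t base L (v ++ u) = FW t base L u * a := by
  induction v with
  | nil => exact ⟨1, by simp⟩
  | cons x v ih =>
    obtain ⟨a, h⟩ := ih
    exact ⟨a * _, by simp only [List.cons_append, FW]; rw [h, mul_assoc]⟩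

theorem bunit (S : Setup t e n kap base)
    (w : List (ZMod e)) (x z : ZMod e) (h : x ≠ z) :
    IsUnit (qintU t (cont base x w) - qintU t (cont base z w)) := by
  apply isUnit_qsub t e S.hU
  rw [cont_cast base S.hb, cont_cast base S.hb]
  exact h

theorem FW_sum (S : Setup t e n kap base) (L : ℕ → A)
    [IsDomain O] (w : List (ZMod e)) : ∑ x, FW t base L (x :: w) = FW t base L w := by
  simp only [FW]
  rw [← Finset.mul_sum, ← map_sum, Lg_sum _ (bunit t S w), map_one, mul_one]

/-- the polynomial relation satisfied by the next Jucys-Murphy element -/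
def Pol (base : ZMod e → ℤ) (w : List (ZMod e)) : Prop :=
  aeval (L w.length) (∏ z, (X - C (qintU t (cont base z w)))) * FW t base L w = 0

theorem FW_eig (hLL : ∀ j k, L j * L k = L k * L j) (w : List (ZMod e)) (hp : Pol t L base w)
    (x : ZMod e) :
    L w.length * FW t base L (x :: w) = qintU t (cont base x w) • FW t base L (x :: w) := by
  have hc : ∀ a : A, (∀ k, L k * a = a * L k) → FW t base L w * a = a * FW t base L w :=
    fun a ha => FW_comm t L a w (fun k _ => ha k)
  obtain ⟨u, hu⟩ := Lg_mul (fun z => qintU t (cont base z w)) x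
  have h1 : aeval (L w.length) ((X - C (qintU t (cont base x w))) *
      Lg (fun z => qintU t (cont base z w)) x) * FW t base L w = 0 := by
    rw [hu, map_mul, mul_assoc]
    rw [show aeval (L w.length) (∏ z, (X - C (qintU t (cont base z w)))) * FW t base L w = 0
      from hp, mul_zero]
  rw [map_mul, mul_assoc, ← FW_comm t L _ w (fun k _ => (aeval_comm _ _ (hLL _ _) _).symm)] at h1
  simp only [map_sub, aeval_X, aeval_C, sub_mul] at h1
  rw [sub_eq_zero, ← Algebra.smul_def] at h1
  exact h1

theorem FW_EV (hLL : ∀ j k, L j * L k = L k * L j) (hb : ∀ x, (base x : ZMod e) = x)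
    (m : ℕ) (hp : ∀ w : List (ZMod e), w.length < m → Pol t L base w)
    (w : List (ZMod e)) (hw : w.length ≤ m) : EV t L (FW t base L w) w := by
  induction w with
  | nil => trivial
  | cons x w ih =>
    simp only [List.length_cons] at hw
    refine ⟨⟨cont base x w, cont_cast base hb w x, FW_eig t L hLL w (hp w hw) x⟩, ?_⟩
    exact EV_mul t L _ _ _ (ih (by omega))

/-- eigenvectors with the right residues are fixed by the idempotents -/
theorem EV_fix (S : Setup t e n kap base) (L : ℕ → A)
    (m : ℕ) (hp : ∀ w : List (ZMod e), w.length < m → Pol t L base w)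
    (w : List (ZMod e)) (hw : w.length ≤ m) (g : A) (hg : EV t L g w) :
    FW t base L w * g = g := by
  induction w with
  | nil => simp [FW]
  | cons x w ih =>
    simp only [List.length_cons] at hw
    have h1 := ih (by omega) hg.2
    obtain ⟨⟨c, hc, h2⟩, _⟩ := hg
    have h3 : qintU t c • g = qintU t (cont base x w) • g := by
      have h4 : aeval (L w.length) (∏ z, (X - C (qintU t (cont base z w)))) * FW t base L w * g = 0 := by
        rw [show aeval (L w.length) (∏ z, (X - C (qintU t (cont base z w)))) * FW t base L w = 0
          from hp w hw, zero_mul]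
      rw [mul_assoc, h1, aeval_eig _ _ _ h2, eval_prod,
        ← Finset.prod_erase_mul _ _ (Finset.mem_univ x), mul_smul] at h4
      have hu : IsUnit (∏ z ∈ Finset.univ.erase x, eval (qintU t c) (X - C (qintU t (cont base z w)))) := by
        rw [IsUnit.prod_iff]
        intro z hz
        simp only [eval_sub, eval_X, eval_C]
        apply isUnit_qsub t e S.hU
        rw [hc, cont_cast base S.hb]
        exact Ne.symm (Finset.ne_of_mem_erase hz)
      have h5 := (IsUnit.smul_eq_zero hu).1 h4
      simp only [eval_sub, eval_X, eval_C, sub_smul] at h5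
      exact sub_eq_zero.1 h5
    rw [h3] at h2
    simp only [FW]
    rw [mul_assoc, aeval_eig _ _ _ h2, Lg_eval_self (fun z => qintU t (cont base z w))
      (bunit t S w) x, one_smul, h1]

end HSide
end Paper

open scoped BigOperators
open scoped Classical
namespace Paper

section HSide2
open Polynomial
variable {O : Type*} [CommRing O] [IsDomain O] {A : Type*} [Ring A] [Algebra O A] (t : Oˣ)
variable {e : ℕ} [NeZero e]
variable {n : ℕ} {kap base : ZMod e → ℤ} (S : Setup t e n kap base)
variable (L T : ℕ → A) (H : HeckeN t n L T)

theorem Setup.two_ne {O : Type*} [CommRing O] {t : Oˣ} {e n : ℕ} {kap base : ZMod e → ℤ}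
    (S : Setup t e n kap base) (hn : 2 ≤ n) (x : ZMod e) : x + 1 ≠ x - 1 := by
  intro h
  have h2 : ((2 : ℕ) : ZMod e) = 0 := by push_cast; linear_combination h
  rw [ZMod.natCast_eq_zero_iff] at h2
  have := Nat.le_of_dvd (by omega) h2
  have := S.hne
  omega

theorem Setup.one_ne {O : Type*} [CommRing O] {t : Oˣ} {e n : ℕ} {kap base : ZMod e → ℤ}
    (S : Setup t e n kap base) : (1 : ZMod e) ≠ 0 := by
  have : Fact (1 < e) := ⟨S.he⟩
  exact one_ne_zero

theorem pol_step (S : Setup t e n kap base) (L T : ℕ → A) (H : HeckeN t n L T)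
    (m : ℕ) (hmn : m + 1 ≤ n)
    (hp : ∀ w : List (ZMod e), w.length < m → Pol t L base w)
    (hv : ∀ w : List (ZMod e), w.length ≤ m → FW t base L w ≠ 0 → val kap w)
    (y : ZMod e) (u : List (ZMod e)) (hu : u.length + 1 = m) :
    aeval (L m) (Lg (fun z => qintU t (cont base z (y :: u))) y) * FW t base L (y :: u) = 0 := by
  by_cases hF0 : FW t base L (y :: u) = 0
  · rw [hF0, mul_zero]
  have hvy := hv (y :: u) (by simp; omega) hF0
  have hadj : ∀ z, (z = y + 1 ∨ z = y - 1) → FW t base L (z :: u) = 0 := by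
    intro z hz
    by_contra hc
    have h1 := hv (z :: u) (by simp; omega) hc
    have h2 := val_adj n S.hne kap S.hk S.hkG u hvy.2 (by omega) z y hz hvy.1
    have := h1.1
    omega
  have hFc : ∀ g : A, (∀ k, L k * g = g * L k) → ∀ w : List (ZMod e),
    FW t base L w * g = g * FW t base L w :=
    fun g hg w => FW_comm t L g w (fun k _ => hg k)
  have hFL : ∀ k (w : List (ZMod e)), L k * FW t base L w = FW t base L w * L k :=
    fun k w => (hFc (L k) (fun j => H.LL j k) w).symm
  have hFF : ∀ w w' : List (ZMod e), FW t base L w * FW t base L w' = FW t base L w' * FW t base L w :=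
    fun w w' => hFc _ (fun k => hFL k w') w
  have heig := fun z => FW_eig t L H.LL u (hp u (by omega)) z
  have hfix : ∀ z, FW t base L u * FW t base L (z :: u) = FW t base L (z :: u) := fun z =>
    EV_fix t S L m hp u (by omega) _ (FW_EV t L H.LL S.hb m hp (z :: u) (by simp; omega)).2
  set FF : ZMod e → A := fun z => FW t base L (z :: u) with hFFdef
  have hprod : ∀ z z', FF z * FF z' = (if z = z' then FF z' else 0) := by
    intro z z'
    simp only [hFFdef]
    conv_lhs => enter [1]; simp only [FW]
    rw [mul_assoc, aeval_eig _ _ _ (heig z')]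
    split_ifs with h
    · subst h
      rw [Lg_eval_self (fun x => qintU t (cont base x u)) (bunit t S u) z, one_smul, hfix]
    · rw [Lg_eval_ne (fun x => qintU t (cont base x u)) z z' h, zero_smul, mul_zero]
  let SS : Finset (ZMod e) := Finset.univ.filter fun z => z ≠ y ∧ z ≠ y + 1 ∧ z ≠ y - 1
  have key := rank2_poly t (T u.length) (L u.length) (L (u.length + 1)) (H.LL _ _)
    (H.quad _ (by omega)) (H.LT _ (by omega)) FF (fun z => qintU t (cont base z u))
    (by
      rw [hFFdef]
      simp only []
      rw [FW_sum t S L u]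
      exact FW_comm t L _ _ (fun k hk => (H.TL _ _ (by omega) (by omega) (by omega)).symm))
    heig (fun z => by rw [hFFdef]; simp only []; rw [← hFL]; exact heig z)
    (fun z => hFL _ _) (fun z z' h => by rw [hprod, if_neg h]) (fun z => by rw [hprod, if_pos rfl])
    y SS
    (by
      intro z h1 h2
      simp only [SS, Finset.mem_filter, Finset.mem_univ, true_and, not_and_or, not_not] at h2
      rcases h2 with h2 | h2
      · exact absurd h2 h1
      · exact hadj z h2)
    (by simp [SS])
  obtain ⟨a, ha⟩ := Lg_eq' (fun z => qintU t (cont base z (y :: u))) y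
    (insert (y + 1) (insert (y - 1) SS)) (by
      intro z
      simp only [SS, Finset.mem_insert, Finset.mem_filter, Finset.mem_univ, true_and]
      constructor
      · rintro (h | h | h)
        · rw [h]; simpa using S.one_ne
        · rw [h]; simpa [sub_eq_self] using S.one_ne
        · exact h.1
      · intro h; tauto)
  have hpoly : (∏ z ∈ insert (y + 1) (insert (y - 1) SS),
        (X - C (qintU t (cont base z (y :: u))))) * (- C (t : O)) =
      (∏ z ∈ SS, (X - C (qintU t (cont base z u)))) *
      ((C (t : O) * X + 1 - C (qintU t (cont base y u))) *
        (1 + C ((t : O) * qintU t (cont base y u)) - X)) := by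
    rw [Finset.prod_insert, Finset.prod_insert]
    · have h1 : cont base (y + 1) (y :: u) = cont base y u + 1 := by simp [cont]
      have h2 : cont base (y - 1) (y :: u) = cont base y u - 1 := by
        simp only [cont]
        rw [if_neg (Ne.symm (S.two_ne (by omega) y))]
        simp
      have h3 : ∏ z ∈ SS, (X - C (qintU t (cont base z (y :: u)))) =
          ∏ z ∈ SS, (X - C (qintU t (cont base z u))) := by
        refine Finset.prod_congr rfl fun z hz => ?_
        simp only [SS, Finset.mem_filter, Finset.mem_univ, true_and] at hz
        simp only [cont]
        rw [if_neg hz.2.1, if_neg hz.2.2]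
      rw [h1, h2, h3, qintU_succ]
      have h4 := qintU_succ t (cont base y u - 1)
      rw [sub_add_cancel] at h4
      rw [h4]
      simp only [map_add, map_mul, map_one]
      ring
    · simp [SS]
    · simp only [SS, Finset.mem_insert, Finset.mem_filter, Finset.mem_univ, true_and]
      push Not
      exact ⟨S.two_ne (by omega) y, fun _ h => absurd rfl h⟩
  rw [← hpoly, map_mul] at key
  rw [ha, map_mul, mul_assoc]
  have key2 : (-(t : O)) • ((aeval (L (u.length + 1)))
      (∏ z ∈ insert (y + 1) (insert (y - 1) SS), (X - C (qintU t (cont base z (y :: u))))) * FF y) = 0 := by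
    rw [← smul_mul_assoc, Algebra.smul_def, Algebra.commutes]
    simpa using key
  have ht : IsUnit (-(t : O)) := by rw [IsUnit.neg_iff]; exact t.isUnit
  have key3 := (IsUnit.smul_eq_zero ht).1 key2
  rw [← hu, key3, mul_zero]

theorem pol_all (S : Setup t e n kap base) (L T : ℕ → A) (H : HeckeN t n L T)
    (m : ℕ) (hmn : m + 1 ≤ n)
    (hp : ∀ w : List (ZMod e), w.length < m → Pol t L base w)
    (hv : ∀ w : List (ZMod e), w.length ≤ m → FW t base L w ≠ 0 → val kap w)
    (y : ZMod e) (u : List (ZMod e)) (hu : u.length + 1 = m) : Pol t L base (y :: u) := by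
  have h1 := pol_step t S L T H m hmn hp hv y u hu
  unfold Pol
  set b := fun z => qintU t (cont base z (y :: u)) with hb
  have h2 : (∏ z, (X - C (b z))) = (X - C (b y)) * ∏ z ∈ Finset.univ.filter (· ≠ y), (X - C (b z)) := by
    rw [← Finset.mul_prod_erase Finset.univ (fun z => X - C (b z)) (Finset.mem_univ y)]
    congr 1
    refine Finset.prod_congr ?_ fun _ _ => rfl
    ext z; simp
  have hun : ∀ z ∈ Finset.univ.filter (· ≠ y), IsUnit (b y - b z) := by
    intro z hz
    simp only [Finset.mem_filter, Finset.mem_univ, true_and] at hz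
    exact bunit t S (y :: u) y z (Ne.symm hz)
  have h3 : ∏ z ∈ Finset.univ.filter (· ≠ y), (X - C (b z)) =
      C (∏ z ∈ Finset.univ.filter (· ≠ y), (b y - b z)) * Lg b y := by
    unfold Lg
    have : (Finset.univ.filter (· ≠ y)) = @Finset.erase _ (fun a b => Classical.propDecidable (a = b)) Finset.univ y := by
      ext z; simp
    rw [← this, map_prod, ← Finset.prod_mul_distrib]
    refine Finset.prod_congr rfl fun z hz => ?_
    rw [← mul_assoc, ← C_mul, Ring.mul_inverse_cancel _ (hun z hz)]
    simp
  have h4 : (y :: u).length = m := by simpa using hu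
  rw [h4, h2, h3, map_mul, map_mul, mul_assoc, mul_assoc, h1]
  simp

end HSide2
end Paper

open scoped BigOperators
open scoped Classical
namespace Paper

section HSide3
open Polynomial
variable {O : Type*} [CommRing O] {A : Type*} [Ring A] [Algebra O A] (t : Oˣ)
variable {e : ℕ} [NeZero e]
variable {n : ℕ} {kap base : ZMod e → ℤ} (S : Setup t e n kap base)
variable (L T : ℕ → A) (H : HeckeN t n L T)

theorem phi_comm (L T : ℕ → A) (H : HeckeN t n L T)
    (r k : ℕ) (hr : r + 1 < n) (h1 : k ≠ r) (h2 : k ≠ r + 1) :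
    L k * phi t (T r) (L r) (L (r + 1)) = phi t (T r) (L r) (L (r + 1)) * L k := by
  unfold phi
  have h3 := H.TL r k hr h1 h2
  have h4 := H.LL k r
  have h5 := H.LL k (r + 1)
  have h6 : L k * (T r * (L r - L (r + 1))) = T r * (L r - L (r + 1)) * L k := by
    rw [← mul_assoc, ← h3, mul_assoc, mul_assoc, mul_sub, sub_mul, h4, h5]
  simp only [mul_add, add_mul, mul_smul_comm, smul_mul_assoc, h6, h5, mul_one, one_mul]

theorem EV_phi (L T : ℕ → A) (H : HeckeN t n L T)
    (g : A) (u : List (ZMod e)) (x y : ZMod e) (hr : u.length + 1 < n)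
    (v : List (ZMod e)) (hg : EV t L g (v ++ x :: y :: u)) :
    EV t L (phi t (T u.length) (L u.length) (L (u.length + 1)) * g) (v ++ y :: x :: u) := by
  induction v with
  | nil =>
    obtain ⟨⟨a, ha, h1⟩, ⟨b, hb, h2⟩, h3⟩ := hg
    have hX := phi_X t (T u.length) (L u.length) (L (u.length + 1)) (H.LL _ _) (H.LT _ hr)
    have hY := phi_Y t (T u.length) (L u.length) (L (u.length + 1)) (H.LL _ _)
      (rank2_TY t _ _ _ (H.quad _ hr) (H.LT _ hr))
    refine ⟨⟨b, hb, ?_⟩, ⟨a, ha, ?_⟩, ?_⟩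
    · rw [List.length_cons, ← mul_assoc, ← hX, mul_assoc, h2, mul_smul_comm]
    · simp only [List.length_cons] at h1
      rw [← mul_assoc, ← hY, mul_assoc, h1, mul_smul_comm]
    · exact EV_lmul t L g _ u h3 (fun k hk => phi_comm t L T H _ _ hr (by omega) (by omega))
  | cons z v ih =>
    obtain ⟨⟨a, ha, h1⟩, h3⟩ := hg
    refine ⟨⟨a, ha, ?_⟩, ih h3⟩
    have h1' : L (v ++ x :: y :: u).length * g = qintU t a • g := h1
    change L (v ++ y :: x :: u).length * _ = _
    have hlen : (v ++ x :: y :: u).length = (v ++ y :: x :: u).length := by simp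
    have hlen2 : u.length + 2 ≤ (v ++ y :: x :: u).length := by simp
    rw [hlen] at h1'
    rw [← mul_assoc, phi_comm t L T H _ _ hr (by omega) (by omega), mul_assoc, h1',
      mul_smul_comm]

theorem phi_nz (S : Setup t e n kap base) (L T : ℕ → A) (H : HeckeN t n L T)
    (g : A) (u : List (ZMod e)) (x y : ZMod e) (hr : u.length + 1 < n)
    (hg : EV t L g (x :: y :: u)) (h1 : x ≠ y + 1) (h2 : x ≠ y - 1)
    (h0 : phi t (T u.length) (L u.length) (L (u.length + 1)) * g = 0) : g = 0 := by
  obtain ⟨⟨a, ha, hA⟩, ⟨b, hb, hB⟩, -⟩ := hg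
  simp only [List.length_cons] at hA
  have h3 := phi_sq t (T u.length) (L u.length) (L (u.length + 1)) (H.LL _ _)
    (H.quad _ hr) (H.LT _ hr)
  have h4 : ((t : O) • L u.length + 1 - L (u.length + 1)) *
      ((t : O) • L (u.length + 1) + 1 - L u.length) * g = 0 := by
    rw [← h3, mul_assoc, h0, mul_zero]
  have h5 : ((t : O) • L (u.length + 1) + 1 - L u.length) * g =
      (qintU t (a + 1) - qintU t b) • g := by
    rw [sub_mul, add_mul, smul_mul_assoc, hA, hB, one_mul, qintU_succ]
    module
  have h6 : ((t : O) • L u.length + 1 - L (u.length + 1)) * g =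
      (qintU t (b + 1) - qintU t a) • g := by
    rw [sub_mul, add_mul, smul_mul_assoc, hA, hB, one_mul, qintU_succ]
    module
  rw [mul_assoc, h5, mul_smul_comm, h6] at h4
  have u1 : IsUnit (qintU t (a + 1) - qintU t b) := by
    apply isUnit_qsub t e S.hU
    push_cast; rw [ha, hb]; intro h; apply h2; linear_combination h
  have u2 : IsUnit (qintU t (b + 1) - qintU t a) := by
    apply isUnit_qsub t e S.hU
    push_cast; rw [ha, hb]; exact Ne.symm h1
  exact (IsUnit.smul_eq_zero u2).1 ((IsUnit.smul_eq_zero u1).1 h4)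

theorem phi_eig (S : Setup t e n kap base)
    (hn : 2 ≤ n) (Tr X Y g : A) (hXY : X * Y = Y * X)
    (hq : Tr * Tr = ((t : O) - 1) • Tr + (t : O) • (1 : A))
    (hYT : Y * Tr = Tr * X + 1 + ((t : O) - 1) • Y)
    (a b : ℤ) (hX : X * g = qintU t a • g) (hY : Y * g = qintU t b • g)
    (h0 : phi t Tr X Y * g = 0) :
    (((b : ZMod e) = a + 1) → Tr * g = (t : O) • g) ∧
      (((b : ZMod e) = a - 1) → Tr * g = - g) := by
  have h3 := phi_sq t Tr X Y hXY hq hYT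
  have h4 : ((t : O) • X + 1 - Y) * ((t : O) • Y + 1 - X) * g = 0 := by
    rw [← h3, mul_assoc, h0, mul_zero]
  have h5 : ((t : O) • Y + 1 - X) * g = (qintU t (b + 1) - qintU t a) • g := by
    rw [sub_mul, add_mul, smul_mul_assoc, hX, hY, one_mul, qintU_succ]
    module
  have h6 : ((t : O) • X + 1 - Y) * g = (qintU t (a + 1) - qintU t b) • g := by
    rw [sub_mul, add_mul, smul_mul_assoc, hX, hY, one_mul, qintU_succ]
    module
  rw [mul_assoc, h5, mul_smul_comm, h6] at h4
  have h7 : (qintU t a - qintU t b) • (Tr * g) + (1 + ((t : O) - 1) * qintU t b) • g = 0 := by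
    have : phi t Tr X Y * g = Tr * (X * g) - Tr * (Y * g) + g + ((t : O) - 1) • (Y * g) := by
      unfold phi
      simp only [mul_sub, add_mul, sub_mul, smul_mul_assoc, one_mul, mul_assoc]
    rw [this, hX, hY] at h0
    simp only [mul_smul_comm] at h0
    rw [← h0]
    module
  constructor
  · intro hab
    have u1 : IsUnit (qintU t (b + 1) - qintU t a) := by
      apply isUnit_qsub t e S.hU
      push_cast; rw [hab]; intro h; apply S.two_ne hn (a : ZMod e); linear_combination h
    have h8 : (qintU t (a + 1) - qintU t b) • g = 0 := (IsUnit.smul_eq_zero u1).1 h4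
    have h9 : (qintU t (a + 1) - qintU t b) • (Tr * g) = 0 := by
      rw [← mul_smul_comm, h8, mul_zero]
    have h10 : ((t ^ a : Oˣ) : O) • (Tr * g - (t : O) • g) = 0 := by
      rw [qintU_pow]
      rw [qintU_succ] at h8 h9
      linear_combination (norm := module) h9 - h7 - ((t : O) - 1) • h8
    exact sub_eq_zero.1 ((IsUnit.smul_eq_zero (Units.isUnit _)).1 h10)
  · intro hab
    have u1 : IsUnit (qintU t (a + 1) - qintU t b) := by
      apply isUnit_qsub t e S.hU
      push_cast; rw [hab]; exact S.two_ne hn (a : ZMod e)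
    have h8 : (qintU t (b + 1) - qintU t a) • g = 0 := by
      rw [smul_comm] at h4
      exact (IsUnit.smul_eq_zero u1).1 h4
    have h9 : (qintU t (b + 1) - qintU t a) • (Tr * g) = 0 := by
      rw [← mul_smul_comm, h8, mul_zero]
    have h10 : ((t ^ b : Oˣ) : O) • (Tr * g + g) = 0 := by
      rw [qintU_pow]
      rw [qintU_succ] at h8 h9
      linear_combination (norm := module) h9 + h7
    exact eq_neg_of_add_eq_zero_left ((IsUnit.smul_eq_zero (Units.isUnit _)).1 h10)

theorem HS_all (S : Setup t e n kap base) (L T : ℕ → A) (H : HeckeN t n L T)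
    [IsDomain O] (hcyc : 0 < n → aeval (L 0) (∏ z ∈ Finset.univ.filter (fun z => kap z = 1),
      (X - C (qintU t (base z)))) = 0) (m : ℕ) (hmn : m ≤ n) :
    (∀ w : List (ZMod e), w.length < m → Pol t L base w) ∧
    (∀ w : List (ZMod e), w.length ≤ m → FW t base L w ≠ 0 → val kap w) := by
  induction m with
  | zero =>
    refine ⟨fun w hw => by omega, fun w hw _ => ?_⟩
    have : w = [] := List.length_eq_zero_iff.1 (by omega)
    subst this
    trivial
  | succ m ih =>
    obtain ⟨hp, hv⟩ := ih (by omega)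
    have hp' : ∀ w : List (ZMod e), w.length < m + 1 → Pol t L base w := by
      intro w hw
      match w, hw with
      | [], _ =>
        unfold Pol
        have hd : (∏ z ∈ Finset.univ.filter (fun z => kap z = 1), (X - C (qintU t (base z)))) ∣
            ∏ z, (X - C (qintU t (cont base z []))) :=
          Finset.prod_dvd_prod_of_subset _ _ _ (Finset.subset_univ _)
        obtain ⟨q, hq⟩ := hd
        rw [hq, map_mul]
        simp [hcyc (by omega)]
      | y :: u, hw =>
        simp only [List.length_cons] at hw
        rcases Nat.lt_or_ge (u.length + 1) m with h | h
        · exact hp _ (by simpa using h)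
        · exact pol_all t S L T H m hmn hp hv y u (by omega)
    refine ⟨hp', fun w hw hF => ?_⟩
    rcases Nat.lt_or_ge w.length (m + 1) with h | h
    · exact hv w (by omega) hF
    rcases Nat.eq_zero_or_pos m with hm | hm
    · subst hm
      obtain ⟨x, rfl⟩ : ∃ x, w = [x] := List.length_eq_one_iff.1 (by omega)
      refine ⟨?_, trivial⟩
      simp only [hh]
      by_contra hc
      apply hF
      simp only [FW, one_mul, List.length_nil]
      obtain ⟨a, ha⟩ := Lg_eq' (fun z => qintU t (cont base z [])) x (Finset.univ.filter (· ≠ x))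
        (by simp)
      have hd : (∏ z ∈ Finset.univ.filter (fun z => kap z = 1), (X - C (qintU t (base z)))) ∣
            ∏ z ∈ Finset.univ.filter (· ≠ x), (X - C (qintU t (cont base z []))) := by
        apply Finset.prod_dvd_prod_of_subset
        intro z hz
        simp only [Finset.mem_filter, Finset.mem_univ, true_and] at hz ⊢
        rintro rfl
        exact hc hz
      obtain ⟨q, hq⟩ := hd
      rw [ha, hq, map_mul, map_mul, hcyc (by omega)]
      simp
    have P2 : ∀ x (u : List (ZMod e)), u.length + 1 = m → FW t base L (x :: x :: u) = 0 := by
      intro x u hu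
      have h1 := pol_step t S L T H m hmn hp hv x u hu
      have hc : FW t base L (x :: u) * aeval (L m) (Lg (fun z => qintU t (cont base z (x :: u))) x) =
          aeval (L m) (Lg (fun z => qintU t (cont base z (x :: u))) x) * FW t base L (x :: u) :=
        FW_comm t L _ _ (fun k _ => (aeval_comm _ _ (H.LL _ _) _).symm)
      rw [← hc] at h1
      have h2 : (x :: u).length = m := by simpa using hu
      conv_lhs => unfold FW
      rw [h2]
      exact h1
    have hEV : ∀ w : List (ZMod e), w.length ≤ m + 1 → EV t L (FW t base L w) w :=
      FW_EV t L H.LL S.hb (m + 1) hp'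
    have hfix := fun w hw g hg => EV_fix t S L (m + 1) hp' w hw g hg
    refine val_step n S.hne kap S.hk0 S.hk S.hkG (fun w => FW t base L w ≠ 0) m hm hmn
      ?_ (fun u hu => hv u (by omega)) ?_ ?_ ?_ w (by omega) hF
    · intro x u h1 h2
      apply h1
      simp only [FW]
      rw [h2, zero_mul]
    · intro x u hu h1
      exact h1 (P2 x u (by simpa using hu))
    · intro v x y u hl h1 h2 h3 h4 h5
      apply h4
      have hl' : v.length + (u.length + 2) = m + 1 := by simpa using hl
      have h6 := EV_phi t L T H (FW t base L (v ++ x :: y :: u)) u x y (by omega) v (hEV _ (by omega))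
      have h7 := hfix _ (by simp at hl ⊢; omega) _ h6
      rw [h5, zero_mul] at h7
      exact phi_nz t S L T H _ u x y (by omega) (EV_append t L _ v _ (hEV _ (by omega))) h2 h3 h7.symm
    · intro x y u hl hxy hne
      have hl' : u.length + 2 = m := by simpa using hl
      have hE := hEV (x :: y :: x :: u) (by omega)
      set g := FW t base L (x :: y :: x :: u) with hg
      have e1 := EV_phi t L T H g u y x (by omega) [x] hE
      have e2 := EV_phi t L T H g (x :: u) x y (by simp; omega) [] hE
      have f1 := hfix _ (by simp; omega) _ e1
      have f2 := hfix _ (by simp; omega) _ e2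
      rw [show [x] ++ x :: y :: u = x :: x :: y :: u from rfl, P2 x (y :: u) (by simpa using hl'),
        zero_mul] at f1
      have hz : FW t base L ([] ++ y :: x :: x :: u) = 0 := by
        have h0 : FW t base L (x :: x :: u) = 0 := by
          by_contra hc
          have h1 := hv (x :: x :: u) (by simp; omega) hc
          have h2 := h1.1
          have h3 := h1.2.1
          simp [hh] at h2
          omega
        simp only [FW, List.nil_append]
        simp only [FW] at h0
        rw [h0, zero_mul]
      rw [hz, zero_mul] at f2
      obtain ⟨⟨a, ha, hA⟩, ⟨b, hb, hB⟩, ⟨c, hc, hC⟩, -⟩ := hE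
      simp only [List.length_cons] at hA hB f2
      have q1 := phi_eig t S (by omega) (T u.length) (L u.length) (L (u.length + 1)) g (H.LL _ _)
        (H.quad _ (by omega)) (H.LT _ (by omega)) c b hC hB f1.symm
      have q2 := phi_eig t S (by omega) (T (u.length + 1)) (L (u.length + 1)) (L (u.length + 1 + 1)) g
        (H.LL _ _) (H.quad _ (by omega)) (H.LT _ (by omega)) b a hB hA f2.symm
      rw [ha, hb] at q2
      rw [hb, hc] at q1
      have hbr : T u.length * (T (u.length + 1) * (T u.length * g)) =
          T (u.length + 1) * (T u.length * (T (u.length + 1) * g)) := by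
        simp only [← mul_assoc]
        rw [H.braid _ (by omega)]
      have hfin : (t : O) • ((1 : O) + t) • g = 0 := by
        rcases hxy with h | h
        · have r1 := q1.2 (by rw [h]; ring)
          have r2 := q2.1 h
          simp only [r1, r2, mul_neg, mul_smul_comm, smul_neg, neg_neg] at hbr
          linear_combination (norm := module) hbr
        · have r1 := q1.1 (by rw [h]; ring)
          have r2 := q2.2 h
          simp only [r1, r2, mul_neg, mul_smul_comm, smul_neg, neg_neg] at hbr
          linear_combination (norm := module) - hbr
      have u2 : IsUnit ((1 : O) + t) := by
        have h1 : qintU t 2 = 1 + (t : O) := by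
          rw [show (2 : ℤ) = 1 + 1 by norm_num, qintU_succ, qintU_one]; ring
        rw [← h1]
        apply S.hU
        intro hd
        have := Int.le_of_dvd (by norm_num) hd
        have := S.hne
        omega
      exact hne ((IsUnit.smul_eq_zero u2).1 ((IsUnit.smul_eq_zero t.isUnit).1 hfin))

end HSide3
end Paper

open scoped BigOperators
open scoped Classical
namespace Paper

section Words
variable {e n : ℕ}

/-- entries of a residue sequence, indexed by natural numbers -/
def xi (i : Fin n → ZMod e) (k : ℕ) : ZMod e := if h : k < n then i ⟨k, h⟩ else 0

/-- the (reversed) word of length `k` attached to a residue sequence -/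
def pw (i : Fin n → ZMod e) : ℕ → List (ZMod e)
  | 0 => []
  | k + 1 => xi i k :: pw i k

theorem xi_fin (i : Fin n → ZMod e) (k : Fin n) : xi i k = i k := by simp [xi]

theorem pw_length (i : Fin n → ZMod e) (k : ℕ) : (pw i k).length = k := by
  induction k with
  | zero => rfl
  | succ k ih => simp [pw, ih]

theorem val_pw (kap : ZMod e → ℤ) (i : Fin n → ZMod e) (m k : ℕ) (hk : k ≤ m)
    (h : val kap (pw i m)) : val kap (pw i k) := by
  induction m with
  | zero => have : k = 0 := by omega
            subst this; exact h
  | succ m ih =>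
    rcases Nat.lt_or_ge m k with h1 | h1
    · have : k = m + 1 := by omega
      subst this; exact h
    · exact ih h1 h.2

theorem pw_congr (i j : Fin n → ZMod e) (m : ℕ) (h : ∀ k, k < m → xi i k = xi j k) :
    pw i m = pw j m := by
  induction m with
  | zero => rfl
  | succ m ih =>
    simp only [pw]
    rw [h m (by omega), ih (fun k hk => h k (by omega))]

/-- the transposition of positions -/
def sg {n : ℕ} (r : Fin (n - 1)) (k : Fin n) : Fin n :=
  if k = pL r then pR r else if k = pR r then pL r else k

theorem pLR {n : ℕ} (r : Fin (n - 1)) : pL r ≠ pR r := by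
  intro h
  have := congrArg Fin.val h
  simp [pL, pR] at this

theorem sg_L {n : ℕ} (r : Fin (n - 1)) : sg r (pL r) = pR r := by simp [sg]
theorem sg_R {n : ℕ} (r : Fin (n - 1)) : sg r (pR r) = pL r := by
  simp [sg, (pLR r).symm]
theorem sg_of_ne {n : ℕ} (r : Fin (n - 1)) (k : Fin n) (h : k.1 ≠ r.1 ∧ k.1 ≠ r.1 + 1) :
    sg r k = k := by
  unfold sg
  rw [if_neg, if_neg]
  · intro h1; exact h.2 (by rw [h1]; rfl)
  · intro h1; exact h.1 (by rw [h1]; rfl)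

theorem swapSeq_sg (i : Fin n → ZMod e) (r : Fin (n - 1)) (k : Fin n) :
    swapSeq i r k = i (sg r k) := by
  unfold swapSeq sg
  split_ifs <;> rfl

theorem sg_sg {n : ℕ} (r : Fin (n - 1)) (k : Fin n) : sg r (sg r k) = k := by
  by_cases h1 : k = pL r
  · rw [h1, sg_L, sg_R]
  by_cases h2 : k = pR r
  · rw [h2, sg_R, sg_L]
  have : sg r k = k := by simp [sg, h1, h2]
  rw [this, this]

theorem swap_swap (i : Fin n → ZMod e) (r : Fin (n - 1)) : swapSeq (swapSeq i r) r = i := by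
  funext k
  rw [swapSeq_sg, swapSeq_sg, sg_sg]

theorem pw_pL (i : Fin n → ZMod e) (r : Fin (n - 1)) :
    pw (swapSeq i r) r.1 = pw i r.1 := by
  apply pw_congr
  intro k hk
  have hn := r.2
  have : k < n := by omega
  have h1 := xi_fin (swapSeq i r) ⟨k, this⟩
  have h2 := xi_fin i ⟨k, this⟩
  simp only at h1 h2
  rw [h1, h2, swapSeq_sg, sg_of_ne _ _ ⟨by simp; omega, by simp; omega⟩]

theorem xi_pL (i : Fin n → ZMod e) (r : Fin (n - 1)) : xi i r.1 = i (pL r) := xi_fin i (pL r)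
theorem xi_pR (i : Fin n → ZMod e) (r : Fin (n - 1)) : xi i (r.1 + 1) = i (pR r) := xi_fin i (pR r)

theorem pw_two (i : Fin n → ZMod e) (r : Fin (n - 1)) :
    pw i (r.1 + 2) = i (pR r) :: i (pL r) :: pw i r.1 := by
  simp only [pw]
  rw [xi_pL, xi_pR]

theorem pw_split (i : Fin n → ZMod e) (r : Fin (n - 1)) (d : ℕ) (hd : r.1 + 2 + d ≤ n) :
    ∃ v, pw i (r.1 + 2 + d) = v ++ i (pR r) :: i (pL r) :: pw i r.1 ∧
      pw (swapSeq i r) (r.1 + 2 + d) = v ++ i (pL r) :: i (pR r) :: pw i r.1 := by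
  induction d with
  | zero =>
    refine ⟨[], pw_two i r, ?_⟩
    have h := pw_two (swapSeq i r) r
    rw [pw_pL, swapSeq_sg, swapSeq_sg, sg_L, sg_R] at h
    exact h
  | succ d ih =>
    obtain ⟨v, h1, h2⟩ := ih (by omega)
    refine ⟨xi i (r.1 + 2 + d) :: v, ?_, ?_⟩
    · rw [← add_assoc, pw, h1]; rfl
    · rw [← add_assoc, pw, h2]
      have h3 := xi_fin (swapSeq i r) ⟨r.1 + 2 + d, by omega⟩
      have h4 := xi_fin i ⟨r.1 + 2 + d, by omega⟩
      simp only at h3 h4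
      rw [h3, h4, swapSeq_sg, sg_of_ne _ _ ⟨by simp; omega, by simp; omega⟩]
      rfl

theorem cont_mid (base : ZMod e → ℤ) (z : ZMod e) (u2 u1 : List (ZMod e))
    (h : ∀ w ∈ u2, w ≠ z + 1 ∧ w ≠ z - 1) : cont base z (u2 ++ u1) = cont base z u1 := by
  induction u2 with
  | nil => rfl
  | cons w u2 ih =>
    have h1 := h w List.mem_cons_self
    simp only [List.cons_append, cont]
    rw [if_neg (by intro h2; apply h1.2; rw [h2]; ring),
      if_neg (by intro h2; apply h1.1; rw [h2]; ring)]
    exact ih (fun x hx => h x (List.mem_cons_of_mem _ hx))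

end Words
end Paper

open scoped BigOperators
open scoped Classical
namespace Paper

section Weight
variable {O : Type*} [CommRing O] {A : Type*} [Ring A] [Algebra O A] {e n : ℕ} [NeZero e]

/-- residues `x`, `y` are neighbours -/
def Adj (x y : ZMod e) : Prop := y = x + 1 ∨ x = y + 1

theorem Adj.symm {x y : ZMod e} (h : Adj x y) : Adj y x := Or.symm h

/-- weight data -/
structure WD (t : Oˣ) (C : (Fin n → ZMod e) → Fin n → O) (f : (Fin n → ZMod e) → A) : Prop where
  sum : ∑ i, f i = 1
  idem : ∀ i, f i * f i = f i
  orth : ∀ i j, i ≠ j → f i * f j = 0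
  unit : ∀ i j k m, i k ≠ j m → IsUnit (C i k - C j m)
  unit1 : ∀ i j k m, i k + 1 ≠ j m → IsUnit (t * C i k + 1 - C j m)
  ne1 : ∀ i r, f i ≠ 0 → i (pL r) ≠ i (pR r)
  ne2 : ∀ i (r s : Fin (n - 1)), s.1 = r.1 + 1 → f i ≠ 0 → i (pL r) ≠ i (pR s)
  adjR : ∀ i r, f i ≠ 0 → i (pR r) = i (pL r) + 1 →
    f (swapSeq i r) = 0 ∧ C i (pR r) = t * C i (pL r) + 1
  adjL : ∀ i r, f i ≠ 0 → i (pL r) = i (pR r) + 1 →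
    f (swapSeq i r) = 0 ∧ C i (pL r) = t * C i (pR r) + 1

/-- diagonal elements -/
def DD (f : (Fin n → ZMod e) → A) (s : (Fin n → ZMod e) → O) : A := ∑ i, s i • f i

/-- inverse of differences -/
noncomputable def dl (C : (Fin n → ZMod e) → Fin n → O) (k m : Fin n) (i : Fin n → ZMod e) : O :=
  if i k = i m then 0 else Ring.inverse (C i k - C i m)

noncomputable def al (t : Oˣ) (C : (Fin n → ZMod e) → Fin n → O) (k m : Fin n)
    (i : Fin n → ZMod e) : O := -(1 + ((t : O) - 1) * C i m) * dl C k m i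

noncomputable def qq (t : Oˣ) (C : (Fin n → ZMod e) → Fin n → O) (k m : Fin n)
    (i : Fin n → ZMod e) : O :=
  if Adj (i k) (i m) then 1 else ((t : O) * C i k + 1 - C i m) * dl C k m i

/-- `S` is carried to `S'` by `X` -/
def Rl (f : (Fin n → ZMod e) → A) (X : A) (r : Fin (n - 1)) (S S' : (Fin n → ZMod e) → O) : Prop :=
  ∀ i, S i • (X * f i) = S' (swapSeq i r) • (X * f i)

variable {t : Oˣ} {C : (Fin n → ZMod e) → Fin n → O} {f : (Fin n → ZMod e) → A}

theorem dl_spec (W : WD t C f) (k m : Fin n) (i : Fin n → ZMod e) (h : i k ≠ i m) :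
    dl C k m i * (C i k - C i m) = 1 := by
  rw [dl, if_neg h]
  exact Ring.inverse_mul_cancel _ (W.unit i i k m h)

theorem DD_f (W : WD t C f) (s : (Fin n → ZMod e) → O) (i) : DD f s * f i = s i • f i := by
  unfold DD
  rw [Finset.sum_mul, Finset.sum_eq_single i]
  · rw [smul_mul_assoc, W.idem]
  · intro j _ hj
    rw [smul_mul_assoc, W.orth j i hj, smul_zero]
  · simp

theorem f_DD (W : WD t C f) (s : (Fin n → ZMod e) → O) (i) : f i * DD f s = s i • f i := by
  unfold DD
  rw [Finset.mul_sum, Finset.sum_eq_single i]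
  · rw [mul_smul_comm, W.idem]
  · intro j _ hj
    rw [mul_smul_comm, W.orth i j hj.symm, smul_zero]
  · simp

theorem ext_f (W : WD t C f) (a b : A) (h : ∀ i, a * f i = b * f i) : a = b := by
  rw [← mul_one a, ← mul_one b, ← W.sum, Finset.mul_sum, Finset.mul_sum]
  exact Finset.sum_congr rfl (fun i _ => h i)

theorem DD_mul (W : WD t C f) (s s' : (Fin n → ZMod e) → O) :
    DD f s * DD f s' = DD f (fun i => s i * s' i) := by
  apply ext_f W
  intro i
  rw [mul_assoc, DD_f W, mul_smul_comm, DD_f W, DD_f W, smul_smul, mul_comm]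

theorem DD_add (s s' : (Fin n → ZMod e) → O) :
    DD f s + DD f s' = DD f (fun i => s i + s' i) := by
  unfold DD
  rw [← Finset.sum_add_distrib]
  exact Finset.sum_congr rfl (fun i _ => (add_smul _ _ _).symm)

theorem DD_comm (W : WD t C f) (s s' : (Fin n → ZMod e) → O) :
    DD f s * DD f s' = DD f s' * DD f s := by
  rw [DD_mul W, DD_mul W]
  congr 1
  funext i
  ring

theorem DD_ext (s s' : (Fin n → ZMod e) → O) (h : ∀ i, f i ≠ 0 → s i = s' i) :
    DD f s = DD f s' := by
  unfold DD
  apply Finset.sum_congr rfl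
  intro i _
  by_cases hi : f i = 0
  · rw [hi, smul_zero, smul_zero]
  · rw [h i hi]

theorem DD_const (W : WD t C f) (a : O) : DD f (fun _ => a) = algebraMap O A a := by
  unfold DD
  rw [← Finset.smul_sum, W.sum, Algebra.algebraMap_eq_smul_one]

theorem X_DD (W : WD t C f) {X : A} {r : Fin (n - 1)} (hX : ∀ i, X * f i = f (swapSeq i r) * X)
    {S S' : (Fin n → ZMod e) → O} (h : Rl f X r S S') : X * DD f S = DD f S' * X := by
  apply ext_f W
  intro i
  rw [mul_assoc, DD_f W, mul_smul_comm, h i, mul_assoc, hX i, ← mul_assoc, DD_f W, smul_mul_assoc]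

theorem Rl.mul {X : A} {r : Fin (n - 1)} {S S' U U' : (Fin n → ZMod e) → O} (h : Rl f X r S S')
    (h' : Rl f X r U U') : Rl f X r (fun i => S i * U i) (fun i => S' i * U' i) := by
  intro i
  simp only
  rw [mul_smul, h' i, smul_comm, h i, smul_comm, ← mul_smul]

theorem Rl.add {X : A} {r : Fin (n - 1)} {S S' U U' : (Fin n → ZMod e) → O} (h : Rl f X r S S')
    (h' : Rl f X r U U') : Rl f X r (fun i => S i + U i) (fun i => S' i + U' i) := by
  intro i
  simp only
  rw [add_smul, h' i, h i, ← add_smul]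

theorem Rl.const {X : A} {r : Fin (n - 1)} (a : O) : Rl f X r (fun _ => a) (fun _ => a) :=
  fun _ => rfl

theorem Rl.sub {X : A} {r : Fin (n - 1)} {S S' U U' : (Fin n → ZMod e) → O} (h : Rl f X r S S')
    (h' : Rl f X r U U') : Rl f X r (fun i => S i - U i) (fun i => S' i - U' i) := by
  intro i
  simp only
  rw [sub_smul, h' i, h i, ← sub_smul]

theorem Rl.rmul (W : WD t C f) {X : A} {r : Fin (n - 1)} {S S' : (Fin n → ZMod e) → O}
    (h : Rl f X r S S') (s : (Fin n → ZMod e) → O) : Rl f (X * DD f s) r S S' := by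
  intro i
  rw [mul_assoc, DD_f W, mul_smul_comm, smul_comm, h i, smul_comm]

/-- twist hypothesis -/
def TW (C : (Fin n → ZMod e) → Fin n → O) (f : (Fin n → ZMod e) → A) (X : A) (r : Fin (n - 1)) :
    Prop := ∀ k, Rl f X r (fun i => C i k) (fun i => C i (sg r k))

theorem Rl_dl (W : WD t C f) {X : A} {r : Fin (n - 1)} (h : TW C f X r) (k m : Fin n) :
    Rl f X r (dl C k m) (dl C (sg r k) (sg r m)) := by
  intro i
  by_cases hkm : i k = i m
  · have h2 : swapSeq i r (sg r k) = swapSeq i r (sg r m) := by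
      rw [swapSeq_sg, swapSeq_sg, sg_sg, sg_sg, hkm]
    rw [dl, if_pos hkm, dl, if_pos h2]
  · have h2 : swapSeq i r (sg r k) ≠ swapSeq i r (sg r m) := by
      rw [swapSeq_sg, swapSeq_sg, sg_sg, sg_sg]; exact hkm
    have e1 := dl_spec W k m i hkm
    have e2 := dl_spec W _ _ (swapSeq i r) h2
    have e3 := ((h k).sub (h m)) i
    simp only at e3
    calc dl C k m i • (X * f i) = (dl C k m i * (dl C (sg r k) (sg r m) (swapSeq i r) *
          (C (swapSeq i r) (sg r k) - C (swapSeq i r) (sg r m)))) • (X * f i) := by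
            rw [e2, mul_one]
      _ = (dl C k m i * dl C (sg r k) (sg r m) (swapSeq i r)) •
          ((C (swapSeq i r) (sg r k) - C (swapSeq i r) (sg r m)) • (X * f i)) := by
            rw [smul_smul, mul_assoc]
      _ = (dl C (sg r k) (sg r m) (swapSeq i r) * (dl C k m i * (C i k - C i m))) • (X * f i) := by
            rw [← e3, smul_smul]; congr 1; ring
      _ = _ := by rw [e1, mul_one]

theorem Rl_al (W : WD t C f) {X : A} {r : Fin (n - 1)} (h : TW C f X r) (k m : Fin n) :
    Rl f X r (al t C k m) (al t C (sg r k) (sg r m)) := by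
  have h1 := (((Rl.const (f := f) (X := X) (r := r) (-1 : O)).sub
    ((Rl.const ((t : O) - 1)).mul (h m))).mul (Rl_dl W h k m))
  intro i
  have h2 := h1 i
  have e1 : ∀ j k m, al t C k m j = (-1 - ((t : O) - 1) * C j m) * dl C k m j := by
    intro j k m; unfold al; ring
  rw [e1, e1]
  exact h2

theorem Rl_qq (W : WD t C f) {X : A} {r : Fin (n - 1)} (h : TW C f X r) (k m : Fin n) :
    Rl f X r (qq t C k m) (qq t C (sg r k) (sg r m)) := by
  have h1 := (((Rl.const (f := f) (X := X) (r := r) (t : O)).mul (h k)).add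
    (Rl.const (1 : O))).sub (h m) |>.mul (Rl_dl W h k m)
  intro i
  have h2 := h1 i
  have e1 : swapSeq i r (sg r k) = i k := by rw [swapSeq_sg, sg_sg]
  have e2 : swapSeq i r (sg r m) = i m := by rw [swapSeq_sg, sg_sg]
  unfold qq
  rw [e1, e2]
  split_ifs
  · rfl
  · exact h2

end Weight
end Paper

open scoped BigOperators
open scoped Classical
namespace Paper

theorem braid_nc {A : Type*} [Ring A] (x y a12 a21 a23 a32 a13 b12 b23 : A)
    (r1 : a12 * x = x * a21) (r2 : a23 * x = x * a13) (r3 : a13 * x = x * a23)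
    (r4 : a12 * y = y * a13) (r5 : a13 * y = y * a12) (r6 : a23 * y = y * a32)
    (q1 : x * x = b12) (q2 : y * y = b23)
    (i1 : a23 * a12 + a21 * a13 = a13 * a23) (i2 : a13 * a12 = a12 * a23 + a32 * a13)
    (i3 : b12 * a13 + a12 * a23 * a12 = b23 * a13 + a23 * a12 * a23) :
    (x + a12) * (y + a23) * (x + a12) - (y + a23) * (x + a12) * (y + a23) =
      x * y * x - y * x * y := by
  linear_combination (norm := noncomm_ring) x * r2 + q1 * a13 + r4 * x + y * r3 + r4 * a12 +
    a12 * r2 + r1 * a13 - y * r4 - q2 * a13 - r2 * y - x * r5 - r2 * a23 - a23 * r4 - r6 * a13 +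
    x * i1 + y * i2 + i3

section Scal
variable {O : Type*} [CommRing O]

theorem sc_sum (t a b p : O) (hp : p * (a - b) = 1) (p' : O) (hp' : p' * (b - a) = 1) :
    -(1 + (t - 1) * b) * p + -(1 + (t - 1) * a) * p' = t - 1 := by
  have : p' = -p := by linear_combination (-p) * hp' - p' * hp
  subst this
  linear_combination (t-1) * hp

theorem sc_qq (t a b p p' : O) (hp : p * (a - b) = 1) (hp' : p' * (b - a) = 1) :
    (t * a + 1 - b) * p * ((t * b + 1 - a) * p') =
      (t - 1) * (-(1 + (t - 1) * b) * p) + t - (-(1 + (t - 1) * b) * p) ^ 2 := by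
  have : p' = -p := by linear_combination (-p) * hp' - p' * hp
  subst this
  linear_combination (-(t-1)*(1 + (t - 1) * b) * p + t * (p * (a-b) + 1)) * hp

theorem sc_0 (t a b p : O) (hp : p * (a - b) = 1) (h : b = t * a + 1 ∨ a = t * b + 1) :
    (t - 1) * (-(1 + (t - 1) * b) * p) + t - (-(1 + (t - 1) * b) * p) ^ 2 = 0 := by
  have h2 := sc_qq t a b p (-p) hp (by linear_combination hp)
  rw [← h2]
  rcases h with h | h <;> subst h <;> ring

theorem sc_i1 (t a b c p q s p' : O) (hp : p * (a - b) = 1) (hq : q * (b - c) = 1)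
    (hs : s * (a - c) = 1) (hp' : p' * (b - a) = 1) :
    (-(1 + (t - 1) * c) * q) * (-(1 + (t - 1) * b) * p) +
      (-(1 + (t - 1) * a) * p') * (-(1 + (t - 1) * c) * s) =
    (-(1 + (t - 1) * c) * s) * (-(1 + (t - 1) * c) * q) := by
  have : p' = -p := by linear_combination (-p) * hp' - p' * hp
  subst this
  have h3 : p * q = s * q + s * p := by
    linear_combination (-(p * q)) * hs + (q*s) * hp + s * p * hq
  have h4 : q * (1 + (t-1)*b) * p - s * (1 + (t-1)*a) * p = s * q * (1 + (t-1)*c) := by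
    linear_combination h3 + (t-1) * (b * h3  ) - (t-1) * s * hp + (t-1) * s * hq
  linear_combination (1 + (t-1)*c) * h4

theorem sc_i2 (t a b c p q s q' : O) (hp : p * (a - b) = 1) (hq : q * (b - c) = 1)
    (hs : s * (a - c) = 1) (hq' : q' * (c - b) = 1) :
    (-(1 + (t - 1) * c) * s) * (-(1 + (t - 1) * b) * p) =
      (-(1 + (t - 1) * b) * p) * (-(1 + (t - 1) * c) * q) +
      (-(1 + (t - 1) * b) * q') * (-(1 + (t - 1) * c) * s) := by
  have : q' = -q := by linear_combination (-q) * hq' - q' * hq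
  subst this
  have h3 : p * q = s * q + s * p := by
    linear_combination (-(p * q)) * hs + (q*s) * hp + s * p * hq
  linear_combination (-(1 + (t - 1) * c) * (1 + (t - 1) * b)) * h3

theorem sc_i3 (t a b c p q s : O) (hp : p * (a - b) = 1) (hq : q * (b - c) = 1)
    (hs : s * (a - c) = 1) :
    ((t - 1) * (-(1 + (t - 1) * b) * p) + t - (-(1 + (t - 1) * b) * p) ^ 2) *
        (-(1 + (t - 1) * c) * s) +
      (-(1 + (t - 1) * b) * p) * (-(1 + (t - 1) * c) * q) * (-(1 + (t - 1) * b) * p) =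
    ((t - 1) * (-(1 + (t - 1) * c) * q) + t - (-(1 + (t - 1) * c) * q) ^ 2) *
        (-(1 + (t - 1) * c) * s) +
      (-(1 + (t - 1) * c) * q) * (-(1 + (t - 1) * b) * p) * (-(1 + (t - 1) * c) * q) := by
  have h3 : p * q = s * q + s * p := by
    linear_combination (-(p * q)) * hs + (q*s) * hp + s * p * hq
  have h4 : q * (1 + (t-1)*b) * p - s * (1 + (t-1)*a) * p = s * q * (1 + (t-1)*c) := by
    linear_combination h3 + (t-1) * (b * h3) - (t-1) * s * hp + (t-1) * s * hq
  linear_combination (-(1 + (t-1)*c) * s * (t-1) * (1 + (t-1)*b) * p) * hp +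
    ((1 + (t-1)*c) * s * (t-1) * (1 + (t-1)*c) * q) * hq +
    ((1 + (t-1)*b) * (1 + (t-1)*c)) * (-p * h4 + (1 + (t-1)*c) * q * h3)

end Scal
end Paper

open scoped BigOperators
open scoped Classical
namespace Paper

theorem sg_braid {n : ℕ} (r s : Fin (n - 1)) (h : s.1 = r.1 + 1) :
    pL s = pR r ∧ sg r (pR s) = pR s ∧ sg s (pL r) = pL r ∧ sg s (pR r) = pR s ∧
      sg s (pR s) = pR r := by
  have h0 : pL s = pR r := by apply Fin.ext; simp [pL, pR, h]
  refine ⟨h0, ?_, ?_, ?_, ?_⟩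
  · exact sg_of_ne _ _ ⟨by simp [pR]; omega, by simp [pR]; omega⟩
  · exact sg_of_ne _ _ ⟨by simp [pL]; omega, by simp [pL]; omega⟩
  · rw [← h0, sg_L]
  · rw [sg_R, h0]

section Weight2
variable {O : Type*} [CommRing O] {A : Type*} [Ring A] [Algebra O A] {e n : ℕ} [NeZero e]
variable {t : Oˣ} {C : (Fin n → ZMod e) → Fin n → O} {f : (Fin n → ZMod e) → A}

/-- a family of twisting elements -/
structure Tw (C : (Fin n → ZMod e) → Fin n → O) (f : (Fin n → ZMod e) → A)
    (X : Fin (n - 1) → A) : Prop where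
  xf : ∀ r i, X r * f i = f (swapSeq i r) * X r
  tw : ∀ r, TW C f (X r) r

theorem f_comm_DD (W : WD t C f) (S : (Fin n → ZMod e) → O) (i) : DD f S * f i = f i * DD f S := by
  rw [DD_f W, f_DD W]

theorem Tw.mulDD (W : WD t C f) {X : Fin (n - 1) → A} (H : Tw C f X)
    (S : Fin (n - 1) → (Fin n → ZMod e) → O) : Tw C f (fun r => X r * DD f (S r)) := by
  constructor
  · intro r i
    rw [mul_assoc, f_comm_DD W, ← mul_assoc, H.xf, mul_assoc]
  · intro r k
    exact (H.tw r k).rmul W _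

/-- symmetric families of scalars -/
def Sym2F (f : (Fin n → ZMod e) → A) (X : Fin (n - 1) → A)
    (S : Fin n → Fin n → (Fin n → ZMod e) → O) : Prop :=
  ∀ r k m, Rl f (X r) r (S k m) (S (sg r k) (sg r m))

theorem braid_mulDD (W : WD t C f) {X : Fin (n - 1) → A} (H : Tw C f X)
    (S : Fin n → Fin n → (Fin n → ZMod e) → O) (hS : Sym2F f X S) (r s : Fin (n - 1))
    (h : s.1 = r.1 + 1) (hb : X r * X s * X r = X s * X r * X s) :
    (X r * DD f (S (pL r) (pR r))) * (X s * DD f (S (pL s) (pR s))) *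
      (X r * DD f (S (pL r) (pR r))) =
    (X s * DD f (S (pL s) (pR s))) * (X r * DD f (S (pL r) (pR r))) *
      (X s * DD f (S (pL s) (pR s))) := by
  obtain ⟨h0, h1, h2, h3, h4⟩ := sg_braid r s h
  rw [h0]
  have e1 := X_DD W (H.xf s) (hS s (pL r) (pR s))
  have e2 := X_DD W (H.xf r) (hS r (pL r) (pR s))
  have e3 := X_DD W (H.xf r) (hS r (pR r) (pR s))
  have e4 := X_DD W (H.xf s) (hS s (pL r) (pR r))
  rw [h2, h4] at e1
  rw [sg_L, h1] at e2
  rw [sg_R, h1] at e3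
  rw [h2, h3] at e4
  have c1 := DD_comm W (S (pL r) (pR s)) (S (pL r) (pR r))
  have c2 := DD_comm W (S (pR r) (pR s)) (S (pL r) (pR r))
  have c3 := DD_comm W (S (pR r) (pR s)) (S (pL r) (pR s))
  generalize DD f (S (pL r) (pR r)) = a12 at *
  generalize DD f (S (pL r) (pR s)) = a13 at *
  generalize DD f (S (pR r) (pR s)) = a23 at *
  generalize X r = x at *
  generalize X s = y at *
  have f1 : x * a12 * (y * a23) * (x * a12) = x * y * x * (a23 * a13 * a12) := by
    calc x * a12 * (y * a23) * (x * a12) = x * (a12 * y) * a23 * x * a12 := by noncomm_ring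
      _ = x * y * (a13 * a23) * x * a12 := by rw [← e1]; noncomm_ring
      _ = x * y * a23 * (a13 * x) * a12 := by rw [← c3]; noncomm_ring
      _ = x * y * (a23 * x) * a23 * a12 := by rw [← e3]; noncomm_ring
      _ = x * y * x * (a13 * a23) * a12 := by rw [← e2]; noncomm_ring
      _ = _ := by rw [← c3]; noncomm_ring
  have f2 : y * a23 * (x * a12) * (y * a23) = y * x * y * (a12 * a13 * a23) := by
    calc y * a23 * (x * a12) * (y * a23) = y * (a23 * x) * a12 * y * a23 := by noncomm_ring
      _ = y * x * a13 * (a12 * y) * a23 := by rw [← e2]; noncomm_ring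
      _ = y * x * (a13 * y) * a13 * a23 := by rw [← e1]; noncomm_ring
      _ = y * x * y * (a12 * a13 * a23) := by rw [← e4]; noncomm_ring
  rw [f1, f2, hb]
  congr 1
  rw [c3, mul_assoc, c2, ← mul_assoc, c1]

theorem far_mulDD (W : WD t C f) {X : Fin (n - 1) → A} (H : Tw C f X)
    (S : Fin n → Fin n → (Fin n → ZMod e) → O) (hS : Sym2F f X S) (r s : Fin (n - 1))
    (h : r.1 + 1 < s.1 ∨ s.1 + 1 < r.1) (hb : X r * X s = X s * X r) :
    (X r * DD f (S (pL r) (pR r))) * (X s * DD f (S (pL s) (pR s))) =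
    (X s * DD f (S (pL s) (pR s))) * (X r * DD f (S (pL r) (pR r))) := by
  have e1 := X_DD W (H.xf s) (hS s (pL r) (pR r))
  have e2 := X_DD W (H.xf r) (hS r (pL s) (pR s))
  rw [sg_of_ne _ _ (by simp [pL]; omega), sg_of_ne _ _ (by simp [pR]; omega)] at e1 e2
  have c1 := DD_comm W (S (pL r) (pR r)) (S (pL s) (pR s))
  rw [mul_assoc, ← mul_assoc (DD f _) (X s), ← e1, mul_assoc (X s) (DD f (S (pL s) _)),
    ← mul_assoc (DD f _) (X r), ← e2, mul_assoc, mul_assoc, c1, ← mul_assoc, ← mul_assoc, hb,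
    ← mul_assoc, ← mul_assoc]

/-- the quadratic scalar -/
noncomputable def be (t : Oˣ) (C : (Fin n → ZMod e) → Fin n → O) (k m : Fin n)
    (i : Fin n → ZMod e) : O := ((t : O) - 1) * al t C k m i + t - al t C k m i ^ 2

noncomputable def aT (t : Oˣ) (C : (Fin n → ZMod e) → Fin n → O) (f : (Fin n → ZMod e) → A)
    (r : Fin (n - 1)) : A := DD f (al t C (pL r) (pR r))

theorem far_T (W : WD t C f) {X : Fin (n - 1) → A} (H : Tw C f X) (r s : Fin (n - 1))
    (h : r.1 + 1 < s.1 ∨ s.1 + 1 < r.1) :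
    (X r + aT t C f r) * (X s + aT t C f s) - (X s + aT t C f s) * (X r + aT t C f r) =
      X r * X s - X s * X r := by
  have e1 := X_DD W (H.xf s) (Rl_al W (H.tw s) (pL r) (pR r))
  have e2 := X_DD W (H.xf r) (Rl_al W (H.tw r) (pL s) (pR s))
  rw [sg_of_ne _ _ (by simp [pL]; omega), sg_of_ne _ _ (by simp [pR]; omega)] at e1 e2
  have c1 := DD_comm W (al t C (pL r) (pR r)) (al t C (pL s) (pR s))
  unfold aT
  linear_combination (norm := noncomm_ring) e2 - e1 + c1

theorem al_add (W : WD t C f) (i) (k m : Fin n) (h : i k ≠ i m) :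
    al t C k m i + al t C m k i = (t : O) - 1 :=
  sc_sum _ _ _ _ (dl_spec W k m i h) _ (dl_spec W m k i h.symm)

theorem quad_T (W : WD t C f) {X : Fin (n - 1) → A} (H : Tw C f X) (r : Fin (n - 1)) :
    (X r + aT t C f r) * (X r + aT t C f r) - (((t : O) - 1) • (X r + aT t C f r) + (t : O) • 1) =
      X r * X r - DD f (be t C (pL r) (pR r)) := by
  have e1 := X_DD W (H.xf r) (Rl_al W (H.tw r) (pR r) (pL r))
  rw [sg_L, sg_R] at e1
  have e2 : DD f (al t C (pL r) (pR r)) + DD f (al t C (pR r) (pL r)) = ((t : O) - 1) • 1 := by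
    rw [DD_add, ← Algebra.algebraMap_eq_smul_one, ← DD_const W]
    apply DD_ext
    intro i hi
    exact al_add W i _ _ (W.ne1 i r hi)
  have e3 : DD f (be t C (pL r) (pR r)) + aT t C f r * aT t C f r =
      ((t : O) - 1) • aT t C f r + (t : O) • 1 := by
    unfold aT
    apply ext_f W
    intro i
    rw [DD_mul W, DD_add, DD_f W, add_mul, smul_mul_assoc, smul_mul_assoc, DD_f W, one_mul,
      smul_smul, ← add_smul]
    congr 1
    unfold be
    ring
  have e4 : X r * DD f (al t C (pL r) (pR r)) + X r * DD f (al t C (pR r) (pL r)) =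
      ((t : O) - 1) • X r := by
    rw [← mul_add, e2, mul_smul_comm, mul_one]
  rw [smul_add, ← e4]
  have e5 := e3
  unfold aT at *
  linear_combination (norm := noncomm_ring) - e1 + e5

theorem braid_T (W : WD t C f) {X : Fin (n - 1) → A} (H : Tw C f X)
    (hsq : ∀ r, X r * X r = DD f (be t C (pL r) (pR r))) (r s : Fin (n - 1))
    (h : s.1 = r.1 + 1) :
    (X r + aT t C f r) * (X s + aT t C f s) * (X r + aT t C f r) -
      (X s + aT t C f s) * (X r + aT t C f r) * (X s + aT t C f s) =
    X r * X s * X r - X s * X r * X s := by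
  obtain ⟨h0, h1, h2, h3, h4⟩ := sg_braid r s h
  have a1 := fun i (hi : f i ≠ 0) => W.ne1 i r hi
  have a2 := fun i (hi : f i ≠ 0) => W.ne1 i s hi
  have a3 := fun i (hi : f i ≠ 0) => W.ne2 i r s h hi
  have q1 := hsq r
  have q2 := hsq s
  unfold aT
  rw [h0] at *
  have r1 := X_DD W (H.xf r) (Rl_al W (H.tw r) (pR r) (pL r))
  have r2 := X_DD W (H.xf r) (Rl_al W (H.tw r) (pL r) (pR s))
  have r3 := X_DD W (H.xf r) (Rl_al W (H.tw r) (pR r) (pR s))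
  have r4 := X_DD W (H.xf s) (Rl_al W (H.tw s) (pL r) (pR s))
  have r5 := X_DD W (H.xf s) (Rl_al W (H.tw s) (pL r) (pR r))
  have r6 := X_DD W (H.xf s) (Rl_al W (H.tw s) (pR s) (pR r))
  rw [sg_L, sg_R] at r1
  rw [sg_L, h1] at r2
  rw [sg_R, h1] at r3
  rw [h2, h4] at r4
  rw [h2, h3] at r5
  rw [h3, h4] at r6
  refine braid_nc (X r) (X s) _ _ _ _ _ _ _ r1.symm r2.symm r3.symm r4.symm r5.symm r6.symm q1 q2
    ?_ ?_ ?_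
  · rw [DD_mul W, DD_mul W, DD_mul W, DD_add]
    apply DD_ext
    intro i hi
    exact sc_i1 _ _ _ _ _ _ _ _ (dl_spec W _ _ i (a1 i hi)) (dl_spec W _ _ i (a2 i hi))
      (dl_spec W _ _ i (a3 i hi)) (dl_spec W _ _ i (a1 i hi).symm)
  · rw [DD_mul W, DD_mul W, DD_mul W, DD_add]
    apply DD_ext
    intro i hi
    exact sc_i2 _ _ _ _ _ _ _ _ (dl_spec W _ _ i (a1 i hi)) (dl_spec W _ _ i (a2 i hi))
      (dl_spec W _ _ i (a3 i hi)) (dl_spec W _ _ i (a2 i hi).symm)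
  · simp only [DD_mul W, DD_add]
    apply DD_ext
    intro i hi
    exact sc_i3 _ _ _ _ _ _ _ (dl_spec W _ _ i (a1 i hi)) (dl_spec W _ _ i (a2 i hi))
      (dl_spec W _ _ i (a3 i hi))

end Weight2
end Paper

open scoped BigOperators
open scoped Classical
namespace Paper

section Weight3
variable {O : Type*} [CommRing O] {A : Type*} [Ring A] [Algebra O A] {e n : ℕ} [NeZero e]
variable {t : Oˣ} {C : (Fin n → ZMod e) → Fin n → O} {f : (Fin n → ZMod e) → A}

theorem unit_smul_zero {u : O} (hu : IsUnit u) (z : A) (h : u • z = 0) : z = 0 := by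
  obtain ⟨v, rfl⟩ := hu
  have := congrArg (fun w => ((v⁻¹ : Oˣ) : O) • w) h
  simpa [smul_smul] using this

theorem tw_of_comm (W : WD t C f) (x : A) (r : Fin (n - 1))
    (h : ∀ k, x * DD f (fun i => C i k) = DD f (fun i => C i (sg r k)) * x) :
    (∀ i, x * f i = f (swapSeq i r) * x) ∧ TW C f x r := by
  have key : ∀ i j, j ≠ swapSeq i r → f j * x * f i = 0 := by
    intro i j hj
    obtain ⟨k, hk⟩ := Function.ne_iff.1 hj
    rw [swapSeq_sg] at hk
    have h1 := congrArg (fun z => f j * z * f i) (h (sg r k))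
    simp only [sg_sg] at h1
    have h2 : C i (sg r k) • (f j * x * f i) = C j k • (f j * x * f i) := by
      calc C i (sg r k) • (f j * x * f i) = f j * x * (C i (sg r k) • f i) := by
            rw [mul_smul_comm]
        _ = f j * (x * DD f (fun i => C i (sg r k))) * f i := by
            rw [← DD_f W (fun i => C i (sg r k))]; noncomm_ring
        _ = (f j * DD f (fun i => C i k)) * x * f i := by rw [h1]; noncomm_ring
        _ = _ := by rw [f_DD W]; simp only [smul_mul_assoc]
    apply unit_smul_zero (W.unit j i k (sg r k) hk)
    rw [sub_smul, h2, sub_self]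
  have xf : ∀ i, x * f i = f (swapSeq i r) * x := by
    intro i
    have h1 : x * f i = f (swapSeq i r) * x * f i := by
      calc x * f i = (∑ j, f j) * x * f i := by rw [W.sum, one_mul]
        _ = ∑ j, f j * x * f i := by rw [Finset.sum_mul, Finset.sum_mul]
        _ = _ := Finset.sum_eq_single _ (fun j _ hj => key i j hj) (by simp)
    have h2 : f (swapSeq i r) * x = f (swapSeq i r) * x * f i := by
      calc f (swapSeq i r) * x = f (swapSeq i r) * x * (∑ j, f j) := by rw [W.sum, mul_one]
        _ = ∑ j, f (swapSeq i r) * x * f j := by rw [Finset.mul_sum]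
        _ = _ := Finset.sum_eq_single _ (fun j _ hj => key j _ (by
            intro h3; apply hj; rw [← swap_swap j r, ← h3, swap_swap])) (by simp)
    rw [h1, ← h2]
  refine ⟨xf, ?_⟩
  intro k i
  have h1 := congrArg (fun z => z * f i) (h k)
  simp only [mul_assoc] at h1
  rw [DD_f W, mul_smul_comm, xf i, ← mul_assoc, DD_f W, smul_mul_assoc] at h1
  simp only
  rw [xf i]
  exact h1

/-- The Hecke relations -/
structure HRel (t : Oˣ) (L : Fin n → A) (T : Fin (n - 1) → A) : Prop where
  quad : ∀ r, T r * T r = ((t : O) - 1) • T r + (t : O) • (1 : A)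
  far : ∀ r s : Fin (n - 1), (r.1 + 1 < s.1 ∨ s.1 + 1 < r.1) → T r * T s = T s * T r
  braid : ∀ r s : Fin (n - 1), s.1 = r.1 + 1 → T r * T s * T r = T s * T r * T s
  TL : ∀ (r : Fin (n - 1)) (k : Fin n), (k.1 ≠ r.1 ∧ k.1 ≠ r.1 + 1) → T r * L k = L k * T r
  LT : ∀ r, L (pR r) * T r = T r * L (pL r) + 1 + ((t : O) - 1) • L (pR r)

/-- The `ψ`-relations -/
structure PRel (C : (Fin n → ZMod e) → Fin n → O) (f : (Fin n → ZMod e) → A)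
    (X : Fin (n - 1) → A) : Prop where
  tw : Tw C f X
  far : ∀ r s : Fin (n - 1), (r.1 + 1 < s.1 ∨ s.1 + 1 < r.1) → X r * X s = X s * X r
  braid : ∀ r s : Fin (n - 1), s.1 = r.1 + 1 → X r * X s * X r = X s * X r * X s
  sq : ∀ r i, ¬ Adj (i (pL r)) (i (pR r)) → i (pL r) ≠ i (pR r) → X r * X r * f i = f i

theorem LT_al (W : WD t C f) (r : Fin (n - 1)) :
    DD f (fun i => C i (pR r)) * aT t C f r = aT t C f r * DD f (fun i => C i (pL r)) + 1 +
      ((t : O) - 1) • DD f (fun i => C i (pR r)) := by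
  unfold aT
  apply ext_f W
  intro i
  by_cases hi : f i = 0
  · rw [hi, mul_zero, mul_zero]
  rw [DD_mul W, DD_mul W, DD_f W, add_mul, add_mul, smul_mul_assoc, DD_f W, DD_f W, one_mul,
    smul_smul]
  have h := dl_spec W _ _ i (W.ne1 i r hi)
  have h2 : C i (pR r) * al t C (pL r) (pR r) i = al t C (pL r) (pR r) i * C i (pL r) + 1 +
      ((t : O) - 1) * C i (pR r) := by
    unfold al
    linear_combination (1 + ((t : O) - 1) * C i (pR r)) * h
  rw [h2, add_smul, add_smul, one_smul]

theorem aT_L (W : WD t C f) (r : Fin (n - 1)) (k : Fin n) :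
    aT t C f r * DD f (fun i => C i k) = DD f (fun i => C i k) * aT t C f r := DD_comm W _ _

theorem A_side (W : WD t C f) {X : Fin (n - 1) → A} (H : PRel C f X) :
    HRel t (fun k => DD f (fun i => C i k))
      (fun r => X r * DD f (qq t C (pL r) (pR r)) + aT t C f r) := by
  have hS : Sym2F f X (qq t C) := fun r k m => Rl_qq W (H.tw.tw r) k m
  have hτ : Tw C f (fun r => X r * DD f (qq t C (pL r) (pR r))) := H.tw.mulDD W _
  have hsq : ∀ r, (X r * DD f (qq t C (pL r) (pR r))) * (X r * DD f (qq t C (pL r) (pR r))) =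
      DD f (be t C (pL r) (pR r)) := by
    intro r
    have e1 := X_DD W (H.tw.xf r) (hS r (pR r) (pL r))
    rw [sg_L, sg_R] at e1
    rw [mul_assoc, ← mul_assoc (DD f _) (X r), ← e1, mul_assoc, DD_mul W, ← mul_assoc]
    apply ext_f W
    intro i
    rw [mul_assoc, DD_f W, DD_f W, mul_smul_comm]
    by_cases hi : f i = 0
    · rw [hi, mul_zero, smul_zero, smul_zero]
    have hne := W.ne1 i r hi
    by_cases ha : Adj (i (pL r)) (i (pR r))
    · have h1 : f (swapSeq i r) = 0 ∧ be t C (pL r) (pR r) i = 0 := by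
        rcases ha with ha | ha
        · obtain ⟨h1, h2⟩ := W.adjR i r hi ha
          exact ⟨h1, sc_0 _ _ _ _ (dl_spec W _ _ i hne) (Or.inl h2)⟩
        · obtain ⟨h1, h2⟩ := W.adjL i r hi ha
          exact ⟨h1, sc_0 _ _ _ _ (dl_spec W _ _ i hne) (Or.inr h2)⟩
      rw [h1.2, mul_assoc, H.tw.xf, h1.1, zero_mul, mul_zero, smul_zero, zero_smul]
    · rw [H.sq r i ha hne]
      congr 1
      unfold qq
      rw [if_neg ha, if_neg (fun h => ha h.symm)]
      have := sc_qq (t : O) _ _ _ _ (dl_spec W _ _ i hne) (dl_spec W _ _ i hne.symm)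
      rw [mul_comm]
      exact this
  constructor
  · intro r
    have h := quad_T W hτ r
    rw [hsq r, sub_self] at h
    exact sub_eq_zero.1 h
  · intro r s hrs
    have h := far_T W hτ r s hrs
    rw [far_mulDD W H.tw (qq t C) hS r s hrs (H.far r s hrs), sub_self] at h
    exact sub_eq_zero.1 h
  · intro r s hrs
    have h := braid_T W hτ hsq r s hrs
    rw [braid_mulDD W H.tw (qq t C) hS r s hrs (H.braid r s hrs), sub_self] at h
    exact sub_eq_zero.1 h
  · intro r k hk
    have h1 := X_DD W (hτ.xf r) (hτ.tw r k)
    rw [sg_of_ne _ _ hk] at h1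
    rw [add_mul, mul_add, h1, aT_L W]
  · intro r
    have h1 := X_DD W (hτ.xf r) (hτ.tw r (pL r))
    rw [sg_L] at h1
    rw [add_mul, mul_add, h1, LT_al W]
    abel

noncomputable def gg (t : Oˣ) (C : (Fin n → ZMod e) → Fin n → O) (k m : Fin n)
    (i : Fin n → ZMod e) : O :=
  if Adj (i k) (i m) then 1 else Ring.inverse ((t : O) * C i k + 1 - C i m) * (C i k - C i m)

theorem Rl_gg (W : WD t C f) {X : A} {r : Fin (n - 1)} (h : TW C f X r) (k m : Fin n) :
    Rl f X r (gg t C k m) (gg t C (sg r k) (sg r m)) := by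
  intro i
  have e1 : swapSeq i r (sg r k) = i k := by rw [swapSeq_sg, sg_sg]
  have e2 : swapSeq i r (sg r m) = i m := by rw [swapSeq_sg, sg_sg]
  unfold gg
  rw [e1, e2]
  split_ifs with ha
  · rfl
  · have hu1 := W.unit1 i i k m (fun h => ha (Or.inl h.symm))
    have hu2 := W.unit1 (swapSeq i r) (swapSeq i r) (sg r k) (sg r m)
      (fun h => ha (Or.inl (by rw [e1, e2] at h; exact h.symm)))
    have d := ((h k).sub (h m)) i
    have d2 := ((((Rl.const (f := f) (X := X) (r := r) (t : O)).mul (h k)).add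
      (Rl.const (1 : O))).sub (h m)) i
    simp only at d d2
    generalize (t : O) * C i k + 1 - C i m = u at *
    generalize (t : O) * C (swapSeq i r) (sg r k) + 1 - C (swapSeq i r) (sg r m) = v at *
    have k1 := Ring.inverse_mul_cancel _ hu1
    have k2 := Ring.inverse_mul_cancel _ hu2
    rw [mul_smul, d, mul_smul, smul_comm, smul_comm (Ring.inverse v)]
    congr 1
    calc Ring.inverse u • (X * f i) = Ring.inverse u • ((Ring.inverse v * v) • (X * f i)) := by
          rw [k2, one_smul]
      _ = (Ring.inverse u * Ring.inverse v) • (v • (X * f i)) := by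
          rw [smul_smul, smul_smul, mul_assoc]
      _ = (Ring.inverse v * (Ring.inverse u * u)) • (X * f i) := by
          rw [← d2, smul_smul]; congr 1; ring
      _ = _ := by rw [k1, mul_one]

theorem qq_gg (W : WD t C f) (k m : Fin n) (i : Fin n → ZMod e) (h : i k ≠ i m) :
    gg t C k m i * qq t C k m i = 1 := by
  unfold gg qq
  split_ifs with ha
  · ring
  · have hu1 := Ring.inverse_mul_cancel _ (W.unit1 i i k m (fun h => ha (Or.inl h.symm)))
    have h2 := dl_spec W k m i h
    linear_combination h2 + dl C k m i * (C i k - C i m) * hu1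

theorem B_side (W : WD t C f) {T : Fin (n - 1) → A}
    (H : HRel t (fun k => DD f (fun i => C i k)) T) :
    PRel C f (fun r => (T r - aT t C f r) * DD f (gg t C (pL r) (pR r))) ∧
    ∀ r, T r = (T r - aT t C f r) * DD f (gg t C (pL r) (pR r)) * DD f (qq t C (pL r) (pR r)) +
      aT t C f r := by
  have hc : ∀ r k, (T r - aT t C f r) * DD f (fun i => C i k) =
      DD f (fun i => C i (sg r k)) * (T r - aT t C f r) := by
    intro r k
    have h1 := H.LT r
    have h2 := LT_al W r
    by_cases hL : k = pL r
    · subst hL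
      rw [sg_L, sub_mul, mul_sub, h1, h2]
      abel
    by_cases hR : k = pR r
    · subst hR
      have h3 := rank2_TY (t := t) _ _ _ (H.quad r) h1
      rw [sg_R, sub_mul, mul_sub, h3, aT_L W, h2, aT_L W]
      abel
    have hk : k.1 ≠ r.1 ∧ k.1 ≠ r.1 + 1 :=
      ⟨fun h => hL (Fin.ext h), fun h => hR (Fin.ext h)⟩
    have h3 := H.TL r k hk
    rw [sg_of_ne _ _ hk, sub_mul, mul_sub, h3, aT_L W]
  have hτ : Tw C f (fun r => T r - aT t C f r) :=
    ⟨fun r => (tw_of_comm W _ r (hc r)).1, fun r => (tw_of_comm W _ r (hc r)).2⟩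
  have hS : Sym2F f (fun r => T r - aT t C f r) (gg t C) := fun r k m => Rl_gg W (hτ.tw r) k m
  have hsq : ∀ r, (T r - aT t C f r) * (T r - aT t C f r) = DD f (be t C (pL r) (pR r)) := by
    intro r
    have h := quad_T W hτ r
    simp only [sub_add_cancel] at h
    rw [H.quad r, sub_self] at h
    exact sub_eq_zero.1 h.symm
  refine ⟨⟨hτ.mulDD W _, ?_, ?_, ?_⟩, ?_⟩
  · intro r s hrs
    apply far_mulDD W hτ (gg t C) hS r s hrs
    have h := far_T W hτ r s hrs
    simp only [sub_add_cancel] at h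
    rw [H.far r s hrs, sub_self] at h
    exact sub_eq_zero.1 h.symm
  · intro r s hrs
    apply braid_mulDD W hτ (gg t C) hS r s hrs
    have h := braid_T W hτ hsq r s hrs
    simp only [sub_add_cancel] at h
    rw [H.braid r s hrs, sub_self] at h
    exact sub_eq_zero.1 h.symm
  · intro r i ha hne
    have e1 := X_DD W (hτ.xf r) (hS r (pR r) (pL r))
    rw [sg_L, sg_R] at e1
    have e5 : (T r - aT t C f r) * DD f (gg t C (pL r) (pR r)) *
        ((T r - aT t C f r) * DD f (gg t C (pL r) (pR r))) * f i =
        (T r - aT t C f r) * (T r - aT t C f r) *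
          (DD f (gg t C (pR r) (pL r)) * DD f (gg t C (pL r) (pR r))) * f i := by
      generalize T r - aT t C f r = x at *
      linear_combination (norm := noncomm_ring) - x * e1 * DD f (gg t C (pL r) (pR r)) * f i
    rw [e5, DD_mul W, hsq, mul_assoc, DD_f W, mul_smul_comm, DD_f W, smul_smul]
    have q1 := qq_gg W _ _ i hne
    have q2 := qq_gg W _ _ i hne.symm
    have q3 : qq t C (pL r) (pR r) i * qq t C (pR r) (pL r) i = be t C (pL r) (pR r) i := by
      unfold qq
      rw [if_neg ha, if_neg (fun h => ha h.symm)]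
      exact sc_qq (t : O) _ _ _ _ (dl_spec W _ _ i hne) (dl_spec W _ _ i hne.symm)
    rw [← q3]
    have : gg t C (pR r) (pL r) i * gg t C (pL r) (pR r) i *
      (qq t C (pL r) (pR r) i * qq t C (pR r) (pL r) i) = 1 := by
      linear_combination q2 + (gg t C (pR r) (pL r) i * qq t C (pR r) (pL r) i) * q1
    rw [this, one_smul]
  · intro r
    rw [mul_assoc, DD_mul W]
    have : DD f (fun i => gg t C (pL r) (pR r) i * qq t C (pL r) (pR r) i) = 1 := by
      rw [← map_one (algebraMap O A), ← DD_const W]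
      apply DD_ext
      intro i hi
      exact qq_gg W _ _ i (W.ne1 i r hi)
    rw [this, mul_one, sub_add_cancel]

end Weight3
end Paper

open scoped BigOperators
open scoped Classical
namespace Paper

section HSide2
open Polynomial
variable {O : Type*} [CommRing O] {A : Type*} [Ring A] [Algebra O A] {t : Oˣ}
variable {e : ℕ} [NeZero e] {n : ℕ} {kap base : ZMod e → ℤ}

/-- the eigenvalues attached to a residue sequence -/
def CC (t : Oˣ) (base : ZMod e → ℤ) (i : Fin n → ZMod e) (k : Fin n) : O :=
  qintU t (cont base (i k) (pw i k.1))

theorem WD_of (S : Setup t e n kap base) (f : (Fin n → ZMod e) → A) (hs : ∑ i, f i = 1)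
    (hi : ∀ i, f i * f i = f i) (ho : ∀ i j, i ≠ j → f i * f j = 0)
    (hnz : ∀ i, f i ≠ 0 → val kap (pw i n)) : WD t (CC t base) f := by
  have hv : ∀ i (r : Fin (n - 1)), f i ≠ 0 →
      hh kap (i (pR r)) (i (pL r) :: pw i r.1) = 1 ∧ hh kap (i (pL r)) (pw i r.1) = 1 ∧
        val kap (pw i r.1) := by
    intro i r h
    have h1 := val_pw kap i n (r.1 + 2) (by have := r.2; omega) (hnz i h)
    rw [pw_two] at h1
    exact ⟨h1.1, h1.2.1, h1.2.2⟩
  have hadj : ∀ i (r : Fin (n - 1)), f i ≠ 0 → Adj (i (pL r)) (i (pR r)) →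
      f (swapSeq i r) = 0 := by
    intro i r h ha
    by_contra hc
    obtain ⟨h1, h2, h3⟩ := hv i r h
    obtain ⟨g1, g2, g3⟩ := hv _ r hc
    rw [pw_pL, swapSeq_sg, sg_L] at g2
    have := val_adj n S.hne kap S.hk S.hkG (pw i r.1) h3
      (by rw [pw_length]; have := r.2; omega) (i (pR r)) (i (pL r))
      (by rcases ha with ha | ha
          · left; exact ha
          · right; rw [ha]; ring) h2
    omega
  have hC : ∀ i (r : Fin (n - 1)), CC t base i (pR r) =
      qintU t (cont base (i (pR r)) (i (pL r) :: pw i r.1)) := by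
    intro i r
    unfold CC
    have : pw i (pR r).1 = i (pL r) :: pw i r.1 := by
      show pw i (r.1 + 1) = _
      rw [pw, xi_pL]
    rw [this]
  have hC' : ∀ i (r : Fin (n - 1)), CC t base i (pL r) =
      qintU t (cont base (i (pL r)) (pw i r.1)) := fun i r => rfl
  refine ⟨hs, hi, ho, ?_, ?_, ?_, ?_, ?_, ?_⟩
  · intro i j k m h
    apply isUnit_qsub t e S.hU
    rw [cont_cast base S.hb, cont_cast base S.hb]
    exact h
  · intro i j k m h
    unfold CC
    rw [← qintU_succ]
    apply isUnit_qsub t e S.hU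
    push_cast
    rw [cont_cast base S.hb, cont_cast base S.hb]
    exact h
  · intro i r h heq
    obtain ⟨h1, h2, h3⟩ := hv i r h
    rw [← heq] at h1
    simp only [hh, if_true] at h1
    omega
  · intro i r s hrs h heq
    obtain ⟨h1, h2, h3⟩ := hv i r h
    obtain ⟨g1, g2, g3⟩ := hv i s h
    obtain ⟨k0, -⟩ := sg_braid r s hrs
    have : pw i s.1 = i (pL r) :: pw i r.1 := by rw [hrs, pw, xi_pL]
    rw [k0, ← heq, this] at g1
    simp only [hh, if_true] at g1
    split_ifs at g1 <;> omega
  · intro i r h ha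
    refine ⟨hadj i r h (Or.inl ha), ?_⟩
    rw [hC, hC', ← qintU_succ]
    simp only [cont]
    rw [if_pos ha]
  · intro i r h ha
    refine ⟨hadj i r h (Or.inr ha), ?_⟩
    rw [hC, hC', ← qintU_succ]
    simp only [cont]
    have h2 := S.two_ne (by have := r.2; omega) (i (pL r))
    have h3 : i (pR r) = i (pL r) - 1 := by rw [ha]; ring
    rw [if_neg (by rw [h3]; exact h2.symm), if_pos h3, sub_add_cancel]

theorem uniq_f {C : (Fin n → ZMod e) → Fin n → O} {f : (Fin n → ZMod e) → A} (W : WD t C f)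
    (g : (Fin n → ZMod e) → A) (hs : ∑ i, g i = 1)
    (hg : ∀ i k, DD f (fun i => C i k) * g i = C i k • g i) (i) : g i = f i := by
  have key : ∀ i j, j ≠ i → f j * g i = 0 := by
    intro i j hj
    obtain ⟨k, hk⟩ := Function.ne_iff.1 hj
    apply unit_smul_zero (W.unit j i k k hk)
    have h1 : C j k • (f j * g i) = C i k • (f j * g i) := by
      calc C j k • (f j * g i) = f j * DD f (fun i => C i k) * g i := by
            rw [f_DD W, smul_mul_assoc]
        _ = C i k • (f j * g i) := by rw [mul_assoc, hg, mul_smul_comm]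
    rw [sub_smul, h1, sub_self]
  calc g i = (∑ j, f j) * g i := by rw [W.sum, one_mul]
    _ = ∑ j, f j * g i := Finset.sum_mul _ _ _
    _ = f i * g i := Finset.sum_eq_single i (fun j _ hj => key i j hj) (by simp)
    _ = ∑ j, f i * g j := (Finset.sum_eq_single i (fun j _ hj => key j i hj.symm) (by simp)).symm
    _ = f i := by rw [← Finset.mul_sum, hs, mul_one]

theorem pw_snoc {m : ℕ} (j : Fin m → ZMod e) (x : ZMod e) :
    pw (Fin.snoc (α := fun _ => ZMod e) j x : Fin (m + 1) → ZMod e) (m + 1) = x :: pw j m := by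
  have h : ∀ k, k ≤ m → pw (Fin.snoc (α := fun _ => ZMod e) j x : Fin (m + 1) → ZMod e) k =
      pw j k := by
    intro k hk
    induction k with
    | zero => rfl
    | succ k ih =>
      rw [pw, pw, ih (by omega)]
      congr 1
      unfold xi
      rw [dif_pos (by omega), dif_pos (by omega)]
      simp [Fin.snoc, show k < m by omega]
  rw [pw, h m le_rfl]
  congr 1
  unfold xi
  rw [dif_pos (by omega)]
  simp [Fin.snoc]

theorem FW_total [IsDomain O] (S : Setup t e n kap base) (L : ℕ → A) (m : ℕ) :
    ∑ i : Fin m → ZMod e, FW t base L (pw i m) = 1 := by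
  induction m with
  | zero => simp [pw, FW]
  | succ m ih =>
    rw [← ih, ← Fintype.sum_equiv (Fin.snocEquiv (fun _ : Fin (m + 1) => ZMod e))
      (fun p => FW t base L (p.1 :: pw p.2 m)) _ (by
        intro p
        rw [← pw_snoc]
        rfl)]
    rw [Fintype.sum_prod_type_right]
    exact Finset.sum_congr rfl (fun j _ => FW_sum t S L (pw j m))

theorem H_side [IsDomain O] (S : Setup t e n kap base) (L : Fin n → A) (T : Fin (n - 1) → A)
    (hLL : ∀ j k, L j * L k = L k * L j) (H : HRel t L T)
    (hcyc : ∀ h : 0 < n, aeval (L ⟨0, h⟩) (∏ z ∈ Finset.univ.filter (fun z => kap z = 1),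
      (X - Polynomial.C (qintU t (base z)))) = 0) :
    ∃ f : (Fin n → ZMod e) → A, WD t (CC t base) f ∧
      (∀ k, L k = DD f (fun i => CC t base i k)) ∧ ∀ i, f i ≠ 0 → val kap (pw i n) := by
  obtain ⟨LN, hLN⟩ : ∃ LN : ℕ → A, LN = fun k => if h : k < n then L ⟨k, h⟩ else 0 := ⟨_, rfl⟩
  obtain ⟨TN, hTN⟩ : ∃ TN : ℕ → A, TN = fun k => if h : k < n - 1 then T ⟨k, h⟩ else 0 := ⟨_, rfl⟩
  have eL : ∀ k (h : k < n), LN k = L ⟨k, h⟩ := by intro k h; rw [hLN]; simp [h]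
  have eT : ∀ k (h : k < n - 1), TN k = T ⟨k, h⟩ := by intro k h; rw [hTN]; simp [h]
  have hL2 : ∀ j k, LN j * LN k = LN k * LN j := by
    intro j k
    by_cases hj : j < n
    · by_cases hk : k < n
      · rw [eL j hj, eL k hk, hLL]
      · rw [show LN k = 0 by rw [hLN]; simp [hk]]; simp
    · rw [show LN j = 0 by rw [hLN]; simp [hj]]; simp
  have HN : HeckeN t n LN TN := by
    refine ⟨hL2, ?_, ?_, ?_, ?_⟩
    · intro r hr
      rw [eT r (by omega)]; exact H.quad _
    · intro r hr
      rw [eT r (by omega), eT (r + 1) (by omega)]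
      exact H.braid _ _ rfl
    · intro r k hr h1 h2
      by_cases hk : k < n
      · rw [eT r (by omega), eL k hk]
        exact H.TL _ _ ⟨h1, h2⟩
      · rw [show LN k = 0 by rw [hLN]; simp [hk]]; simp
    · intro r hr
      rw [eT r (by omega), eL r (by omega), eL (r + 1) hr]
      exact H.LT ⟨r, by omega⟩
  obtain ⟨hP, hV⟩ := HS_all t S LN TN HN (by intro h; rw [eL 0 h]; exact hcyc h) n le_rfl
  have heig : ∀ (i : Fin n → ZMod e) (k : Fin n),
      L k * FW t base LN (pw i n) = CC t base i k • FW t base LN (pw i n) := by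
    intro i k
    have hsplit : ∀ m, k.1 + 1 ≤ m → ∃ v, pw i m = v ++ pw i (k.1 + 1) := by
      intro m hm
      induction m with
      | zero => omega
      | succ m ih =>
        rcases Nat.lt_or_ge m (k.1 + 1) with h1 | h1
        · exact ⟨[], by rw [show m + 1 = k.1 + 1 by omega]; rfl⟩
        · obtain ⟨v, hv⟩ := ih h1
          exact ⟨xi i m :: v, by rw [pw, hv]; rfl⟩
    obtain ⟨v, hv⟩ := hsplit n k.2
    obtain ⟨a, ha⟩ := FW_append t LN (base := base) v (pw i (k.1 + 1))
    have h1 := FW_eig t LN hL2 (pw i k.1) (hP _ (by rw [pw_length]; exact k.2)) (i k)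
    rw [pw_length, eL k.1 k.2] at h1
    rw [hv, ha, ← mul_assoc, pw, xi_fin, h1, smul_mul_assoc]
    rfl
  have hcomm : ∀ (i : Fin n → ZMod e) (k : Fin n),
      L k * FW t base LN (pw i n) = FW t base LN (pw i n) * L k := by
    intro i k
    have := FW_comm t LN (base := base) (LN k.1) (pw i n) (fun _ _ => hL2 _ _)
    rw [eL k.1 k.2] at this
    exact this.symm
  have hsum := FW_total S LN (base := base) n
  refine ⟨fun i => FW t base LN (pw i n), WD_of S _ hsum ?_ ?_ ?_, ?_, fun i hi => hV _ (by rw [pw_length]) hi⟩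
  · intro i
    exact EV_fix t S LN n hP _ (by rw [pw_length]) _
      (FW_EV t LN hL2 S.hb n hP _ (by rw [pw_length]))
  · intro i j hij
    obtain ⟨k, hk⟩ := Function.ne_iff.1 hij
    have hu : IsUnit (CC t base i k - CC t base j k) := by
      apply isUnit_qsub t e S.hU
      rw [cont_cast base S.hb, cont_cast base S.hb]
      exact hk
    apply unit_smul_zero hu
    have h1 : CC t base i k • (FW t base LN (pw i n) * FW t base LN (pw j n)) =
        CC t base j k • (FW t base LN (pw i n) * FW t base LN (pw j n)) := by
      rw [← smul_mul_assoc, ← heig, hcomm, mul_assoc, heig, mul_smul_comm]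
    rw [sub_smul, h1, sub_self]
  · intro i hi
    exact hV _ (by rw [pw_length]) hi
  · intro k
    unfold DD
    rw [← mul_one (L k), ← hsum, Finset.mul_sum]
    exact Finset.sum_congr rfl (fun i _ => heig i k)

end HSide2
end Paper

open scoped BigOperators
open scoped Classical
namespace Paper

section RSide
variable {O : Type*} [CommRing O] {A : Type*} [Ring A] [Algebra O A] {t : Oˣ}
variable {e : ℕ} [NeZero e] {n : ℕ} {kap base : ZMod e → ℤ}

/-- the shifted elements `y^⟨d⟩` -/
def yd (t : Oˣ) (d : ℤ) (z : A) : A :=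
  algebraMap O A ((t ^ d : Oˣ) : O) * z + algebraMap O A (qintU t d)

/-- The deformed quiver Hecke relations (without the cyclotomic one, and without the relations
specific to `e = 2`). -/
structure KRel (t : Oˣ) (f : (Fin n → ZMod e) → A) (ps : Fin (n - 1) → A) (y : Fin n → A) :
    Prop where
  sum : ∑ i, f i = 1
  idem : ∀ i, f i * f i = f i
  orth : ∀ i j, i ≠ j → f i * f j = 0
  yf : ∀ k i, y k * f i = f i * y k
  psf : ∀ r i, ps r * f i = f (swapSeq i r) * ps r
  yy : ∀ k m, y k * y m = y m * y k
  psiyEq : ∀ r i, i (pL r) = i (pR r) → ps r * y (pR r) * f i = (y (pL r) * ps r + 1) * f i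
  psiyNe : ∀ r i, i (pL r) ≠ i (pR r) → ps r * y (pR r) * f i = y (pL r) * ps r * f i
  ypsiEq : ∀ r i, i (pL r) = i (pR r) → y (pR r) * ps r * f i = (ps r * y (pL r) + 1) * f i
  ypsiNe : ∀ r i, i (pL r) ≠ i (pR r) → y (pR r) * ps r * f i = ps r * y (pL r) * f i
  psiyFar : ∀ (r : Fin (n - 1)) (k : Fin n), (k.1 ≠ r.1 ∧ k.1 ≠ r.1 + 1) →
    ps r * y k = y k * ps r
  far : ∀ r s : Fin (n - 1), (r.1 + 1 < s.1 ∨ s.1 + 1 < r.1) → ps r * ps s = ps s * ps r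
  quadEq : ∀ r i, i (pL r) = i (pR r) → ps r * ps r * f i = 0
  quadR : ∀ r i, i (pR r) = i (pL r) + 1 → i (pL r) ≠ i (pR r) + 1 →
    ps r * ps r * f i = (yd t (1 + rhoI i r) (y (pL r)) - y (pR r)) * f i
  quadL : ∀ r i, i (pL r) = i (pR r) + 1 → i (pR r) ≠ i (pL r) + 1 →
    ps r * ps r * f i = (yd t (1 - rhoI i r) (y (pR r)) - y (pL r)) * f i
  quadNone : ∀ r i, i (pL r) ≠ i (pR r) → i (pR r) ≠ i (pL r) + 1 → i (pL r) ≠ i (pR r) + 1 →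
    ps r * ps r * f i = f i
  braidR : ∀ (r s : Fin (n - 1)) i, s.1 = r.1 + 1 → i (pR s) = i (pL r) →
    i (pR r) = i (pL r) + 1 → i (pL r) ≠ i (pR r) + 1 →
    (ps r * ps s * ps r - ps s * ps r * ps s) * f i =
      algebraMap O A (-((t ^ (1 + rhoI i r) : Oˣ) : O)) * f i
  braidL : ∀ (r s : Fin (n - 1)) i, s.1 = r.1 + 1 → i (pR s) = i (pL r) →
    i (pL r) = i (pR r) + 1 → i (pR r) ≠ i (pL r) + 1 →
    (ps r * ps s * ps r - ps s * ps r * ps s) * f i = f i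
  braidNone : ∀ (r s : Fin (n - 1)) i, s.1 = r.1 + 1 →
    ¬(i (pR s) = i (pL r) ∧ (i (pR r) = i (pL r) + 1 ∨ i (pL r) = i (pR r) + 1)) →
    (ps r * ps s * ps r - ps s * ps r * ps s) * f i = 0

/-- the eigenvalues of the `y`'s -/
def YY (t : Oˣ) (base : ZMod e → ℤ) (i : Fin n → ZMod e) (k : Fin n) : O :=
  qintU t (cont base (i k) (pw i k.1) - ((i k).val : ℤ))

theorem CC_YY (i : Fin n → ZMod e) (k : Fin n) : CC t base i k =
    qintU t ((i k).val : ℤ) + ((t ^ ((i k).val : ℤ) : Oˣ) : O) * YY t base i k := by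
  unfold CC YY
  rw [← qintU_add]
  congr 1
  ring

theorem YY_CC (i : Fin n → ZMod e) (k : Fin n) : YY t base i k =
    qintU t (-((i k).val : ℤ)) + ((t ^ (-((i k).val : ℤ)) : Oˣ) : O) * CC t base i k := by
  unfold CC YY
  rw [← qintU_add]
  congr 1
  ring

theorem yd_smul (d : ℤ) (z g : A) (a : O) (h : z * g = a • g) :
    yd t d z * g = (qintU t d + ((t ^ d : Oˣ) : O) * a) • g := by
  unfold yd
  rw [add_mul, mul_assoc, h, ← Algebra.smul_def, ← Algebra.smul_def, smul_smul, add_smul, add_comm]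

variable {f : (Fin n → ZMod e) → A} {ps : Fin (n - 1) → A} {y : Fin n → A}

theorem Setup.adj_ne (S : Setup t e n kap base) (r : Fin (n - 1)) {x z : ZMod e} (h : x = z + 1) :
    z ≠ x + 1 := by
  intro h2
  have := S.two_ne (by have := r.2; omega) z
  apply this
  rw [← h]
  linear_combination -h2

theorem KRel.eq0 (H : KRel t f ps y) (r i) (h : i (pL r) = i (pR r)) (a : O)
    (ha : y (pL r) * f i = a • f i) : f i = 0 := by
  have hs : swapSeq i r = i := by
    funext k
    rw [swapSeq_sg]
    by_cases h1 : k = pL r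
    · rw [h1, sg_L, h]
    by_cases h2 : k = pR r
    · rw [h2, sg_R, h]
    simp [sg, h1, h2]
  have hc := H.psf r i
  rw [hs] at hc
  have h1 := H.psiyEq r i h
  have hq := H.quadEq r i h
  have h2 : ps r * y (pR r) * f i = a • (ps r * f i) + f i := by
    rw [h1, add_mul, one_mul, mul_assoc, hc, ← mul_assoc, ha, smul_mul_assoc]
  have h3 : ps r * (ps r * y (pR r) * f i) = 0 := by
    rw [mul_assoc, H.yf, ← mul_assoc, ← mul_assoc, hq, zero_mul]
  rw [h2, mul_add, mul_smul_comm, ← mul_assoc, hq, smul_zero, zero_add] at h3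
  rw [h3, smul_zero, zero_add, mul_assoc, H.yf, ← mul_assoc, h3, zero_mul] at h2
  exact h2.symm

theorem adj0 (S : Setup t e n kap base) (r : Fin (n - 1))
    (hv : ∀ i, f i ≠ 0 → val kap (pw i (r.1 + 1))) (i) (ha : Adj (i (pL r)) (i (pR r)))
    (h : f i ≠ 0) : f (swapSeq i r) = 0 := by
  by_contra hc
  have h1 := hv i h
  have g1 := hv _ hc
  rw [pw, xi_pL] at h1 g1
  have g2 := g1.1
  rw [pw_pL, swapSeq_sg, sg_L] at g2
  have := val_adj n S.hne kap S.hk S.hkG (pw i r.1) h1.2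
      (by rw [pw_length]; have := r.2; omega) (i (pR r)) (i (pL r))
      (by rcases ha with ha | ha
          · left; exact ha
          · right; rw [ha]; ring) h1.1
  omega

theorem KRel.swap_ne (H : KRel t f ps y) (r i) (h1 : i (pL r) ≠ i (pR r))
    (h2 : ¬ Adj (i (pL r)) (i (pR r))) (h : f i ≠ 0) : f (swapSeq i r) ≠ 0 := by
  intro h0
  apply h
  rw [← H.quadNone r i h1 (fun h => h2 (Or.inl h)) (fun h => h2 (Or.inr h)), mul_assoc, H.psf, h0,
    zero_mul, mul_zero]

theorem RS_y (S : Setup t e n kap base) (H : KRel t f ps y) (r : Fin (n - 1))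
    (hv : ∀ i, f i ≠ 0 → val kap (pw i (r.1 + 1)))
    (hy : ∀ i, y (pL r) * f i = YY t base i (pL r) • f i) (i) :
    y (pR r) * f i = YY t base i (pR r) • f i := by
  by_cases hf : f i = 0
  · rw [hf, mul_zero, smul_zero]
  have hw : pw i (pR r).1 = i (pL r) :: pw i r.1 := by
    show pw i (r.1 + 1) = _
    rw [pw, xi_pL]
  by_cases heq : i (pL r) = i (pR r)
  · exact absurd (H.eq0 r i heq _ (hy i)) hf
  by_cases ha : Adj (i (pL r)) (i (pR r))
  · have h0 := adj0 S r hv i ha hf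
    have hp : ps r * ps r * f i = 0 := by
      rw [mul_assoc, H.psf, h0, zero_mul, mul_zero]
    rcases ha with ha | ha
    · have hq := H.quadR r i ha (S.adj_ne r ha)
      rw [hp, sub_mul, yd_smul _ _ _ _ (hy i)] at hq
      rw [(sub_eq_zero.1 hq.symm).symm]
      congr 1
      unfold YY
      rw [← qintU_add, hw]
      simp only [cont]
      rw [if_pos ha]
      congr 1
      unfold rhoI
      show _ + (cont base (i (pL r)) (pw i r.1) - _) = _
      ring
    · have hq := H.quadL r i ha (S.adj_ne r ha)
      have h3 : i (pR r) = i (pL r) - 1 := by rw [ha]; ring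
      have hYY : YY t base i (pL r) = qintU t (1 - rhoI i r) +
          ((t ^ (1 - rhoI i r) : Oˣ) : O) * YY t base i (pR r) := by
        unfold YY
        rw [← qintU_add, hw]
        simp only [cont]
        rw [if_neg (by rw [h3]; exact (S.two_ne (by have := r.2; omega) (i (pL r))).symm), if_pos h3]
        congr 1
        unfold rhoI
        show cont base (i (pL r)) (pw i r.1) - _ = _
        ring
      rw [hp, sub_mul, hy i, hYY] at hq
      unfold yd at hq
      rw [add_mul, mul_assoc, ← Algebra.smul_def, ← Algebra.smul_def, add_smul] at hq
      have : ((t ^ (1 - rhoI i r) : Oˣ) : O) • (y (pR r) * f i - YY t base i (pR r) • f i) = 0 := by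
        rw [smul_sub, smul_smul, hq]
        abel
      exact sub_eq_zero.1 (unit_smul_zero (Units.isUnit _) _ this)
  · have hq := H.quadNone r i heq (fun h => ha (Or.inl h)) (fun h => ha (Or.inr h))
    have h1 : swapSeq i r (pL r) = i (pR r) := by rw [swapSeq_sg, sg_L]
    have h2 : swapSeq i r (pR r) = i (pL r) := by rw [swapSeq_sg, sg_R]
    have hn := H.ypsiNe r (swapSeq i r) (by rw [h1, h2]; exact Ne.symm heq)
    have hYY : YY t base (swapSeq i r) (pL r) = YY t base i (pR r) := by
      unfold YY
      rw [hw, h1]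
      simp only [cont]
      rw [if_neg (fun h => ha (Or.inl h)),
        if_neg (fun h => ha (Or.inr (by rw [h]; ring)))]
      show qintU t (cont base _ (pw (swapSeq i r) r.1) - _) = _
      rw [pw_pL]
    have key : y (pR r) * (ps r * ps r * f i) = YY t base i (pR r) • (ps r * ps r * f i) := by
      calc y (pR r) * (ps r * ps r * f i) = (y (pR r) * ps r * f (swapSeq i r)) * ps r := by
            simp only [mul_assoc]; rw [H.psf]
        _ = ps r * (y (pL r) * f (swapSeq i r)) * ps r := by rw [hn]; simp only [mul_assoc]
        _ = YY t base i (pR r) • (ps r * (f (swapSeq i r) * ps r)) := by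
            rw [hy, hYY, mul_smul_comm, smul_mul_assoc, mul_assoc]
        _ = _ := by rw [← H.psf, mul_assoc]
    rw [hq] at key
    exact key

theorem RS_all (S : Setup t e n kap base) (H : KRel t f ps y)
    (hc1 : ∀ (h : 0 < n) i, f i ≠ 0 → kap (i ⟨0, h⟩) = 1)
    (hc2 : ∀ (h : 0 < n) i, f i ≠ 0 → 
      y ⟨0, h⟩ * f i = qintU t (base (i ⟨0, h⟩) - ((i ⟨0, h⟩).val : ℤ)) • f i) (m : ℕ) (hm : m ≤ n) :
    (∀ i (k : Fin n), k.1 < m → y k * f i = YY t base i k • f i) ∧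
    (∀ i, f i ≠ 0 → val kap (pw i m)) := by
  induction m with
  | zero => exact ⟨fun i k h => absurd h (by omega), fun i _ => trivial⟩
  | succ m ih =>
    obtain ⟨ihy, ihv⟩ := ih (by omega)
    rcases Nat.eq_zero_or_pos m with h0 | h0
    · subst h0
      refine ⟨fun i k hk => ?_, fun i hi => ⟨?_, trivial⟩⟩
      · by_cases hf : f i = 0
        · rw [hf, mul_zero, smul_zero]
        obtain ⟨k, hk'⟩ := k
        simp only at hk
        obtain rfl : k = 0 := by omega
        exact hc2 hk' i hf
      · have h := hc1 (by omega) i hi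
        show kap (xi i 0) = 1
        rw [← h]
        congr 1
        exact xi_fin i ⟨0, by omega⟩
    · have hr : m - 1 < n - 1 := by omega
      obtain ⟨r, hrm⟩ : ∃ r : Fin (n - 1), r.1 + 1 = m := ⟨⟨m - 1, hr⟩, by simp; omega⟩
      refine ⟨?_, ?_⟩
      · intro i k hk
        rcases Nat.lt_or_ge k.1 m with h1 | h1
        · exact ihy i k h1
        · obtain rfl : k = pR r := by
            apply Fin.ext
            simp only [pR]
            omega
          apply RS_y S H r (by rw [hrm]; exact ihv)
          intro j
          exact ihy j (pL r) (by simp [pL]; omega)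
      · intro i hi
        refine val_step n S.hne kap S.hk0 S.hk S.hkG
          (fun w => ∃ i, f i ≠ 0 ∧ w.length ≤ n ∧ pw i w.length = w) m h0 hm ?_ ?_ ?_ ?_ ?_ (pw i (m + 1))
          (pw_length _ _) ⟨i, hi, by rw [pw_length]; exact hm, by rw [pw_length]⟩
        · rintro x u ⟨j, hj, hl, hp⟩
          simp only [List.length_cons] at hl hp
          rw [pw] at hp
          exact ⟨j, hj, by omega, (List.cons.inj hp).2⟩
        · rintro u hu ⟨j, hj, hl, hp⟩
          rw [← hp, hu]
          exact ihv j hj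
        · rintro x u hu ⟨j, hj, hl, hp⟩
          simp only [List.length_cons] at hl hp hu
          have hur : u.length = r.1 := by omega
          rw [hur, pw_two] at hp
          obtain ⟨h1, h2⟩ := List.cons.inj hp
          obtain ⟨h2, h3⟩ := List.cons.inj h2
          exact hj (H.eq0 r j (by rw [h1, h2]) _ (ihy j _ (by simp [pL]; omega)))
        · rintro v x z u hu hxy hxy1 hxy2 ⟨j, hj, hl, hp⟩
          have hl' := hl
          rw [List.length_append, List.length_cons, List.length_cons] at hl hu hp
          obtain ⟨s, hs⟩ : ∃ s : Fin (n - 1), s.1 = u.length := ⟨⟨u.length, by omega⟩, rfl⟩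
          obtain ⟨v', hv1, hv2⟩ := pw_split j s v.length (by omega)
          rw [show v.length + (u.length + 1 + 1) = s.1 + 2 + v.length by omega, hv1] at hp
          obtain ⟨h1, h2⟩ := List.append_inj' hp (by simp [pw_length, hs])
          obtain ⟨h3, h4⟩ := List.cons.inj h2
          obtain ⟨h4, h5⟩ := List.cons.inj h4
          refine ⟨swapSeq j s, H.swap_ne s j (by rw [h3, h4]; exact Ne.symm hxy) ?_ hj, by simpa using hl', ?_⟩
          · rw [h3, h4]
            rintro (h | h)
            · exact hxy1 h
            · apply hxy2; rw [h]; ring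
          · rw [List.length_append, List.length_cons, List.length_cons,
              show v.length + (u.length + 1 + 1) = s.1 + 2 + v.length by omega, hv2, h1, h3, h4, h5]
        · rintro x z u hu hadj ⟨j, hj, hl, hp⟩
          simp only [List.length_cons] at hl hp hu
          obtain ⟨q, hq⟩ : ∃ q : Fin (n - 1), q.1 = u.length := ⟨⟨u.length, by omega⟩, rfl⟩
          have hrq : r.1 = q.1 + 1 := by omega
          obtain ⟨k0, k1, k2, k3, k4⟩ := sg_braid q r hrq
          rw [show u.length + 1 + 1 + 1 = r.1 + 2 by omega, pw_two, k0, hrq, pw, xi_pL] at hp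
          obtain ⟨h1, h2⟩ := List.cons.inj hp
          obtain ⟨h2, h3⟩ := List.cons.inj h2
          obtain ⟨h3, h4⟩ := List.cons.inj h3
          have hA : Adj (j (pL q)) (j (pR q)) := by
            rw [h2, h3]
            rcases hadj with h | h
            · right; exact h
            · left; rw [h]; ring
          have e1 : f (swapSeq j q) = 0 := by
            apply adj0 S q _ j hA hj
            intro j' hj'
            exact val_pw kap j' m _ (by omega) (ihv j' hj')
          have e2 : f (swapSeq j r) = 0 := by
            apply H.eq0 q (swapSeq j r) _ _ (ihy _ _ (by simp [pL]; omega))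
            rw [swapSeq_sg, swapSeq_sg, k2, k3, h3, h1]
          have e3 : (ps q * ps r * ps q - ps r * ps q * ps r) * f j = 0 := by
            rw [sub_mul, mul_assoc, H.psf, e1, zero_mul, mul_zero, mul_assoc, H.psf, e2, zero_mul,
              mul_zero, sub_zero]
          have h0 : j (pR r) = j (pL q) := by rw [h1, h3]
          apply hj
          rcases hA with hA | hA
          · have := H.braidR q r j hrq h0 hA (S.adj_ne q hA)
            rw [e3, ← Algebra.smul_def] at this
            exact unit_smul_zero (Units.isUnit _).neg _ this.symm
          · have := H.braidL q r j hrq h0 hA (S.adj_ne q hA)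
            rw [e3] at this
            exact this.symm

theorem R_side (S : Setup t e n kap base) (H : KRel t f ps y)
    (hc1 : ∀ (h : 0 < n) i, f i ≠ 0 → kap (i ⟨0, h⟩) = 1)
    (hc2 : ∀ (h : 0 < n) i, f i ≠ 0 → 
      y ⟨0, h⟩ * f i = qintU t (base (i ⟨0, h⟩) - ((i ⟨0, h⟩).val : ℤ)) • f i) :
    WD t (CC t base) f ∧ PRel (CC t base) f ps ∧ ∀ k, y k = DD f (fun i => YY t base i k) := by
  obtain ⟨hy, hv⟩ := RS_all S H hc1 hc2 n le_rfl
  have W := WD_of S f H.sum H.idem H.orth hv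
  refine ⟨W, ⟨⟨H.psf, ?_⟩, H.far, ?_, ?_⟩, ?_⟩
  · intro r k i
    by_cases hf : f i = 0
    · rw [hf, mul_zero, smul_zero, smul_zero]
    have hne := W.ne1 i r hf
    have h1 : ps r * y k * f i = y (sg r k) * ps r * f i := by
      by_cases h1 : k = pL r
      · rw [h1, sg_L, H.ypsiNe r i hne]
      by_cases h2 : k = pR r
      · rw [h2, sg_R, H.psiyNe r i hne]
      have h3 : k.1 ≠ r.1 ∧ k.1 ≠ r.1 + 1 :=
        ⟨fun h => h1 (Fin.ext h), fun h => h2 (Fin.ext h)⟩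
      rw [sg_of_ne r k h3, H.psiyFar r k h3]
    have h2 : YY t base i k • (ps r * f i) = YY t base (swapSeq i r) (sg r k) • (ps r * f i) := by
      calc YY t base i k • (ps r * f i) = ps r * y k * f i := by
            rw [mul_assoc, hy i k k.2, mul_smul_comm]
        _ = y (sg r k) * f (swapSeq i r) * ps r := by rw [h1, mul_assoc, H.psf, mul_assoc]
        _ = _ := by rw [hy _ _ (sg r k).2, smul_mul_assoc, H.psf]
    have h3 : swapSeq i r (sg r k) = i k := by rw [swapSeq_sg, sg_sg]
    simp only
    rw [CC_YY, CC_YY, h3, add_smul, add_smul, mul_smul, mul_smul, h2]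
  · intro r s hrs
    apply ext_f W
    intro i
    by_cases hf : f i = 0
    · rw [hf, mul_zero, mul_zero]
    have := H.braidNone r s i hrs (fun h => W.ne2 i r s hrs hf h.1.symm)
    rw [sub_mul] at this
    exact sub_eq_zero.1 this
  · intro r i h1 h2
    exact H.quadNone r i h2 (fun h => h1 (Or.inl h)) (fun h => h1 (Or.inr h))
  · intro k
    apply ext_f W
    intro i
    rw [DD_f W, hy i k k.2]

end RSide
end Paper

open scoped BigOperators
open scoped Classical
namespace Paper

section CSide
variable {O : Type*} [CommRing O] {A : Type*} [Ring A] [Algebra O A] {t : Oˣ}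
variable {e : ℕ} [NeZero e] {n : ℕ} {kap base : ZMod e → ℤ}
variable {f : (Fin n → ZMod e) → A} {ps : Fin (n - 1) → A}

theorem q_add (a b : ℤ) (c : O) : qintU t a + ((t ^ a : Oˣ) : O) * (qintU t b +
    ((t ^ b : Oˣ) : O) * c) = qintU t (a + b) + ((t ^ (a + b) : Oˣ) : O) * c := by
  rw [qintU_add, zpow_add, Units.val_mul]
  ring

theorem YY_shift (i : Fin n → ZMod e) (k m : Fin n) (d : ℤ)
    (hd : d = 1 + ((i k).val : ℤ) - ((i m).val : ℤ))
    (h : CC t base i m = t * CC t base i k + 1) :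
    qintU t d + ((t ^ d : Oˣ) : O) * YY t base i k = YY t base i m := by
  have h1 : CC t base i m = qintU t 1 + ((t ^ (1 : ℤ) : Oˣ) : O) * CC t base i k := by
    rw [h, qintU_one, zpow_one, add_comm]
  rw [YY_CC, YY_CC, h1, q_add, q_add, hd]
  rw [show 1 + ((i k).val : ℤ) - ((i m).val : ℤ) + -((i k).val : ℤ) = -((i m).val : ℤ) + 1 by ring]

theorem Rl_YY {X : A} {r : Fin (n - 1)} (h : TW (CC t base) f X r) (k : Fin n) :
    Rl f X r (fun i => YY t base i k) (fun i => YY t base i (sg r k)) := by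
  intro i
  have h3 : swapSeq i r (sg r k) = i k := by rw [swapSeq_sg, sg_sg]
  have h2 := h k i
  simp only at h2 ⊢
  rw [YY_CC, YY_CC, h3, add_smul, add_smul, mul_smul, mul_smul, h2]

theorem C_side (S : Setup t e n kap base) (W : WD t (CC t base) f) (H : PRel (CC t base) f ps) :
    KRel t f ps (fun k => DD f (fun i => YY t base i k)) := by
  have hc : ∀ r k, ps r * DD f (fun i => YY t base i k) =
      DD f (fun i => YY t base i (sg r k)) * ps r := fun r k =>
    X_DD W (H.tw.xf r) (Rl_YY (H.tw.tw r) k)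
  have hcR : ∀ r, ps r * DD f (fun i => YY t base i (pR r)) =
      DD f (fun i => YY t base i (pL r)) * ps r := by
    intro r; have := hc r (pR r); rwa [sg_R] at this
  have hcL : ∀ r, ps r * DD f (fun i => YY t base i (pL r)) =
      DD f (fun i => YY t base i (pR r)) * ps r := by
    intro r; have := hc r (pL r); rwa [sg_L] at this
  have h0 : ∀ r i, i (pL r) = i (pR r) → f i = 0 := by
    intro r i h
    by_contra hf
    exact W.ne1 i r hf h
  have h02 : ∀ r s i, s.1 = r.1 + 1 → i (pR s) = i (pL r) → f i = 0 := by
    intro r s i hrs h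
    by_contra hf
    exact W.ne2 i r s hrs hf h.symm
  refine ⟨W.sum, W.idem, W.orth, fun k i => f_comm_DD W _ _, H.tw.xf, fun k m => DD_comm W _ _,
    ?_, ?_, ?_, ?_, ?_, H.far, ?_, ?_, ?_, ?_, ?_, ?_, ?_⟩
  · intro r i h; rw [h0 r i h, mul_zero, mul_zero]
  · intro r i h; rw [hcR]
  · intro r i h; rw [h0 r i h, mul_zero, mul_zero]
  · intro r i h; rw [hcL]
  · intro r k h; have := hc r k; rwa [sg_of_ne r k h] at this
  · intro r i h; rw [h0 r i h, mul_zero]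
  · intro r i h1 h2
    by_cases hf : f i = 0
    · rw [hf, mul_zero, mul_zero]
    obtain ⟨g1, g2⟩ := W.adjR i r hf h1
    rw [mul_assoc, H.tw.xf, g1, zero_mul, mul_zero, sub_mul, yd_smul _ _ _ _ (DD_f W _ i), DD_f W,
      YY_shift i (pL r) (pR r) _ (by unfold rhoI; ring) g2, sub_self]
  · intro r i h1 h2
    by_cases hf : f i = 0
    · rw [hf, mul_zero, mul_zero]
    obtain ⟨g1, g2⟩ := W.adjL i r hf h1
    rw [mul_assoc, H.tw.xf, g1, zero_mul, mul_zero, sub_mul, yd_smul _ _ _ _ (DD_f W _ i), DD_f W,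
      YY_shift i (pR r) (pL r) _ (by unfold rhoI; ring) g2, sub_self]
  · intro r i h1 h2 h3
    exact H.sq r i (by rintro (h | h); exacts [h2 h, h3 h]) h1
  · intro r s i hrs h1 _ _
    rw [h02 r s i hrs h1, mul_zero, mul_zero]
  · intro r s i hrs h1 _ _
    rw [h02 r s i hrs h1, mul_zero]
  · intro r s i hrs h
    rw [H.braid r s hrs, sub_self, zero_mul]

theorem list_prod_smul {ι : Type*} (l : List ι) (g : ι → A) (c : ι → O) (v : A)
    (h : ∀ x ∈ l, g x * v = c x • v) : (l.map g).prod * v = (l.map c).prod • v := by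
  induction l with
  | nil => simp
  | cons a l ih =>
    rw [List.map_cons, List.prod_cons, List.map_cons, List.prod_cons, mul_assoc,
      ih (fun x hx => h x (List.mem_cons_of_mem _ hx)), mul_smul_comm, h a List.mem_cons_self,
      smul_smul, mul_comm]

theorem list_prod_one {P : ℕ → Prop} [DecidablePred P] (g : ℕ → A) (L : ℕ) (h : ∀ l < L, ¬ P l) :
    ((List.range L).map (fun l => if P l then g l else 1)).prod = 1 := by
  apply List.prod_eq_one
  intro x hx
  obtain ⟨l, hl, rfl⟩ := List.mem_map.1 hx
  rw [if_neg (h l (List.mem_range.1 hl))]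

theorem list_prod_single {P : ℕ → Prop} [DecidablePred P] (g : ℕ → A) (L l0 : ℕ) (h0 : l0 < L) (hP : P l0)
    (h : ∀ l < L, P l → l = l0) :
    ((List.range L).map (fun l => if P l then g l else 1)).prod = g l0 := by
  induction L with
  | zero => omega
  | succ L ih =>
    rw [List.range_succ, List.map_append, List.prod_append, List.map_singleton, List.prod_singleton]
    by_cases hl : l0 = L
    · subst hl
      rw [list_prod_one, if_pos hP, one_mul]
      intro l hl hp
      have := h l (by omega) hp
      omega
    · rw [ih (by omega) (fun l hl hp => h l (by omega) hp), if_neg, mul_one]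
      intro hp
      exact hl (h L (by omega) hp).symm

open Polynomial in
theorem list_prod_aeval (Z : A) (c : ℕ → O) (L : ℕ) :
    aeval Z (∏ l ∈ Finset.range L, (X - Polynomial.C (c l))) =
      ((List.range L).map (fun l => Z - algebraMap O A (c l))).prod := by
  induction L with
  | zero => simp
  | succ L ih =>
    rw [Finset.prod_range_succ, map_mul, ih, List.range_succ, List.map_append, List.prod_append,
      List.map_singleton, List.prod_singleton]
    simp

/-- compatibility of the residues with the multicharge -/
structure KB (κ : ℕ → ℤ) (n ℓ e : ℕ) (kap base : ZMod e → ℤ) : Prop where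
  ex : ∀ x, kap x = 1 → ∃ l < ℓ, (κ l : ZMod e) = x
  one : ∀ l < ℓ, kap (κ l : ZMod e) = 1
  eq : 0 < n → ∀ l < ℓ, base (κ l : ZMod e) = κ l
  inj : 0 < n → ∀ l < ℓ, ∀ m < ℓ, (κ l : ZMod e) = κ m → l = m

variable {κ : ℕ → ℤ} {ℓ : ℕ}

theorem cyc_K (B : KB κ n ℓ e kap base) (W : WD t (CC t base) f)
    (hv : ∀ i, f i ≠ 0 → val kap (pw i n)) (h : 0 < n) (i : Fin n → ZMod e) :
    ((List.range ℓ).map fun l => if ((κ l : ZMod e) = i ⟨0, h⟩) then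
      DD f (fun i => YY t base i ⟨0, h⟩) - algebraMap O A (qintU t (κ l - ((i ⟨0, h⟩).val : ℤ)))
            else 1).prod * f i = 0 := by
  by_cases hf : f i = 0
  · rw [hf, mul_zero]
  have h1 := (val_pw kap i n 1 h (hv i hf)).1
  have h2 : kap (i ⟨0, h⟩) = 1 := by
    rw [← h1]
    show _ = kap (xi i 0)
    congr 1
    exact (xi_fin i ⟨0, h⟩).symm
  obtain ⟨l, hl, hx⟩ := B.ex _ h2
  rw [list_prod_single (P := fun l => (κ l : ZMod e) = i ⟨0, h⟩) _ ℓ l hl hx (fun m hm hP => B.inj h m hm l hl (by rw [hP, hx])), sub_mul,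
    DD_f W, ← Algebra.smul_def]
  rw [sub_eq_zero]
  congr 1
  unfold YY
  show qintU t (base (i ⟨0, h⟩) - _) = _
  congr 2
  rw [← hx, B.eq h l hl]

theorem cyc_H (B : KB κ n ℓ e kap base) (W : WD t (CC t base) f)
    (hv : ∀ (h : 0 < n) i, f i ≠ 0 → kap (i ⟨0, h⟩) = 1) (h : 0 < n) :
    ((List.range ℓ).map fun l =>
      DD f (fun i => CC t base i ⟨0, h⟩) - algebraMap O A (qintU t (κ l))).prod = 0 := by
  apply ext_f W
  intro i
  rw [zero_mul]
  by_cases hf : f i = 0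
  · rw [hf, mul_zero]
  obtain ⟨l, hl, hx⟩ := B.ex _ (hv h i hf)
  rw [list_prod_smul _ _ (fun l => CC t base i ⟨0, h⟩ - qintU t (κ l))]
  · rw [List.prod_eq_zero, zero_smul]
    refine List.mem_map.2 ⟨l, List.mem_range.2 hl, ?_⟩
    rw [sub_eq_zero]
    unfold CC
    show qintU t (base (i ⟨0, h⟩)) = _
    rw [← hx, B.eq h l hl]
  · intro l _
    rw [sub_mul, DD_f W, ← Algebra.smul_def, sub_smul]

open Polynomial in
theorem cyc_H' (B : KB κ n ℓ e kap base) (h : 0 < n) (Z : A)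
    (hZ : ((List.range ℓ).map fun l => Z - algebraMap O A (qintU t (κ l))).prod = 0) :
    aeval Z (∏ z ∈ Finset.univ.filter (fun z => kap z = 1),
      (X - Polynomial.C (qintU t (base z)))) = 0 := by
  rw [← hZ, ← list_prod_aeval]
  congr 1
  have : Finset.univ.filter (fun z => kap z = 1) =
      (Finset.range ℓ).image (fun l => (κ l : ZMod e)) := by
    ext x
    simp only [Finset.mem_filter, Finset.mem_univ, true_and, Finset.mem_image, Finset.mem_range]
    constructor
    · intro hx
      obtain ⟨l, hl, h1⟩ := B.ex x hx
      exact ⟨l, hl, h1⟩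
    · rintro ⟨l, hl, rfl⟩
      exact B.one l hl
  rw [this, Finset.prod_image]
  · apply Finset.prod_congr rfl
    intro l hl
    rw [B.eq h l (Finset.mem_range.1 hl)]
  · intro l hl m hm hlm
    exact B.inj h l (by simpa using hl) m (by simpa using hm) hlm

theorem cyc_R (B : KB κ n ℓ e kap base) (Z : A) (h : 0 < n) (i : Fin n → ZMod e)
    (hZ : ((List.range ℓ).map fun l => if ((κ l : ZMod e) = i ⟨0, h⟩) then
      Z - algebraMap O A (qintU t (κ l - ((i ⟨0, h⟩).val : ℤ))) else 1).prod * f i = 0)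
    (hf : f i ≠ 0) : kap (i ⟨0, h⟩) = 1 ∧
      Z * f i = qintU t (base (i ⟨0, h⟩) - ((i ⟨0, h⟩).val : ℤ)) • f i := by
  by_cases hx : ∃ l < ℓ, (κ l : ZMod e) = i ⟨0, h⟩
  · obtain ⟨l, hl, hx⟩ := hx
    refine ⟨by rw [← hx]; exact B.one l hl, ?_⟩
    rw [list_prod_single (P := fun l => (κ l : ZMod e) = i ⟨0, h⟩) _ ℓ l hl hx (fun m hm hP => B.inj h m hm l hl (by rw [hP, hx])), sub_mul,
      ← Algebra.smul_def, sub_eq_zero] at hZ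
    rw [hZ]
    congr 3
    rw [← hx, B.eq h l hl]
  · rw [list_prod_one (P := fun l => (κ l : ZMod e) = i ⟨0, h⟩), one_mul] at hZ
    · exact absurd hZ hf
    · intro l hl hP
      exact hx ⟨l, hl, hP⟩

end CSide
end Paper

open scoped BigOperators
open scoped Classical
namespace Paper

section Lifts
variable {O : Type*} [CommRing O] {A : Type*} [Ring A] [Algebra O A] {t : Oˣ}
variable {e : ℕ} [NeZero e] {n ℓ : ℕ} {κ : ℕ → ℤ}

theorem exists_lift_H (L : Fin n → A) (T : Fin (n - 1) → A) (hLL : ∀ j k, L j * L k = L k * L j)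
    (H : HRel t L T) (hcyc : ∀ h : 0 < n, ((List.range ℓ).map fun l =>
      L ⟨0, h⟩ - algebraMap O A (qintU t (κ l))).prod = 0) :
    ∃ F : CycHecke O t n ℓ κ →ₐ[O] A, (∀ k, F (Lgen O t n ℓ κ k) = L k) ∧
      ∀ r, F (Tgen O t n ℓ κ r) = T r := by
  let F0 : FreeAlgebra O (HeckeGen n) →ₐ[O] A :=
    FreeAlgebra.lift O (fun g => match g with
      | HeckeGen.L k => L k
      | HeckeGen.T r => T r)
  have hL : ∀ k, F0 (hL O k) = L k := fun k => by simp [F0, hL]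
  have hT : ∀ k, F0 (hT O k) = T k := fun k => by simp [F0, hT]
  have hrel : ∀ ⦃a b⦄, HeckeRel O t n ℓ κ a b → F0 a = F0 b := by
    intro a b h
    cases h with
    | cyc h =>
      rw [map_list_prod, List.map_map, map_zero, ← hcyc h]
      congr 2
      funext l
      simp [hL]
    | quad r =>
      have := H.quad r
      simp only [map_mul, map_add, map_sub, hT, map_one, map_zero, AlgHom.commutes]
      rw [add_mul, mul_sub, this, one_mul, Algebra.algebraMap_eq_smul_one, mul_smul_comm, mul_one]
      module
    | LL k m => simp only [map_mul, hL]; exact hLL k m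
    | TTfar r s h => simp only [map_mul, hT]; exact H.far r s h
    | braid r s h => simp only [map_mul, hT]; exact H.braid r s h
    | TL r k h => simp only [map_mul, hT, hL]; exact H.TL r k h
    | LT r =>
      have := H.LT r
      simp only [map_mul, map_add, map_sub, hT, hL, map_one, AlgHom.commutes]
      rw [mul_add, mul_sub, this, mul_one, Algebra.algebraMap_eq_smul_one, mul_smul_comm, mul_one]
      module
  refine ⟨RingQuot.liftAlgHom O ⟨F0, hrel⟩, ?_, ?_⟩
  · intro k
    rw [Lgen, RingQuot.liftAlgHom_mkAlgHom_apply, hL]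
  · intro k
    rw [Tgen, RingQuot.liftAlgHom_mkAlgHom_apply, hT]

theorem exists_lift_K {f : (Fin n → ZMod e) → A} {ps : Fin (n - 1) → A} {y : Fin n → A}
    (H : KRel t f ps y)
    (hno : ∀ (r : Fin (n - 1)) (x z : ZMod e), x = z + 1 → z = x + 1 → False)
    (hcyc : ∀ (h : 0 < n) (i : Fin n → ZMod e),
      ((List.range ℓ).map fun l => if ((κ l : ZMod e) = i ⟨0, h⟩) then
      y ⟨0, h⟩ - algebraMap O A (qintU t (κ l - ((i ⟨0, h⟩).val : ℤ)))
            else 1).prod * f i = 0) :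
    ∃ F : DefKLR O t n e ℓ κ →ₐ[O] A, (∀ i, F (DfGen O t n e ℓ κ i) = f i) ∧
      (∀ r, F (DpsiGen O t n e ℓ κ r) = ps r) ∧ ∀ k, F (DyGen O t n e ℓ κ k) = y k := by
  let F0 : FreeAlgebra O (KLRGen n e) →ₐ[O] A :=
    FreeAlgebra.lift O (fun g => match g with
      | KLRGen.idem i => f i
      | KLRGen.psi r => ps r
      | KLRGen.y k => y k)
  have hE : ∀ i, F0 (kE O i) = f i := fun k => by simp [F0, kE]
  have hP : ∀ r, F0 (kPsi O r) = ps r := fun k => by simp [F0, kPsi]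
  have hY : ∀ k, F0 (kY O k) = y k := fun k => by simp [F0, kY]
  have hD : ∀ d k, F0 (ydot O t d k) = yd t d (y k) := fun d k => by
    simp only [ydot, yd, map_add, map_mul, AlgHom.commutes, hY]
  have hrel : ∀ ⦃a b⦄, DefKLRRel O t n e ℓ κ a b → F0 a = F0 b := by
    intro a b h
    cases h with
    | cyc h i =>
      rw [map_mul, hE, map_list_prod, List.map_map, map_zero, ← hcyc h i]
      congr 3
      funext l
      simp only [Function.comp]
      split_ifs
      · rw [map_sub, hY, AlgHom.commutes]
      · rw [map_one]
    | orth i j h => simp only [map_mul, hE, map_zero]; exact H.orth i j h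
    | idem i => simp only [map_mul, hE]; exact H.idem i
    | complete => simp only [map_sum, hE, map_one]; exact H.sum
    | yE k i => simp only [map_mul, hE, hY]; exact H.yf k i
    | psiE r i => simp only [map_mul, hE, hP]; exact H.psf r i
    | yy k m => simp only [map_mul, hY]; exact H.yy k m
    | psiyEq r i h => simp only [map_mul, map_add, map_one, hE, hP, hY]; exact H.psiyEq r i h
    | psiyNe r i h => simp only [map_mul, map_add, map_one, hE, hP, hY]; exact H.psiyNe r i h
    | ypsiEq r i h => simp only [map_mul, map_add, map_one, hE, hP, hY]; exact H.ypsiEq r i h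
    | ypsiNe r i h => simp only [map_mul, map_add, map_one, hE, hP, hY]; exact H.ypsiNe r i h
    | psiyFar r k h => simp only [map_mul, hP, hY]; exact H.psiyFar r k h
    | psipsiFar r s h => simp only [map_mul, hP]; exact H.far r s h
    | quadEq r i h => simp only [map_mul, hE, hP, map_zero, pow_two]; exact H.quadEq r i h
    | quadR r i h1 h2 =>
      simp only [map_mul, map_sub, hE, hP, hY, hD, pow_two]; exact H.quadR r i h1 h2
    | quadL r i h1 h2 =>
      simp only [map_mul, map_sub, hE, hP, hY, hD, pow_two]; exact H.quadL r i h1 h2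
    | quadBoth r i h1 h2 => exact (hno r _ _ h1 h2).elim
    | quadNone r i h1 h2 h3 =>
      simp only [map_mul, hE, hP, pow_two]; exact H.quadNone r i h1 h2 h3
    | braidBoth r hr i h0 h1 h2 => exact (hno r _ _ h1 h2).elim
    | braidR r hr i h0 h1 h2 =>
      simp only [map_mul, map_sub, hE, hP, AlgHom.commutes]
      exact H.braidR r ⟨r.1 + 1, hr⟩ i rfl h0 h1 h2
    | braidL r hr i h0 h1 h2 =>
      simp only [map_mul, map_sub, hE, hP]
      exact H.braidL r ⟨r.1 + 1, hr⟩ i rfl h0 h1 h2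
    | braidNone r hr i h =>
      simp only [map_mul, map_sub, hE, hP, map_zero]
      exact H.braidNone r ⟨r.1 + 1, hr⟩ i rfl h
  refine ⟨RingQuot.liftAlgHom O ⟨F0, hrel⟩, ?_, ?_, ?_⟩
  · intro k
    rw [DfGen, RingQuot.liftAlgHom_mkAlgHom_apply, hE]
  · intro k
    rw [DpsiGen, RingQuot.liftAlgHom_mkAlgHom_apply, hP]
  · intro k
    rw [DyGen, RingQuot.liftAlgHom_mkAlgHom_apply, hY]

theorem gen_LL (j k) : Lgen O t n ℓ κ j * Lgen O t n ℓ κ k =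
    Lgen O t n ℓ κ k * Lgen O t n ℓ κ j := by
  have := RingQuot.mkAlgHom_rel O (HeckeRel.LL (R := O) (t := t) (ℓ := ℓ) (κ := κ) j k)
  simp only [map_mul] at this
  exact this

theorem gen_cycH (h : 0 < n) : ((List.range ℓ).map fun l =>
      Lgen O t n ℓ κ ⟨0, h⟩ - algebraMap O _ (qintU t (κ l))).prod = 0 := by
  have := RingQuot.mkAlgHom_rel O (HeckeRel.cyc (R := O) (t := t) (ℓ := ℓ) (κ := κ) h)
  rw [map_list_prod, List.map_map, map_zero] at this
  rw [← this]
  congr 2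
  funext l
  simp only [Function.comp, map_sub, AlgHom.commutes]
  rfl

theorem gen_HRel : HRel t (Lgen O t n ℓ κ) (Tgen O t n ℓ κ) := by
  refine ⟨?_, ?_, ?_, ?_, ?_⟩
  · intro r
    have := RingQuot.mkAlgHom_rel O (HeckeRel.quad (R := O) (t := t) (ℓ := ℓ) (κ := κ) r)
    simp only [map_mul, map_add, map_sub, map_one, map_zero, AlgHom.commutes] at this
    change (Tgen O t n ℓ κ r + 1) * (Tgen O t n ℓ κ r - _) = 0 at this
    rw [add_mul, mul_sub, one_mul, Algebra.algebraMap_eq_smul_one, mul_smul_comm, mul_one] at this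
    linear_combination (norm := module) this
  · intro r s h
    have := RingQuot.mkAlgHom_rel O (HeckeRel.TTfar (R := O) (t := t) (ℓ := ℓ) (κ := κ) r s h)
    simp only [map_mul] at this
    exact this
  · intro r s h
    have := RingQuot.mkAlgHom_rel O (HeckeRel.braid (R := O) (t := t) (ℓ := ℓ) (κ := κ) r s h)
    simp only [map_mul] at this
    exact this
  · intro r k h
    have := RingQuot.mkAlgHom_rel O (HeckeRel.TL (R := O) (t := t) (ℓ := ℓ) (κ := κ) r k h)
    simp only [map_mul] at this
    exact this
  · intro r
    have := RingQuot.mkAlgHom_rel O (HeckeRel.LT (R := O) (t := t) (ℓ := ℓ) (κ := κ) r)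
    simp only [map_mul, map_add, map_sub, map_one, AlgHom.commutes] at this
    change Lgen O t n ℓ κ (pR r) * (Tgen O t n ℓ κ r - _ + 1) =
      Tgen O t n ℓ κ r * Lgen O t n ℓ κ (pL r) + 1 at this
    rw [mul_add, mul_sub, mul_one, Algebra.algebraMap_eq_smul_one, mul_smul_comm, mul_one] at this
    linear_combination (norm := module) this

theorem gen_cycK (h : 0 < n) (i : Fin n → ZMod e) :
    ((List.range ℓ).map fun l => if ((κ l : ZMod e) = i ⟨0, h⟩) then
      DyGen O t n e ℓ κ ⟨0, h⟩ - algebraMap O _ (qintU t (κ l - ((i ⟨0, h⟩).val : ℤ)))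
            else 1).prod * DfGen O t n e ℓ κ i = 0 := by
  have := RingQuot.mkAlgHom_rel O (DefKLRRel.cyc (R := O) (t := t) (ℓ := ℓ) (κ := κ) h i)
  rw [map_mul, map_list_prod, List.map_map, map_zero] at this
  rw [← this]
  congr 3
  funext l
  simp only [Function.comp]
  split_ifs
  · rw [map_sub, AlgHom.commutes]
    rfl
  · rw [map_one]

theorem mk_ydot (d : ℤ) (k : Fin n) :
    RingQuot.mkAlgHom O (DefKLRRel O t n e ℓ κ) (ydot O t d k) = yd t d (DyGen O t n e ℓ κ k) := by
  simp only [ydot, yd, map_add, map_mul, AlgHom.commutes]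
  rfl

theorem gen_KRel : KRel t (DfGen O t n e ℓ κ) (DpsiGen O t n e ℓ κ) (DyGen O t n e ℓ κ) := by
  have M : ∀ {a b}, DefKLRRel O t n e ℓ κ a b → RingQuot.mkAlgHom O (DefKLRRel O t n e ℓ κ) a =
      RingQuot.mkAlgHom O (DefKLRRel O t n e ℓ κ) b := fun h => RingQuot.mkAlgHom_rel O h
  refine ⟨?_, ?_, ?_, ?_, ?_, ?_, ?_, ?_, ?_, ?_, ?_, ?_, ?_, ?_, ?_, ?_, ?_, ?_, ?_⟩
  · have := M DefKLRRel.complete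
    simp only [map_sum, map_one] at this
    exact this
  · intro i
    have := M (DefKLRRel.idem i)
    simp only [map_mul] at this
    exact this
  · intro i j h
    have := M (DefKLRRel.orth i j h)
    simp only [map_mul, map_zero] at this
    exact this
  · intro k i
    have := M (DefKLRRel.yE k i)
    simp only [map_mul] at this
    exact this
  · intro r i
    have := M (DefKLRRel.psiE r i)
    simp only [map_mul] at this
    exact this
  · intro k m
    have := M (DefKLRRel.yy k m)
    simp only [map_mul] at this
    exact this
  · intro r i h
    have := M (DefKLRRel.psiyEq r i h)
    simp only [map_mul, map_add, map_one] at this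
    exact this
  · intro r i h
    have := M (DefKLRRel.psiyNe r i h)
    simp only [map_mul, map_add, map_one] at this
    exact this
  · intro r i h
    have := M (DefKLRRel.ypsiEq r i h)
    simp only [map_mul, map_add, map_one] at this
    exact this
  · intro r i h
    have := M (DefKLRRel.ypsiNe r i h)
    simp only [map_mul, map_add, map_one] at this
    exact this
  · intro r k h
    have := M (DefKLRRel.psiyFar r k h)
    simp only [map_mul] at this
    exact this
  · intro r s h
    have := M (DefKLRRel.psipsiFar r s h)
    simp only [map_mul] at this
    exact this
  · intro r i h
    have := M (DefKLRRel.quadEq r i h)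
    simp only [map_mul, map_zero, pow_two] at this
    exact this
  · intro r i h1 h2
    have := M (DefKLRRel.quadR r i h1 h2)
    simp only [map_mul, map_sub, mk_ydot, pow_two] at this
    exact this
  · intro r i h1 h2
    have := M (DefKLRRel.quadL r i h1 h2)
    simp only [map_mul, map_sub, mk_ydot, pow_two] at this
    exact this
  · intro r i h1 h2 h3
    have := M (DefKLRRel.quadNone r i h1 h2 h3)
    simp only [map_mul, pow_two] at this
    exact this
  · intro r s i hs h0 h1 h2
    have hr : r.1 + 1 < n - 1 := by rw [← hs]; exact s.2
    obtain rfl : s = ⟨r.1 + 1, hr⟩ := Fin.ext hs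
    have := M (DefKLRRel.braidR r hr i h0 h1 h2)
    rw [map_mul, map_mul, AlgHom.commutes] at this
    simp only [map_mul, map_sub] at this
    exact this
  · intro r s i hs h0 h1 h2
    have hr : r.1 + 1 < n - 1 := by rw [← hs]; exact s.2
    obtain rfl : s = ⟨r.1 + 1, hr⟩ := Fin.ext hs
    have := M (DefKLRRel.braidL r hr i h0 h1 h2)
    simp only [map_mul, map_sub] at this
    exact this
  · intro r s i hs h
    have hr : r.1 + 1 < n - 1 := by rw [← hs]; exact s.2
    obtain rfl : s = ⟨r.1 + 1, hr⟩ := Fin.ext hs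
    have := M (DefKLRRel.braidNone r hr i h)
    simp only [map_mul, map_sub, map_zero] at this
    exact this

theorem map_DD {B : Type*} [Ring B] [Algebra O B] (F : A →ₐ[O] B) (f : (Fin n → ZMod e) → A)
    (g : (Fin n → ZMod e) → B) (h : ∀ i, F (f i) = g i) (s : (Fin n → ZMod e) → O) :
    F (DD f s) = DD g s := by
  unfold DD
  rw [map_sum]
  exact Finset.sum_congr rfl (fun i _ => by rw [map_smul, h])

theorem main_iso [IsDomain O] {kap base : ZMod e → ℤ} (S : Setup t e n kap base)
    (B : KB κ n ℓ e kap base) : Nonempty (CycHecke O t n ℓ κ ≃ₐ[O] DefKLR O t n e ℓ κ) := by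
  -- the Hecke side
  obtain ⟨fH, WH, hLH, hvH⟩ := H_side S (Lgen O t n ℓ κ) (Tgen O t n ℓ κ) gen_LL gen_HRel
    (fun h => cyc_H' B h _ (gen_cycH h))
  have hLf : Lgen O t n ℓ κ = fun k => DD fH (fun i => CC t base i k) := funext hLH
  have HR := gen_HRel (O := O) (t := t) (n := n) (ℓ := ℓ) (κ := κ)
  rw [hLf] at HR
  obtain ⟨PH, hT⟩ := B_side WH HR
  obtain ⟨Ps, p1, p2, p3⟩ := exists_lift_K (κ := κ) (ℓ := ℓ) (C_side S WH PH)
    (fun r x z h1 h2 => S.adj_ne r h1 h2) (fun h i => cyc_K B WH hvH h i)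
  -- the quiver Hecke side
  have hc := fun (h : 0 < n) i => cyc_R (f := DfGen O t n e ℓ κ) B (DyGen O t n e ℓ κ ⟨0, h⟩) h i
    (gen_cycK h i)
  obtain ⟨WR, PR, hyR⟩ := R_side S (gen_KRel (O := O) (t := t) (n := n) (e := e) (ℓ := ℓ) (κ := κ))
    (fun h i hf => (hc h i hf).1) (fun h i hf => (hc h i hf).2)
  obtain ⟨Ph, q1, q2⟩ := exists_lift_H (κ := κ) (ℓ := ℓ) _ _ (fun j k => DD_comm WR _ _)
    (A_side WR PR) (fun h => cyc_H B WR (fun h i hf => (hc h i hf).1) h)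
  have q3 : ∀ i, Ph (fH i) = DfGen O t n e ℓ κ i := by
    apply uniq_f WR (fun i => Ph (fH i))
    · rw [← map_sum, WH.sum, map_one]
    · intro i k
      rw [← q1 k, ← map_mul, hLH k, DD_f WH, map_smul]
  refine ⟨AlgEquiv.ofAlgHom Ph Ps ?_ ?_⟩
  · apply RingQuot.ringQuot_ext'
    apply FreeAlgebra.hom_ext
    funext g
    cases g with
    | idem i =>
      show Ph (Ps (DfGen O t n e ℓ κ i)) = DfGen O t n e ℓ κ i
      rw [p1, q3]
    | psi r =>
      show Ph (Ps (DpsiGen O t n e ℓ κ r)) = DpsiGen O t n e ℓ κ r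
      rw [p2, map_mul, map_sub, q2]
      simp only [aT]
      rw [map_DD Ph _ _ q3, map_DD Ph _ _ q3, add_sub_cancel_right]
      apply ext_f WR
      intro i
      by_cases hf : DfGen O t n e ℓ κ i = 0
      · rw [hf, mul_zero, mul_zero]
      rw [mul_assoc, DD_f WR, mul_smul_comm, mul_assoc, DD_f WR, mul_smul_comm, smul_smul,
        qq_gg WR _ _ _ (WR.ne1 i r hf), one_smul]
    | y k =>
      show Ph (Ps (DyGen O t n e ℓ κ k)) = DyGen O t n e ℓ κ k
      rw [p3, map_DD Ph _ _ q3, hyR]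
  · apply RingQuot.ringQuot_ext'
    apply FreeAlgebra.hom_ext
    funext g
    cases g with
    | L k =>
      show Ps (Ph (Lgen O t n ℓ κ k)) = Lgen O t n ℓ κ k
      rw [q1, map_DD Ps _ _ p1, hLH]
    | T r =>
      show Ps (Ph (Tgen O t n ℓ κ r)) = Tgen O t n ℓ κ r
      rw [q2, map_add, map_mul]
      simp only [aT]
      rw [map_DD Ps _ _ p1, map_DD Ps _ _ p1, p2]
      exact (hT r).symm

end Lifts

theorem main_final (n ℓ e : ℕ) (he : 2 ≤ e) [NeZero e] (κ : ℕ → ℤ) (K : Type) [Field K]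
    (O : Subring K) (t : Oˣ) (hO : IsIdempotentSubring O t e n ℓ κ) :
    Nonempty (CycHecke O t n ℓ κ ≃ₐ[O] DefKLR O t n e ℓ κ) := by
  obtain ⟨h1, h2, h3⟩ := hO
  have hnu : ∀ k : ℤ, (e : ℤ) ∣ k → ¬ IsUnit (qintU t k) := by
    intro k hk hu
    have h4 := Ideal.eq_top_of_isUnit_mem _ (h3 k hk) hu
    rw [Ideal.jacobson_eq_top_iff] at h4
    exact bot_ne_top h4
  obtain ⟨ha, hb⟩ := IsUnit.mul_iff.1 h1
  have hne : n < e := by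
    by_contra hc
    refine hnu e dvd_rfl (isUnit_of_dvd_unit ?_ ha)
    exact Finset.dvd_prod_of_mem (fun d : ℕ => qintU t (d : ℤ)) (Finset.mem_Icc.2 ⟨by omega, by omega⟩)
  have hsep0 : ∀ l m, l < m → m < ℓ → ∀ d : ℤ, -(n : ℤ) < d → d < n →
      ¬ (e : ℤ) ∣ κ l - κ m + d := by
    intro l m hlm hm d hd1 hd2 hdv
    refine hnu _ hdv (isUnit_of_dvd_unit ?_ hb)
    refine dvd_trans ?_ (Finset.dvd_prod_of_mem _ (Finset.mem_range.2 (lt_trans hlm hm)))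
    refine dvd_trans ?_ (Finset.dvd_prod_of_mem _ (Finset.mem_Ioo.2 ⟨hlm, hm⟩))
    exact Finset.dvd_prod_of_mem (fun d : ℤ => qintU t (κ l - κ m + d)) (Finset.mem_Ioo.2 ⟨hd1, hd2⟩)
  have hsep : ∀ l m, l < ℓ → m < ℓ → l ≠ m → ∀ d : ℤ, -(n : ℤ) < d → d < n →
      ¬ (e : ℤ) ∣ κ l - κ m + d := by
    intro l m hl hm hlm d hd1 hd2 hdv
    rcases Nat.lt_or_gt_of_ne hlm with h | h
    · exact hsep0 l m h hm d hd1 hd2 hdv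
    · refine hsep0 m l h hl (-d) (by omega) (by omega) ?_
      have := (dvd_neg).2 hdv
      rwa [show -(κ l - κ m + d) = κ m - κ l + -d by ring] at this
  have hinj : 0 < n → ∀ l < ℓ, ∀ m < ℓ, (κ l : ZMod e) = κ m → l = m := by
    intro hn l hl m hm hlm
    by_contra hc
    apply hsep l m hl hm hc 0 (by omega) (by omega)
    rw [add_zero, ← ZMod.intCast_zmod_eq_zero_iff_dvd]
    push_cast
    rw [hlm, sub_self]
  let kap : ZMod e → ℤ := fun x => if ∃ l < ℓ, (κ l : ZMod e) = x then 1 else 0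
  let base : ZMod e → ℤ := fun x => if h : ∃ l < ℓ, (κ l : ZMod e) = x then κ h.choose else x.val
  have hkap : ∀ x, kap x = 1 → ∃ l < ℓ, (κ l : ZMod e) = x := by
    intro x hx
    by_contra hc
    simp [kap, if_neg hc] at hx
  refine main_iso (kap := kap) (base := base) ⟨he, hne, ?_, ?_, ?_, ?_, h2⟩ ⟨hkap, ?_, ?_, hinj⟩
  · intro x; simp only [kap]; split_ifs <;> simp
  · intro x; simp only [kap]; split_ifs <;> simp
  · intro x k hk1 hkn hx hxk
    obtain ⟨l, hl, rfl⟩ := hkap _ hx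
    obtain ⟨m, hm, hmk⟩ := hkap _ hxk
    have hz : (((κ l - κ m + k : ℤ)) : ZMod e) = 0 := by
      push_cast
      rw [hmk]
      ring
    rw [ZMod.intCast_zmod_eq_zero_iff_dvd] at hz
    by_cases hlm : l = m
    · subst hlm
      rw [sub_self, zero_add] at hz
      have := Int.le_of_dvd (by omega) hz
      omega
    · exact hsep l m hl hm hlm k (by omega) (by omega) hz
  · intro x
    by_cases h : ∃ l < ℓ, (κ l : ZMod e) = x
    · simp only [base, dif_pos h]
      exact h.choose_spec.2
    · simp only [base, dif_neg h]
      simp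
  · intro l hl
    simp only [kap]
    rw [if_pos ⟨l, hl, rfl⟩]
  · intro hn l hl
    have h : ∃ m < ℓ, (κ m : ZMod e) = (κ l : ZMod e) := ⟨l, hl, rfl⟩
    simp only [base, dif_pos h]
    rw [hinj hn _ h.choose_spec.1 l hl h.choose_spec.2]

end Paper

namespace Paper

/-- Theorem A: if `(O, t)` is an `e`-idempotent subring of a field `K`
and `κ` is a multicharge with `κ_l - κ_{l+1} ≥ n`, then the integral cyclotomic Hecke
algebra `H_n(O, t, κ)` is isomorphic, as a unital `O`-algebra, to the deformed
cyclotomic quiver Hecke algebra `R_n(O)`; i.e. it is generated by elements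
`f_i, ψ_r, y_k` subject only to the deformed KLR relations. -/
theorem deformed_KLR_presentation
    (n ℓ e : ℕ) (hℓ : 1 ≤ ℓ) (he : 2 ≤ e) [NeZero e]
    (κ : ℕ → ℤ) (hκ : ∀ l, l + 1 < ℓ → (n : ℤ) ≤ κ l - κ (l + 1))
    (K : Type) [Field K] (O : Subring K) (t : Oˣ)
    (hO : IsIdempotentSubring O t e n ℓ κ) :
    Nonempty (CycHecke O t n ℓ κ ≃ₐ[O] DefKLR O t n e ℓ κ) := by
  exact main_final n ℓ e he κ K O t hO

end Paper
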